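/- arXiv:2002.12353 — 3 statements merged into one kernel-verified Lean document; each statement's English description precedes it below -/
import Mathlib

section
/- Let g ≥ 5 be a Sophie Germain prime and let h denote the cardinality of the class group of the order ℤ[√-(2g+1)]. Then the set of primes p with p ≠ 2g+1 that are representable as p = x² + (2g+1)y² for some integers x, y has relative natural density 1/(2h) among all primes; that is, #{p ≤ x : p prime, p ≠ 2g+1, p = x₀² + (2g+1)y₀² for some integers x₀, y₀} / #{p ≤ x : p prime} tends to 1/(2h) as x → ∞. -/
section wienerIkehara

open MeasureTheory Filter Topology Set Complex

/-- The Fejér kernel, the Fourier transform of the triangle function. -/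
noncomputable def fejerKernel (u : ℝ) : ℝ := Real.sinc (u / 2) ^ 2

lemma continuous_fejerKernel : Continuous fejerKernel := by
  unfold fejerKernel
  exact (Real.continuous_sinc.comp (continuous_id.div_const 2)).pow 2

lemma fejerKernel_nonneg (u : ℝ) : 0 ≤ fejerKernel u := sq_nonneg _

lemma fejerKernel_le (u : ℝ) : fejerKernel u ≤ 8 * (1 + u ^ 2)⁻¹ := by
  unfold fejerKernel
  rw [← div_eq_mul_inv, le_div_iff₀ (by positivity)]
  have h1 : Real.sinc (u / 2) ^ 2 ≤ 1 := by
    rw [sq_le_one_iff_abs_le_one]; exact Real.abs_sinc_le_one _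
  have h2 : Real.sinc (u / 2) ^ 2 * u ^ 2 ≤ 4 := by
    rcases eq_or_ne u 0 with rfl | hu
    · simp
    rw [Real.sinc_of_ne_zero (by positivity), div_pow, div_pow]
    have := Real.sin_sq_le_one (u / 2)
    field_simp
    linarith
  nlinarith

lemma integrable_fejerKernel : Integrable fejerKernel :=
  (integrable_inv_one_add_sq.const_mul 8).mono' continuous_fejerKernel.aestronglyMeasurable
    (ae_of_all _ fun u ↦ by
      rw [Real.norm_of_nonneg (fejerKernel_nonneg u)]; exact fejerKernel_le u)

lemma integral_fejerKernel_pos : 0 < ∫ u, fejerKernel u := by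
  refine integral_pos_of_integrable_nonneg_nonzero (x := 0) continuous_fejerKernel
    integrable_fejerKernel (fun u ↦ fejerKernel_nonneg u) ?_
  simp [fejerKernel]

lemma integral_one_sub_mul_exp {v : ℂ} (hv : v ≠ 0) :
    ∫ y in (0 : ℝ)..1, (1 - (y : ℂ)) * cexp (v * y) = cexp v / v ^ 2 - 1 / v - 1 / v ^ 2 := by
  have hd : ∀ y ∈ uIcc (0 : ℝ) 1, HasDerivAt
      (fun y : ℝ ↦ cexp (v * y) * ((1 - (y : ℂ)) / v + 1 / v ^ 2))
      ((1 - (y : ℂ)) * cexp (v * y)) y := by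
    intro y _
    have h1 : HasDerivAt (fun y : ℝ ↦ (y : ℂ)) 1 y := ofRealCLM.hasDerivAt
    have h2 : HasDerivAt (fun y : ℝ ↦ cexp (v * y)) (cexp (v * y) * (v * 1)) y :=
      (h1.const_mul v).cexp
    have h3 : HasDerivAt (fun y : ℝ ↦ (1 - (y : ℂ)) / v + 1 / v ^ 2) (-1 / v) y :=
      ((h1.const_sub 1).div_const v).add_const _
    convert! h2.mul h3 using 1
    field_simp
    ring
  rw [intervalIntegral.integral_eq_sub_of_hasDerivAt hd
    (by apply Continuous.intervalIntegrable; fun_prop)]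
  simp
  ring

lemma integral_triangle_mul_exp (v : ℝ) :
    ∫ y in (-1 : ℝ)..1, ((1 - |y| : ℝ) : ℂ) * cexp (v * I * y) = fejerKernel v := by
  rcases eq_or_ne v 0 with rfl | hv
  · simp only [ofReal_zero, zero_mul, Complex.exp_zero, mul_one]
    rw [intervalIntegral.integral_ofReal, ← intervalIntegral.integral_add_adjacent_intervals
      (b := 0) (by apply Continuous.intervalIntegrable; fun_prop)
      (by apply Continuous.intervalIntegrable; fun_prop)]
    have h1 : ∫ y in (-1 : ℝ)..0, (1 - |y|) = ∫ y in (-1 : ℝ)..0, (1 + y) := by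
      refine intervalIntegral.integral_congr fun y hy ↦ ?_
      rw [uIcc_of_le (by norm_num)] at hy
      simp [abs_of_nonpos hy.2]
    have h2 : ∫ y in (0 : ℝ)..1, (1 - |y|) = ∫ y in (0 : ℝ)..1, (1 - y) := by
      refine intervalIntegral.integral_congr fun y hy ↦ ?_
      rw [uIcc_of_le (by norm_num)] at hy
      simp [abs_of_nonneg hy.1]
    rw [h1, h2, intervalIntegral.integral_add (by simp) (by simp),
      intervalIntegral.integral_sub (by simp) (by simp)]
    simp [fejerKernel]
    norm_num
  · rw [← intervalIntegral.integral_add_adjacent_intervals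
      (b := 0) (by apply Continuous.intervalIntegrable; fun_prop)
      (by apply Continuous.intervalIntegrable; fun_prop)]
    have h1 : ∫ y in (-1 : ℝ)..0, ((1 - |y| : ℝ) : ℂ) * cexp (v * I * y) =
        ∫ y in (0 : ℝ)..1, (1 - (y : ℂ)) * cexp ((-(v * I)) * y) := by
      have := intervalIntegral.integral_comp_neg (a := 0) (b := 1)
        (fun y : ℝ ↦ ((1 - |y| : ℝ) : ℂ) * cexp (v * I * y))
      rw [neg_zero] at this
      rw [← this]
      refine intervalIntegral.integral_congr fun y hy ↦ ?_
      rw [uIcc_of_le (by norm_num)] at hy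
      simp [abs_of_nonneg hy.1]
    have h2 : ∫ y in (0 : ℝ)..1, ((1 - |y| : ℝ) : ℂ) * cexp (v * I * y) =
        ∫ y in (0 : ℝ)..1, (1 - (y : ℂ)) * cexp ((v * I) * y) := by
      refine intervalIntegral.integral_congr fun y hy ↦ ?_
      rw [uIcc_of_le (by norm_num)] at hy
      simp [abs_of_nonneg hy.1]
    have hv' : (v : ℂ) * I ≠ 0 := by simp [hv]
    rw [h1, h2, integral_one_sub_mul_exp (neg_ne_zero.mpr hv'), integral_one_sub_mul_exp hv']
    have h3 : cexp (v * I) + cexp (-(v * I)) = 2 - 4 * (Real.sin (v / 2) : ℂ) ^ 2 := by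
      have h4 := Complex.cos_two_mul (v / 2)
      have h5 := Complex.sin_sq_add_cos_sq (v / 2)
      rw [show 2 * ((v : ℂ) / 2) = v by ring] at h4
      rw [← neg_mul, ← Complex.two_cos, h4]
      push_cast
      linear_combination 4 * h5
    unfold fejerKernel
    rw [Real.sinc_of_ne_zero (by positivity)]
    have h6 : cexp (-(v * I)) = 2 - 4 * (Real.sin (v / 2) : ℂ) ^ 2 - cexp (v * I) := by
      rw [← h3]; ring
    rw [h6]
    push_cast
    have hv2 : (v : ℂ) ≠ 0 := by exact_mod_cast hv
    have : ((v : ℂ) * I) ^ 2 = - v ^ 2 := by rw [mul_pow, I_sq]; ring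
    rw [neg_sq, this]
    field_simp
    ring

lemma integral_triangle_scaled_mul_exp {l : ℝ} (hl : 0 < l) (v : ℝ) :
    ∫ y in (-l)..l, ((1 - |y / l| : ℝ) : ℂ) * cexp (v * I * y) = (l * fejerKernel (l * v) : ℝ) := by
  have := intervalIntegral.smul_integral_comp_mul_left (a := -1) (b := 1)
    (fun y : ℝ ↦ ((1 - |y / l| : ℝ) : ℂ) * cexp (v * I * y)) l
  rw [mul_neg_one, mul_one] at this
  rw [← this, ofReal_mul, ← integral_triangle_mul_exp, real_smul]
  congr 1
  refine intervalIntegral.integral_congr fun y _ ↦ ?_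
  rw [mul_div_cancel_left₀ _ hl.ne']
  push_cast
  ring_nf

/-- If the Laplace transform of a bounded function extends continuously to the closed right
half-plane, then the convolutions of the function with Fejér kernels vanish at infinity. -/
theorem tendsto_integral_mul_fejerKernel {b : ℝ → ℂ} {C : ℝ} (hbm : Measurable b)
    (hb : ∀ t, ‖b t‖ ≤ C) {G : ℂ → ℂ} (hG : ContinuousOn G {s | 0 ≤ s.re})
    (hbG : ∀ s : ℂ, 0 < s.re → ∫ t in Ioi (0 : ℝ), b t * cexp (-(s * t)) = G s)
    {l : ℝ} (hl : 0 < l) :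
    Tendsto (fun u : ℝ ↦ ∫ t in Ioi (0 : ℝ), b t * (l * fejerKernel (l * (u - t)) : ℝ))
      atTop (𝓝 0) := by
  set k : ℝ → ℂ := fun y ↦ ((1 - |y / l| : ℝ) : ℂ) with hk
  have hkc : Continuous k := by fun_prop
  have hC : 0 ≤ C := (norm_nonneg _).trans (hb 0)
  -- the Fubini step
  have step1 : ∀ u ε : ℝ, 0 < ε →
      ∫ y in Ioc (-l) l, k y * cexp (u * I * y) * G (ε + y * I) =
        ∫ t in Ioi (0 : ℝ), b t * cexp (-(ε * t)) * (l * fejerKernel (l * (u - t)) : ℝ) := by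
    intro u ε hε
    have e1 : ∀ y : ℝ, k y * cexp (u * I * y) * G (ε + y * I) = ∫ t in Ioi (0 : ℝ),
        cexp (-(y * I * t)) * ((k y * cexp (u * I * y)) * (b t * cexp (-(ε * t)))) := by
      intro y
      rw [← hbG _ (by simpa using hε), ← integral_const_mul]
      refine integral_congr_ae (ae_of_all _ fun t ↦ ?_)
      simp only
      rw [add_mul, neg_add, Complex.exp_add]
      ring
    have e2 : ∀ t : ℝ, b t * cexp (-(ε * t)) * (l * fejerKernel (l * (u - t)) : ℝ) =
        ∫ y in Ioc (-l) l,
          cexp (-(y * I * t)) * ((k y * cexp (u * I * y)) * (b t * cexp (-(ε * t)))) := by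
      intro t
      rw [← integral_triangle_scaled_mul_exp hl, intervalIntegral.integral_of_le (by linarith),
        ← integral_const_mul]
      refine integral_congr_ae (ae_of_all _ fun y ↦ ?_)
      have : cexp ((u - t : ℝ) * I * y) = cexp (u * I * y) * cexp (-(y * I * t)) := by
        rw [← Complex.exp_add]; congr 1; push_cast; ring
      simp only [this]
      ring
    simp_rw [e1, e2]
    refine integral_integral_swap ?_
    refine Integrable.bdd_mul (c := 1) (Integrable.mul_prod
      (f := fun y : ℝ ↦ k y * cexp (u * I * y)) (g := fun t : ℝ ↦ b t * cexp (-(ε * t))) ?_ ?_)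
      ?_ ?_
    · exact (Continuous.integrableOn_Icc (by fun_prop)).mono_set Ioc_subset_Icc_self
    · refine ((exp_neg_integrableOn_Ioi 0 hε).const_mul C).mono'
        (by apply Measurable.aestronglyMeasurable; fun_prop) (ae_of_all _ fun t ↦ ?_)
      rw [norm_mul, Complex.norm_exp]
      gcongr
      · exact hb t
      · simp
    · apply Continuous.aestronglyMeasurable
      fun_prop
    · refine ae_of_all _ fun z ↦ ?_
      rw [Complex.norm_exp]
      simp
  -- the limit `ε → 0`
  have step2 : ∀ u : ℝ, ∫ y in Ioc (-l) l, k y * cexp (u * I * y) * G (y * I) =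
        ∫ t in Ioi (0 : ℝ), b t * (l * fejerKernel (l * (u - t)) : ℝ) := by
    intro u
    have hlim1 : Tendsto (fun ε : ℝ ↦ ∫ y in Ioc (-l) l, k y * cexp (u * I * y) * G (ε + y * I))
        (𝓝[>] 0) (𝓝 (∫ y in Ioc (-l) l, k y * cexp (u * I * y) * G (y * I))) := by
      have hcomp : IsCompact ((fun p : ℝ × ℝ ↦ (p.1 + p.2 * I : ℂ)) '' (Icc 0 1 ×ˢ Icc (-l) l)) :=
        (isCompact_Icc.prod isCompact_Icc).image (by fun_prop)
      obtain ⟨D, hD⟩ := hcomp.exists_bound_of_continuousOn (f := G) (hG.mono (by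
        rintro _ ⟨p, hp, rfl⟩
        simpa using hp.1.1))
      obtain ⟨D', hD'⟩ := isCompact_Icc.exists_bound_of_continuousOn (s := Icc (-l) l)
        hkc.continuousOn
      have hGc : ∀ ε : ℝ, 0 ≤ ε → ContinuousOn (fun y : ℝ ↦ G (ε + y * I)) univ := fun ε hε ↦
        hG.comp (by fun_prop) (fun y _ ↦ by simpa using hε)
      refine tendsto_integral_filter_of_dominated_convergence (fun _ ↦ D' * 1 * D) ?_ ?_
        (integrable_const _) ?_
      · filter_upwards [self_mem_nhdsWithin] with ε hε
        have h := continuousOn_univ.mp (hGc ε (le_of_lt hε))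
        exact Continuous.aestronglyMeasurable (Continuous.mul (by fun_prop) h)
      · filter_upwards [Ioc_mem_nhdsGT one_pos] with ε hε
        rw [ae_restrict_iff' measurableSet_Ioc]
        refine ae_of_all _ fun y hy ↦ ?_
        rw [norm_mul, norm_mul]
        have hy' := Ioc_subset_Icc_self hy
        have h1 := hD' y hy'
        have h2 := hD _ ⟨(ε, y), ⟨⟨hε.1.le, hε.2⟩, hy'⟩, rfl⟩
        have h3 : ‖cexp (u * I * y)‖ = 1 := by rw [Complex.norm_exp]; simp
        rw [h3]
        gcongr
        exact mul_nonneg ((norm_nonneg _).trans h1) zero_le_one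
      · refine ae_of_all _ fun y ↦ Tendsto.const_mul _ ?_
        have h0 : ContinuousWithinAt G {s | 0 ≤ s.re} (y * I) := hG _ (by simp)
        refine h0.tendsto.comp (tendsto_nhdsWithin_iff.mpr ⟨?_, ?_⟩)
        · have : Continuous (fun ε : ℝ ↦ (ε + y * I : ℂ)) := by fun_prop
          convert! (this.tendsto 0).mono_left nhdsWithin_le_nhds using 2
          simp
        · filter_upwards [self_mem_nhdsWithin] with ε hε
          simpa using (le_of_lt hε)
    have hlim2 : Tendsto (fun ε : ℝ ↦ ∫ t in Ioi (0 : ℝ),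
          b t * cexp (-(ε * t)) * (l * fejerKernel (l * (u - t)) : ℝ))
        (𝓝[>] 0) (𝓝 (∫ t in Ioi (0 : ℝ), b t * (l * fejerKernel (l * (u - t)) : ℝ))) := by
      refine tendsto_integral_filter_of_dominated_convergence
        (fun t ↦ C * (l * fejerKernel (l * (u - t)))) ?_ ?_ ?_ ?_
      · have := continuous_fejerKernel
        exact Eventually.of_forall fun ε ↦ by apply Measurable.aestronglyMeasurable; fun_prop
      · filter_upwards [self_mem_nhdsWithin] with ε hε
        rw [ae_restrict_iff' measurableSet_Ioi]
        refine ae_of_all _ fun t ht ↦ ?_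
        rw [norm_mul, norm_mul, Complex.norm_exp, norm_real,
          Real.norm_of_nonneg (mul_nonneg hl.le (fejerKernel_nonneg _))]
        refine mul_le_mul_of_nonneg_right ?_ (mul_nonneg hl.le (fejerKernel_nonneg _))
        rw [← mul_one C]
        gcongr
        · exact hb t
        · rw [Real.exp_le_one_iff]
          simpa using mul_nonneg (le_of_lt hε) (le_of_lt ht)
      · refine (Integrable.const_mul ?_ l).const_mul C |>.integrableOn
        exact ((integrable_fejerKernel.comp_mul_left' hl.ne').comp_sub_left u)
      · refine ae_of_all _ fun t ↦ Tendsto.mul_const _ ?_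
        have : Continuous (fun ε : ℝ ↦ b t * cexp (-(ε * t))) := by fun_prop
        convert! (this.tendsto 0).mono_left nhdsWithin_le_nhds using 2
        simp
    refine tendsto_nhds_unique hlim1 (hlim2.congr' ?_)
    filter_upwards [self_mem_nhdsWithin] with ε hε
    exact (step1 u ε hε).symm
  simp_rw [← step2]
  have hRL := Real.tendsto_integral_exp_smul_cocompact
    (fun y ↦ (Ioc (-l) l).indicator (fun y ↦ k y * G (y * I)) y)
  have hu : Tendsto (fun u : ℝ ↦ -(u / (2 * Real.pi))) atTop (cocompact ℝ) := by
    refine Tendsto.mono_right ?_ atBot_le_cocompact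
    exact tendsto_neg_atTop_atBot.comp (tendsto_id.atTop_div_const (by positivity))
  refine (hRL.comp hu).congr fun u ↦ ?_
  simp only [Function.comp]
  rw [← integral_indicator measurableSet_Ioc]
  refine integral_congr_ae (ae_of_all _ fun y ↦ ?_)
  by_cases hy : y ∈ Ioc (-l) l
  · simp only [indicator_of_mem hy, Circle.smul_def, Real.fourierChar_apply, smul_eq_mul]
    have : 2 * Real.pi * -(y * -(u / (2 * Real.pi))) = u * y := by
      field_simp
    rw [this]
    push_cast
    rw [show (u : ℂ) * y * I = u * I * y by ring]
    ring
  · simp [indicator_of_notMem hy]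

/-- A slowly decreasing bounded function whose Fejér means converge is itself convergent. -/
theorem tendsto_of_tendsto_integral_fejerKernel {B : ℝ → ℝ} {A C : ℝ} (hBm : Measurable B)
    (hB0 : ∀ t, 0 ≤ B t) (hBC : ∀ t, B t ≤ C) (hmono : Monotone fun t ↦ Real.exp t * B t)
    (h : ∀ l > 0, Tendsto
      (fun u : ℝ ↦ ∫ t in Ioi (0 : ℝ), (B t - A) * (l * fejerKernel (l * (u - t))))
      atTop (𝓝 0)) :
    Tendsto B atTop (𝓝 A) := by
  set c := ∫ u, fejerKernel u with hc
  have hcpos : 0 < c := integral_fejerKernel_pos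
  have hKm : Measurable fejerKernel := continuous_fejerKernel.measurable
  set m : ℝ → ℝ := fun R ↦ ∫ v in (-R)..R, fejerKernel v with hm
  have hmlim : Tendsto m atTop (𝓝 c) :=
    intervalIntegral_tendsto_integral integrable_fejerKernel tendsto_neg_atTop_atBot tendsto_id
  set w : ℝ → ℝ → ℝ → ℝ := fun l u t ↦ l * fejerKernel (l * (u - t)) with hw
  have hw0 : ∀ l > 0, ∀ u t, 0 ≤ w l u t := fun l hl u t ↦
    mul_nonneg hl.le (fejerKernel_nonneg _)
  have hwi : ∀ l > 0, ∀ u, Integrable (w l u) := fun l hl u ↦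
    ((integrable_fejerKernel.comp_mul_left' hl.ne').comp_sub_left u).const_mul l
  have hwint : ∀ l > 0, ∀ u a b, ∫ t in a..b, w l u t =
      ∫ v in (l * (u - b))..(l * (u - a)), fejerKernel v := by
    intro l hl u a b
    rw [intervalIntegral.integral_const_mul,
      intervalIntegral.integral_comp_sub_left (fun t ↦ fejerKernel (l * t)) u]
    exact intervalIntegral.smul_integral_comp_mul_left fejerKernel l
  have hwtot : ∀ l > 0, ∀ u, ∫ t in Ioi 0, w l u t = ∫ v in Iic (l * u), fejerKernel v := by
    intro l hl u
    refine tendsto_nhds_unique (intervalIntegral_tendsto_integral_Ioi 0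
      (hwi l hl u).integrableOn tendsto_id) ?_
    simp_rw [hwint l hl, sub_zero]
    refine intervalIntegral_tendsto_integral_Iic _ integrable_fejerKernel.integrableOn ?_
    exact (tendsto_const_nhds.add_atBot tendsto_neg_atTop_atBot).const_mul_atBot hl
  have hwlim : ∀ l > 0, Tendsto (fun u ↦ ∫ t in Ioi 0, w l u t) atTop (𝓝 c) := by
    intro l hl
    simp_rw [hwtot l hl]
    have h1 := intervalIntegral_tendsto_integral_Ioi 0
      (f := fejerKernel) (μ := volume) integrable_fejerKernel.integrableOn tendsto_id
    have h2 : ∀ u, ∫ v in Iic u, fejerKernel v =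
        (∫ v in Iic 0, fejerKernel v) + ∫ v in (0 : ℝ)..u, fejerKernel v := fun u ↦ by
      rw [← intervalIntegral.integral_Iic_sub_Iic integrable_fejerKernel.integrableOn
        integrable_fejerKernel.integrableOn]
      ring
    have h3 : c = (∫ v in Iic 0, fejerKernel v) + ∫ v in Ioi 0, fejerKernel v := by
      rw [hc, ← intervalIntegral.integral_Iic_add_Ioi integrable_fejerKernel.integrableOn
        integrable_fejerKernel.integrableOn]
    have h4 : Tendsto (fun u ↦ ∫ v in Iic u, fejerKernel v) atTop (𝓝 c) := by
      rw [h3]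
      exact (h1.const_add _).congr fun u ↦ (h2 u).symm
    exact h4.comp (tendsto_id.const_mul_atTop hl)
  have hBw : ∀ l > 0, ∀ u, IntegrableOn (fun t ↦ B t * w l u t) (Ioi 0) := by
    intro l hl u
    refine (Integrable.bdd_mul (c := C) (hwi l hl u) hBm.aestronglyMeasurable
      (ae_of_all _ fun t ↦ ?_)).integrableOn
    rw [Real.norm_of_nonneg (hB0 t)]
    exact hBC t
  have hBlim : ∀ l > 0, Tendsto (fun u ↦ ∫ t in Ioi 0, B t * w l u t) atTop (𝓝 (A * c)) := by
    intro l hl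
    have := (h l hl).add ((hwlim l hl).const_mul A)
    rw [zero_add] at this
    refine this.congr fun u ↦ ?_
    rw [← integral_const_mul, ← integral_add]
    · refine integral_congr_ae (ae_of_all _ fun t ↦ ?_)
      simp only [hw]
      ring
    · have := (hBw l hl u).sub ((hwi l hl u).integrableOn.const_mul A)
      refine this.congr (ae_of_all _ fun t ↦ ?_)
      simp only [hw, Pi.sub_apply]
      ring
    · exact (hwi l hl u).integrableOn.const_mul A
  have hloc : ∀ l > 0, ∀ u δ, 0 < δ → ∫ t in Ioc (u - δ) (u + δ), w l u t = m (l * δ) := by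
    intro l hl u δ hδ
    rw [← intervalIntegral.integral_of_le (by linarith), hwint l hl]
    simp only [hm]
    congr 1 <;> ring
  have hslow : ∀ s t, s ≤ t → B s ≤ Real.exp (t - s) * B t := by
    intro s t hst
    have := hmono hst
    simp only at this
    have h1 : Real.exp (t - s) * B t = Real.exp (-s) * (Real.exp t * B t) := by
      rw [← mul_assoc, ← Real.exp_add]; ring_nf
    have h2 : B s = Real.exp (-s) * (Real.exp s * B s) := by
      rw [← mul_assoc, ← Real.exp_add]; simp
    rw [h1, h2]
    gcongr
  -- the two one-sided inequalities
  have hup : ∀ l > 0, ∀ δ > 0, ∀ u > δ,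
      Real.exp (-(2 * δ)) * B (u - δ) * m (l * δ) ≤ ∫ t in Ioi 0, B t * w l u t := by
    intro l hl δ hδ u hu
    rw [← hloc l hl u δ hδ, ← integral_const_mul]
    have hsub : Ioc (u - δ) (u + δ) ⊆ Ioi 0 := fun t ht ↦ by
      have := ht.1
      simp only [mem_Ioi]; linarith
    refine le_trans ?_ (setIntegral_mono_set (hBw l hl u)
      (ae_of_all _ fun t ↦ mul_nonneg (hB0 t) (hw0 l hl u t)) (ae_of_all _ hsub))
    refine setIntegral_mono_on ((hwi l hl u).integrableOn.const_mul _)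
      ((hBw l hl u).mono_set hsub) measurableSet_Ioc fun t ht ↦ ?_
    refine mul_le_mul_of_nonneg_right ?_ (hw0 l hl u t)
    have h1 := hslow (u - δ) t ht.1.le
    have h2 : Real.exp (t - (u - δ)) ≤ Real.exp (2 * δ) :=
      Real.exp_le_exp.mpr (by linarith [ht.2])
    have h3 : B (u - δ) ≤ Real.exp (2 * δ) * B t :=
      h1.trans (mul_le_mul_of_nonneg_right h2 (hB0 t))
    rw [Real.exp_neg, inv_mul_le_iff₀ (Real.exp_pos _)]
    exact h3
  have hlow : ∀ l > 0, ∀ δ > 0, ∀ u > δ,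
      ∫ t in Ioi 0, B t * w l u t ≤
        C * c + (Real.exp (2 * δ) * B (u + δ) - C) * m (l * δ) := by
    intro l hl δ hδ u hu
    have hC : 0 ≤ C := (hB0 0).trans (hBC 0)
    have hsub : Ioc (u - δ) (u + δ) ⊆ Ioi 0 := fun t ht ↦ by
      have := ht.1
      simp only [mem_Ioi]; linarith
    have h1 : ∫ t in Ioi 0, C * w l u t ≤ C * c := by
      rw [integral_const_mul, hwtot l hl]
      gcongr
      exact setIntegral_le_integral integrable_fejerKernel (ae_of_all _ fejerKernel_nonneg)
    have h2 : ∫ t in Ioi 0, (Ioc (u - δ) (u + δ)).indicator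
        (fun t ↦ (Real.exp (2 * δ) * B (u + δ) - C) * w l u t) t =
          (Real.exp (2 * δ) * B (u + δ) - C) * m (l * δ) := by
      rw [setIntegral_indicator measurableSet_Ioc, inter_eq_right.mpr hsub, integral_const_mul,
        hloc l hl u δ hδ]
    rw [← h2]
    refine le_trans ?_ (add_le_add_left h1 _)
    rw [← integral_add ((hwi l hl u).integrableOn.const_mul _)
      (((hwi l hl u).const_mul _).indicator measurableSet_Ioc).integrableOn]
    refine setIntegral_mono_on (hBw l hl u) (((hwi l hl u).integrableOn.const_mul _).add
      (((hwi l hl u).const_mul _).indicator measurableSet_Ioc).integrableOn)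
      measurableSet_Ioi fun t _ ↦ ?_
    by_cases ht : t ∈ Ioc (u - δ) (u + δ)
    · rw [indicator_of_mem ht, ← add_mul]
      refine mul_le_mul_of_nonneg_right ?_ (hw0 l hl u t)
      have h1 := hslow t (u + δ) ht.2
      have h2 : Real.exp (u + δ - t) ≤ Real.exp (2 * δ) :=
        Real.exp_le_exp.mpr (by linarith [ht.1])
      have := h1.trans (mul_le_mul_of_nonneg_right h2 (hB0 (u + δ)))
      linarith
    · rw [indicator_of_notMem ht, add_zero]
      exact mul_le_mul_of_nonneg_right (hBC t) (hw0 l hl u t)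
  have hx0 : Tendsto (fun x : ℝ ↦ x) (𝓝[>] 0) (𝓝 0) := tendsto_id.mono_left nhdsWithin_le_nhds
  have hmx : Tendsto (fun x : ℝ ↦ m x⁻¹) (𝓝[>] 0) (𝓝 c) :=
    hmlim.comp tendsto_inv_nhdsGT_zero
  have hexp : ∀ a : ℝ, Tendsto (fun x : ℝ ↦ Real.exp (a * x)) (𝓝[>] 0) (𝓝 1) := by
    intro a
    have := (Real.continuous_exp.tendsto _).comp (hx0.const_mul a)
    simpa [Function.comp_def] using this
  have hpos : ∀ᶠ x : ℝ in 𝓝[>] 0, 0 < x ∧ 0 < m x⁻¹ :=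
    (eventually_mem_nhdsWithin.mono fun x hx ↦ hx).and (hmx.eventually_const_lt hcpos)
  rw [tendsto_order]
  constructor
  · intro a ha
    have hlim : Tendsto (fun x : ℝ ↦ (A * c - x - C * (c - m x⁻¹)) / (Real.exp (2 * x) * m x⁻¹))
        (𝓝[>] 0) (𝓝 ((A * c - 0 - C * (c - c)) / (1 * c))) :=
      (((tendsto_const_nhds.sub hx0).sub ((tendsto_const_nhds.sub hmx).const_mul C))).div
        ((hexp 2).mul hmx) (by positivity)
    have hval : (A * c - 0 - C * (c - c)) / (1 * c) = A := by field_simp; ring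
    rw [hval] at hlim
    obtain ⟨x, hx, hx0, hm0⟩ := ((hlim.eventually_const_lt ha).and hpos).exists
    have hl : 0 < x⁻¹ * x⁻¹ := by positivity
    have h1 := (hBlim _ hl).eventually_const_lt (show A * c - x < A * c by linarith)
    have h2 := (tendsto_atTop_add_const_right atTop (-x) tendsto_id).eventually
      (h1.and (eventually_gt_atTop x))
    filter_upwards [h2] with t ht
    simp only [id] at ht
    have h3 := hlow _ hl x hx0 (t + -x) ht.2
    rw [mul_assoc, inv_mul_cancel₀ hx0.ne', mul_one, neg_add_cancel_right] at h3
    refine hx.trans_le ?_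
    rw [div_le_iff₀ (by positivity)]
    linarith [ht.1]
  · intro a ha
    have hlim : Tendsto (fun x : ℝ ↦ (A * c + x) / (Real.exp (-2 * x) * m x⁻¹))
        (𝓝[>] 0) (𝓝 ((A * c + 0) / (1 * c))) :=
      (tendsto_const_nhds.add hx0).div ((hexp (-2)).mul hmx) (by positivity)
    have hval : (A * c + 0) / (1 * c) = A := by field_simp; ring
    rw [hval] at hlim
    obtain ⟨x, hx, hx0, hm0⟩ := ((hlim.eventually_lt_const ha).and hpos).exists
    have hl : 0 < x⁻¹ * x⁻¹ := by positivity
    have h1 := (hBlim _ hl).eventually_lt_const (show A * c < A * c + x by linarith)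
    have h2 := (tendsto_atTop_add_const_right atTop x tendsto_id).eventually
      (h1.and (eventually_gt_atTop x))
    filter_upwards [h2] with t ht
    simp only [id] at ht
    have h3 := hup _ hl x hx0 (t + x) ht.2
    rw [mul_assoc x⁻¹, inv_mul_cancel₀ hx0.ne', mul_one, add_sub_cancel_right] at h3
    refine lt_of_le_of_lt ?_ hx
    rw [le_div_iff₀ (by positivity)]
    rw [neg_mul]
    linarith [ht.1]

lemma integral_Ioi_one_eq_integral_exp (f : ℝ → ℂ) :
    ∫ x in Ioi (1 : ℝ), f x = ∫ t in Ioi (0 : ℝ), (Real.exp t : ℂ) * f (Real.exp t) := by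
  have h : Real.exp '' Ioi 0 = Ioi 1 := by
    ext x
    constructor
    · rintro ⟨t, ht, rfl⟩
      exact Real.one_lt_exp_iff.mpr ht
    · intro hx
      exact ⟨Real.log x, Real.log_pos hx, Real.exp_log (zero_lt_one.trans hx)⟩
  rw [← h, integral_image_eq_integral_abs_deriv_smul measurableSet_Ioi
    (fun x _ ↦ (Real.hasDerivAt_exp x).hasDerivWithinAt) Real.exp_injective.injOn]
  simp

/-- The **Wiener–Ikehara theorem** for sequences satisfying a Chebyshev bound. -/
theorem wienerIkehara {f : ℕ → ℝ} (hf : ∀ n, 0 ≤ f n) {C : ℝ}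
    (hC : ∀ n : ℕ, ∑ k ∈ Finset.Icc 1 n, f k ≤ C * n) {A : ℝ} {F : ℂ → ℂ}
    (hFc : ContinuousOn F {s | 1 ≤ s.re})
    (hF : ∀ s : ℂ, 1 < s.re → LSeries (fun n ↦ (f n : ℂ)) s = F s + A / (s - 1)) :
    Tendsto (fun n : ℕ ↦ (∑ k ∈ Finset.Icc 1 n, f k) / n) atTop (𝓝 A) := by
  set S : ℝ → ℝ := fun x ↦ ∑ k ∈ Finset.Icc 1 ⌊x⌋₊, f k with hS
  set B : ℝ → ℝ := fun t ↦ Real.exp (-t) * S (Real.exp t) with hB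
  have hC0 : 0 ≤ C := by
    have := (Finset.sum_nonneg fun k _ ↦ hf k).trans (hC 1)
    simpa using this
  have hSmono : Monotone S := fun x y hxy ↦
    Finset.sum_le_sum_of_subset_of_nonneg (Finset.Icc_subset_Icc_right (Nat.floor_mono hxy))
      fun k _ _ ↦ hf k
  have hS0 : ∀ x, 0 ≤ S x := fun x ↦ Finset.sum_nonneg fun k _ ↦ hf k
  have hSC : ∀ x, 0 ≤ x → S x ≤ C * x := fun x hx ↦
    (hC _).trans (mul_le_mul_of_nonneg_left (Nat.floor_le hx) hC0)
  have hBm : Measurable B := by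
    have := hSmono.measurable
    fun_prop
  have hB0 : ∀ t, 0 ≤ B t := fun t ↦ mul_nonneg (Real.exp_pos _).le (hS0 _)
  have hBC : ∀ t, B t ≤ C := fun t ↦ by
    have := hSC _ (Real.exp_pos t).le
    simp only [hB]
    rw [Real.exp_neg, inv_mul_le_iff₀ (Real.exp_pos _)]
    linarith
  have hexpB : ∀ t, Real.exp t * B t = S (Real.exp t) := fun t ↦ by
    simp only [hB]
    rw [← mul_assoc, ← Real.exp_add]
    simp
  have hlap : ∀ s : ℂ, 0 < s.re →
      ∫ t in Ioi (0 : ℝ), (B t : ℂ) * cexp (-(s * t)) =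
        LSeries (fun n ↦ (f n : ℂ)) (s + 1) / (s + 1) := by
    intro s hs
    have hs1 : s + 1 ≠ 0 := fun h0 ↦ by
      have := congrArg re h0
      simp at this
      linarith
    have hO : (fun n : ℕ ↦ ∑ k ∈ Finset.Icc 1 n, f k) =O[atTop] fun n ↦ (n : ℝ) ^ (1 : ℝ) := by
      refine Asymptotics.IsBigO.of_bound C (Eventually.of_forall fun n ↦ ?_)
      rw [Real.rpow_one, Real.norm_of_nonneg (Finset.sum_nonneg fun k _ ↦ hf k),
        Real.norm_of_nonneg (Nat.cast_nonneg n)]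
      exact hC n
    rw [LSeries_eq_mul_integral_of_nonneg f zero_le_one (s := s + 1) (by simpa using hs) hO hf,
      mul_div_cancel_left₀ _ hs1, integral_Ioi_one_eq_integral_exp]
    refine integral_congr_ae (ae_of_all _ fun t ↦ ?_)
    simp only [hB, hS]
    push_cast
    have h1 : (cexp t) ^ (-(s + 1 + 1)) = cexp (-(s * t)) * cexp (-t) * cexp (-t) := by
      rw [← ofReal_exp, cpow_def_of_ne_zero (by exact_mod_cast (Real.exp_pos t).ne'),
        ← ofReal_log (Real.exp_pos t).le, Real.log_exp, ← Complex.exp_add, ← Complex.exp_add]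
      congr 1
      ring
    rw [h1]
    have h2 : cexp t * cexp (-t) = 1 := by rw [← Complex.exp_add]; simp
    linear_combination (-(cexp (-t) * (∑ k ∈ Finset.Icc 1 ⌊Real.exp t⌋₊, (f k : ℂ)) *
      cexp (-(s * t)))) * h2
  have hconst : ∀ s : ℂ, 0 < s.re → ∫ t in Ioi (0 : ℝ), (A : ℂ) * cexp (-(s * t)) = A / s := by
    intro s hs
    have := integral_exp_mul_complex_Ioi (a := -s) (by simpa using hs) 0
    rw [integral_const_mul]
    simp only [neg_mul, ofReal_zero, mul_zero, Complex.exp_zero] at this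
    rw [this]
    ring
  have hgint : ∀ s : ℂ, 0 < s.re → ∀ g : ℝ → ℝ, Measurable g → ∀ D, (∀ t, |g t| ≤ D) →
      IntegrableOn (fun t : ℝ ↦ (g t : ℂ) * cexp (-(s * t))) (Ioi 0) := by
    intro s hs g hg D hD
    refine ((exp_neg_integrableOn_Ioi 0 hs).const_mul D).mono'
      (by apply Measurable.aestronglyMeasurable; fun_prop) (ae_of_all _ fun t ↦ ?_)
    rw [norm_mul, Complex.norm_exp, norm_real]
    refine mul_le_mul (hD t) (by simp) (Real.exp_pos _).le ((abs_nonneg _).trans (hD t))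
  have hBt : Tendsto B atTop (𝓝 A) := by
    have hBmono : Monotone fun t ↦ Real.exp t * B t := by
      simp_rw [hexpB]
      exact hSmono.comp Real.exp_monotone
    refine tendsto_of_tendsto_integral_fejerKernel hBm hB0 hBC hBmono fun l hl ↦ ?_
    have := tendsto_integral_mul_fejerKernel (b := fun t ↦ ((B t - A : ℝ) : ℂ)) (C := C + |A|)
      (G := fun s ↦ (F (s + 1) - A) / (s + 1)) (by fun_prop) (fun t ↦ ?_) ?_ ?_ hl
    · rw [← tendsto_ofReal_iff, ofReal_zero]
      refine this.congr fun u ↦ ?_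
      simp only [← ofReal_mul]
      exact integral_ofReal
    · rw [norm_real]
      refine (abs_sub _ _).trans ?_
      rw [abs_of_nonneg (hB0 t)]
      linarith [hBC t]
    · refine ContinuousOn.div ((hFc.comp (by fun_prop) fun s hs ↦ ?_).sub continuousOn_const)
        (by fun_prop) fun s hs h0 ↦ ?_
      · simpa using hs
      · have := congrArg re h0
        simp only [mem_ofPred_eq] at hs
        simp at this
        linarith
    · intro s hs
      have hs0 : s ≠ 0 := fun h0 ↦ by simp [h0] at hs
      have hs1 : s + 1 ≠ 0 := fun h0 ↦ by
        have := congrArg re h0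
        simp at this
        linarith
      push_cast
      simp_rw [sub_mul]
      rw [integral_sub (hgint s hs B hBm C fun t ↦ by rw [abs_of_nonneg (hB0 t)]; exact hBC t)
        (hgint s hs (fun _ ↦ A) measurable_const |A| fun _ ↦ le_rfl), hlap s hs, hconst s hs,
        hF _ (by simpa using hs), add_sub_cancel_right]
      field_simp
      ring
  have hlog : Tendsto (fun n : ℕ ↦ Real.log n) atTop atTop :=
    Real.tendsto_log_atTop.comp tendsto_natCast_atTop_atTop
  refine (hBt.comp hlog).congr' ?_
  filter_upwards [eventually_gt_atTop 0] with n hn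
  have hn' : (0 : ℝ) < n := by exact_mod_cast hn
  simp only [hB, hS, Function.comp, Real.exp_neg, Real.exp_log hn', Nat.floor_natCast]
  ring

end wienerIkehara

open Filter Topology Complex MeasureTheory Set in
theorem exists_differentiableOn_LSeries_eq_add_div {f : ℕ → ℂ} {c : ℂ} {C : ℝ}
    (hf : ∀ n : ℕ, ‖∑ k ∈ Finset.Icc 1 n, f k - c * n‖ ≤ C * √n)
    (hs : ∀ s : ℂ, 1 < s.re → LSeriesSummable f s) :
    ∃ H : ℂ → ℂ, DifferentiableOn ℂ H {s | 1 / 2 < s.re} ∧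
      ∀ s : ℂ, 1 < s.re → LSeries f s = H s + c / (s - 1) := by
  set A : ℝ → ℂ := fun t ↦ ∑ k ∈ Finset.Icc 1 ⌊t⌋₊, f k with hA
  set h : ℝ → ℂ := (Ioi 1).indicator fun t ↦ A t - c * t with hh
  have hC : 0 ≤ C := by simpa using (norm_nonneg _).trans (hf 1)
  have hbd : ∀ t, 1 ≤ t → ‖A t - c * t‖ ≤ (C + ‖c‖) * √t := by
    intro t ht
    have h0 : (0 : ℝ) ≤ t := zero_le_one.trans ht
    have h1 := Nat.floor_le h0
    have h2 := Nat.lt_floor_add_one t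
    have h3 : 1 ≤ √t := Real.one_le_sqrt.mpr ht
    have : A t - c * t = (A t - c * (⌊t⌋₊ : ℕ)) - c * ((t - ⌊t⌋₊ : ℝ) : ℂ) := by
      push_cast
      ring
    rw [this]
    refine (norm_sub_le _ _).trans ?_
    rw [add_mul]
    refine add_le_add ((hf _).trans (by gcongr)) ?_
    rw [norm_mul, norm_real, Real.norm_of_nonneg (by linarith)]
    gcongr
    linarith
  have hAm : Measurable A :=
    (measurable_from_top (f := fun n : ℕ ↦ ∑ k ∈ Finset.Icc 1 n, f k)).comp Nat.measurable_floor
  have hhm : Measurable h := by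
    refine Measurable.indicator ?_ measurableSet_Ioi
    fun_prop
  have hhb : ∀ t, ‖h t‖ ≤ (C + ‖c‖) * √t := by
    intro t
    rw [hh, indicator]
    split_ifs with ht
    · exact hbd t (le_of_lt ht)
    · rw [norm_zero]
      positivity
  have hmel : ∀ s : ℂ, 1 / 2 < s.re → DifferentiableAt ℂ (mellin h) (-s) := by
    intro s hs
    refine mellin_differentiableAt_of_isBigO_rpow (a := -(1 / 2)) (b := -s.re - 1) ?_ ?_
      (by simpa using hs) ?_ (by simp)
    · refine LocallyIntegrable.locallyIntegrableOn ?_ _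
      have : LocallyIntegrable (fun t : ℝ ↦ (C + ‖c‖) * √t) :=
        Continuous.locallyIntegrable (by fun_prop)
      refine this.mono hhm.aestronglyMeasurable (ae_of_all _ fun t ↦ ?_)
      exact (hhb t).trans (le_abs_self _)
    · refine Asymptotics.IsBigO.of_bound (C + ‖c‖) (Eventually.of_forall fun t ↦ ?_)
      rw [neg_neg, ← Real.sqrt_eq_rpow, Real.norm_of_nonneg (Real.sqrt_nonneg _)]
      exact hhb t
    · refine Asymptotics.IsBigO.of_bound 0 ?_
      filter_upwards [Ioo_mem_nhdsGT (zero_lt_one (α := ℝ))] with t ht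
      rw [hh, indicator_of_notMem (by simpa using ht.2.le)]
      simp
  refine ⟨fun s ↦ s * mellin h (-s) + c, fun s hs ↦ ?_, fun s hs1 ↦ ?_⟩
  · have : DifferentiableAt ℂ (fun s ↦ mellin h (-s)) s :=
      DifferentiableAt.comp (g := mellin h) s (hmel s hs) differentiableAt_id.neg
    exact ((differentiableAt_id.mul this).add_const c).differentiableWithinAt
  have hO : (fun n : ℕ ↦ ∑ k ∈ Finset.Icc 1 n, f k) =O[atTop] fun n ↦ (n : ℝ) ^ (1 : ℝ) := by
    refine Asymptotics.IsBigO.of_bound (C + ‖c‖ + ‖c‖) ?_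
    filter_upwards [eventually_ge_atTop 1] with n hn
    have h1 : (1 : ℝ) ≤ n := by exact_mod_cast hn
    have := hbd n h1
    simp only [hA, Nat.floor_natCast] at this
    rw [Real.rpow_one, Real.norm_of_nonneg (by positivity)]
    have h2 : √(n : ℝ) ≤ n := by
      rw [Real.sqrt_le_left (by positivity)]
      nlinarith
    calc ‖∑ k ∈ Finset.Icc 1 n, f k‖
        = ‖(∑ k ∈ Finset.Icc 1 n, f k - c * (n : ℝ)) + c * (n : ℝ)‖ := by rw [sub_add_cancel]
      _ ≤ (C + ‖c‖) * √n + ‖c‖ * n := by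
        refine (norm_add_le _ _).trans (add_le_add this ?_)
        rw [norm_mul, norm_real, Real.norm_of_nonneg (by positivity)]
      _ ≤ (C + ‖c‖ + ‖c‖) * n := by
        rw [add_mul (C + ‖c‖)]
        gcongr
  have hs0 : s ≠ 0 := fun h0 ↦ by simp [h0] at hs1; linarith
  have hs1' : s - 1 ≠ 0 := fun h0 ↦ by
    rw [sub_eq_zero] at h0
    simp [h0] at hs1
  have hi1 : IntegrableOn (fun t : ℝ ↦ (A t - c * t) * (t : ℂ) ^ (-(s + 1))) (Ioi 1) := by
    have : IntegrableOn (fun t : ℝ ↦ (C + ‖c‖) * t ^ (1 / 2 + -(s.re + 1))) (Ioi 1) :=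
      (integrableOn_Ioi_rpow_of_lt (by linarith) zero_lt_one).const_mul _
    refine this.mono' ?_ ?_
    · refine Measurable.aestronglyMeasurable ?_
      fun_prop
    · refine (ae_restrict_iff' measurableSet_Ioi).mpr (ae_of_all _ fun t ht ↦ ?_)
      have ht0 : 0 < t := zero_lt_one.trans ht
      rw [norm_mul, norm_cpow_eq_rpow_re_of_pos ht0, Real.rpow_add ht0, ← mul_assoc,
        ← Real.sqrt_eq_rpow]
      exact mul_le_mul_of_nonneg_right (hbd t (le_of_lt ht)) (by positivity)
  have hi2 : IntegrableOn (fun t : ℝ ↦ c * (t : ℂ) ^ (-s)) (Ioi 1) :=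
    (integrableOn_Ioi_cpow_of_lt (by simpa using hs1) zero_lt_one).const_mul _
  rw [LSeries_eq_mul_integral f zero_le_one hs1 (hs s hs1) hO]
  have h1 : ∫ t in Ioi (1 : ℝ), A t * (t : ℂ) ^ (-(s + 1)) =
      (∫ t in Ioi (1 : ℝ), (A t - c * t) * (t : ℂ) ^ (-(s + 1))) +
        ∫ t in Ioi (1 : ℝ), c * (t : ℂ) ^ (-s) := by
    rw [← integral_add hi1 hi2]
    refine setIntegral_congr_fun measurableSet_Ioi fun t ht ↦ ?_
    have ht0 : (t : ℂ) ≠ 0 := by exact_mod_cast (zero_lt_one.trans ht).ne'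
    have : (t : ℂ) ^ (-s) = t * (t : ℂ) ^ (-(s + 1)) := by
      rw [show -s = 1 + -(s + 1) by ring, cpow_add _ _ ht0, cpow_one]
    simp only [this]
    ring
  have h2 : mellin h (-s) = ∫ t in Ioi (1 : ℝ), (A t - c * t) * (t : ℂ) ^ (-(s + 1)) := by
    rw [mellin]
    have h3 : ∀ t : ℝ, (t : ℂ) ^ (-s - 1) • h t =
        (Ioi 1).indicator (fun t : ℝ ↦ (A t - c * t) * (t : ℂ) ^ (-(s + 1))) t := by
      intro t
      simp only [hh, indicator]
      split_ifs
      · rw [smul_eq_mul, mul_comm, neg_add']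
      · simp
    simp_rw [h3]
    rw [setIntegral_indicator measurableSet_Ioi,
      inter_eq_self_of_subset_right (Ioi_subset_Ioi zero_le_one)]
  beta_reduce
  rw [h1, h2, integral_const_mul, integral_Ioi_cpow_of_lt (by simpa using hs1) zero_lt_one]
  have hs1'' : -s + 1 ≠ 0 := by
    intro h0
    apply hs1'
    linear_combination -h0
  simp only [ofReal_one, one_cpow]
  field_simp
  ring

open Filter Topology Complex in
theorem AnalyticAt.tendsto_mul_logDeriv {f : ℂ → ℂ} {z : ℂ} (hf : AnalyticAt ℂ f z)
    (hz : analyticOrderAt f z ≠ ⊤) :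
    Tendsto (fun δ : ℝ ↦ (δ : ℂ) * logDeriv f (z + δ)) (𝓝[>] 0)
      (𝓝 (analyticOrderNatAt f z)) := by
  obtain ⟨g, hg, hg0, hfg⟩ := hf.analyticOrderAt_ne_top.mp hz
  set n := analyticOrderNatAt f z
  have hδ : Tendsto (fun δ : ℝ ↦ z + (δ : ℂ)) (𝓝[>] 0) (𝓝 z) := by
    have : Continuous fun δ : ℝ ↦ z + (δ : ℂ) := by fun_prop
    simpa using (this.tendsto 0).mono_left nhdsWithin_le_nhds
  have hlog : Tendsto (fun δ : ℝ ↦ (n : ℂ) + (δ : ℂ) * logDeriv g (z + δ)) (𝓝[>] 0) (𝓝 n) := by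
    have h1 : Tendsto (fun δ : ℝ ↦ (δ : ℂ)) (𝓝[>] 0) (𝓝 0) := by
      simpa using (continuous_ofReal.tendsto 0).mono_left nhdsWithin_le_nhds
    have h2 : ContinuousAt (logDeriv g) z := hg.deriv.continuousAt.div hg.continuousAt hg0
    simpa using ((h1.mul (h2.tendsto.comp hδ)).const_add (n : ℂ))
  refine hlog.congr' ?_
  filter_upwards [hδ.eventually hfg.eventuallyEq_nhds, self_mem_nhdsWithin,
    hδ.eventually hg.eventually_analyticAt, hδ.eventually (hg.continuousAt.eventually_ne hg0)]
    with δ h1 h2 h3 h4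
  have hδ0 : (δ : ℂ) ≠ 0 := by exact_mod_cast (ne_of_gt h2)
  have hd1 : DifferentiableAt ℂ (fun w : ℂ ↦ (w - z) ^ n) (z + δ) := by fun_prop
  rw [logDeriv_apply f, h1.deriv_eq, h1.eq_of_nhds, ← logDeriv_apply]
  simp_rw [smul_eq_mul]
  rw [logDeriv_mul (f := fun w ↦ (w - z) ^ n) (z + δ)
    (pow_ne_zero _ (by simpa using hδ0)) h4 hd1 h3.differentiableAt]
  have : logDeriv (fun w : ℂ ↦ (w - z) ^ n) (z + δ) = n / δ := by
    rw [logDeriv_fun_pow (by fun_prop), logDeriv_apply]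
    simp [div_eq_mul_inv]
  rw [this]
  field_simp

open Filter Topology Complex in
theorem LSeries_deriv_eq_neg_mul {a D : ℕ → ℂ} (ha : ∀ s : ℂ, 1 < s.re → LSeriesSummable a s)
    (hD : ∀ s : ℂ, 1 < s.re → LSeriesSummable D s)
    (haD : ∀ n, a n * Real.log n = ∑ p ∈ n.divisorsAntidiagonal, D p.1 * a p.2)
    {s : ℂ} (hs : 1 < s.re) : deriv (LSeries a) s = -(LSeries D s * LSeries a s) := by
  have habs : LSeries.abscissaOfAbsConv a ≤ (1 : ℝ) :=
    LSeries.abscissaOfAbsConv_le_of_forall_lt_LSeriesSummable fun y hy ↦ ha _ (by simpa using hy)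
  rw [LSeries_deriv (habs.trans_lt (by exact_mod_cast hs)),
    ← LSeries_convolution' (hD s hs) (ha s hs)]
  congr 1
  refine LSeries_congr (fun {n} _ ↦ ?_) s
  rw [LSeries.convolution_def]
  beta_reduce
  rw [← haD, LSeries.logMul, ← natCast_log, mul_comm]

open Filter Topology Complex in
theorem exists_analyticOnNhd_LSeries_logDeriv {a D : ℕ → ℂ}
    (ha : ∀ s : ℂ, 1 < s.re → LSeriesSummable a s) (hD : ∀ s : ℂ, 1 < s.re → LSeriesSummable D s)
    (ha1 : a 1 ≠ 0)
    (haD : ∀ n, a n * Real.log n = ∑ p ∈ n.divisorsAntidiagonal, D p.1 * a p.2)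
    {c : ℂ} {C : ℝ} (hpart : ∀ n : ℕ, ‖∑ k ∈ Finset.Icc 1 n, a k - c * n‖ ≤ C * √n) :
    ∃ Z : ℂ → ℂ, AnalyticOnNhd ℂ Z {s | 1 / 2 < s.re} ∧
      (∀ s : ℂ, 1 / 2 < s.re → analyticOrderAt Z s ≠ ⊤) ∧
      (∀ s : ℂ, 1 < s.re → Z s ≠ 0) ∧ (c ≠ 0 → Z 1 ≠ 0) ∧
      ∀ s : ℂ, 1 < s.re →
        LSeries D s = -logDeriv Z s + (if c = 0 then 0 else 1) / (s - 1) := by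
  obtain ⟨H, hH, hL⟩ := exists_differentiableOn_LSeries_eq_add_div hpart ha
  set Q : ℂ → ℂ := fun s ↦ if c = 0 then 1 else s - 1 with hQ
  have hQd : Differentiable ℂ Q := by
    rw [hQ]
    split_ifs <;> fun_prop
  have hQ0 : ∀ s : ℂ, 1 < s.re → Q s ≠ 0 := by
    intro s hs h0
    simp only [hQ] at h0
    split_ifs at h0 with hc
    · exact one_ne_zero h0
    · rw [sub_eq_zero] at h0
      simp [h0] at hs
  have hopen : IsOpen {s : ℂ | 1 / 2 < s.re} := isOpen_lt continuous_const continuous_re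
  have hopen1 : IsOpen {s : ℂ | 1 < s.re} := isOpen_lt continuous_const continuous_re
  set Z : ℂ → ℂ := fun s ↦ Q s * H s + c with hZ
  have hZL : ∀ s : ℂ, 1 < s.re → Z s = Q s * LSeries a s := by
    intro s hs
    have h1 := hQ0 s hs
    simp only [hZ, hL s hs, hQ] at h1 ⊢
    split_ifs at h1 ⊢ with hc
    · simp [hc]
    · rw [mul_add, mul_div_cancel₀ _ h1]
  have hZan : AnalyticOnNhd ℂ Z {s | 1 / 2 < s.re} :=
    ((hQd.differentiableOn.mul hH).add_const c).analyticOnNhd hopen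
  have habs : LSeries.abscissaOfAbsConv a ≤ (1 : ℝ) :=
    LSeries.abscissaOfAbsConv_le_of_forall_lt_LSeriesSummable fun y hy ↦ ha _ (by simpa using hy)
  have habsD : LSeries.abscissaOfAbsConv D ≤ (1 : ℝ) :=
    LSeries.abscissaOfAbsConv_le_of_forall_lt_LSeriesSummable fun y hy ↦ hD _ (by simpa using hy)
  have hLd : ∀ s : ℂ, 1 < s.re → DifferentiableAt ℂ (LSeries a) s := fun s hs ↦
    (LSeries_hasDerivAt (habs.trans_lt (by exact_mod_cast hs))).differentiableAt
  have hDd : ∀ s : ℂ, 1 < s.re → DifferentiableAt ℂ (LSeries D) s := fun s hs ↦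
    (LSeries_hasDerivAt (habsD.trans_lt (by exact_mod_cast hs))).differentiableAt
  have hord : ∀ s : ℂ, 1 / 2 < s.re → analyticOrderAt Z s ≠ ⊤ := by
    intro s hs h
    have h0 := hZan.eqOn_zero_of_preconnected_of_eventuallyEq_zero
      (convex_halfSpace_re_gt _).isPreconnected hs (analyticOrderAt_eq_top.mp h)
    have : (fun x : ℝ ↦ LSeries a x) =ᶠ[atTop] 0 := by
      filter_upwards [eventually_gt_atTop 1] with x hx
      have h1 : Z x = 0 := h0 (by simp; linarith)
      rw [hZL x (by simpa using hx)] at h1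
      exact (mul_eq_zero.mp h1).resolve_left (hQ0 x (by simpa using hx))
    rcases LSeries_eventually_eq_zero_iff'.mp this with h1 | h1
    · exact ha1 (h1 1 one_ne_zero)
    · rw [h1] at habs
      exact absurd (top_le_iff.mp habs) (EReal.coe_ne_top 1)
  have hlogZ : ∀ s : ℂ, 1 < s.re → LSeries a s ≠ 0 →
      logDeriv Z s = -LSeries D s + (if c = 0 then 0 else 1) / (s - 1) := by
    intro s hs h0
    have h1 : Z =ᶠ[𝓝 s] fun s ↦ Q s * LSeries a s := by
      filter_upwards [hopen1.mem_nhds hs] with w hw using hZL w hw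
    rw [logDeriv_apply, h1.deriv_eq, h1.eq_of_nhds, ← logDeriv_apply,
      logDeriv_mul (f := Q) s (hQ0 s hs) h0 (hQd s) (hLd s hs), logDeriv_apply (LSeries a),
      LSeries_deriv_eq_neg_mul ha hD haD hs, add_comm]
    congr 1
    · rw [neg_div, mul_div_cancel_right₀ _ h0]
    · rw [logDeriv_apply, hQ]
      split_ifs
      · simp
      · simp
  have hlim0 : Tendsto (fun δ : ℝ ↦ (δ : ℂ)) (𝓝[>] 0) (𝓝 0) := by
    simpa using (continuous_ofReal.tendsto 0).mono_left nhdsWithin_le_nhds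
  have hZ0 : ∀ s : ℂ, 1 < s.re → Z s ≠ 0 := by
    intro s hs
    have hs2 : 1 / 2 < s.re := by linarith
    have han := hZan s hs2
    have hlim := han.tendsto_mul_logDeriv (hord s hs2)
    have hδ : Tendsto (fun δ : ℝ ↦ s + (δ : ℂ)) (𝓝[>] 0) (𝓝 s) := by
      simpa using hlim0.const_add s
    have hs10 : s - 1 ≠ 0 := fun h0 ↦ by
      rw [sub_eq_zero] at h0
      simp [h0] at hs
    have hcont : ContinuousAt
        (fun s ↦ -LSeries D s + (if c = 0 then 0 else 1) / (s - 1)) s := by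
      refine ((hDd s hs).continuousAt.neg).add (continuousAt_const.div ?_ hs10)
      fun_prop
    have hne : ∀ᶠ δ : ℝ in 𝓝[>] 0, Z (s + δ) ≠ 0 := by
      have h2 : Tendsto (fun δ : ℝ ↦ s + (δ : ℂ)) (𝓝[>] 0) (𝓝[≠] s) := by
        refine tendsto_nhdsWithin_iff.mpr ⟨hδ, ?_⟩
        filter_upwards [self_mem_nhdsWithin] with δ h
        simpa using (ne_of_gt h : δ ≠ 0)
      refine h2.eventually ((han.eventually_eq_zero_or_eventually_ne_zero).resolve_left ?_)
      exact fun h ↦ hord s hs2 (analyticOrderAt_eq_top.mpr h)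
    have hlim2 := hlim0.mul (hcont.tendsto.comp hδ)
    rw [zero_mul] at hlim2
    have heq := tendsto_nhds_unique hlim (hlim2.congr' ?_)
    · rw [← han.analyticOrderAt_eq_zero, ← Nat.cast_analyticOrderNatAt (hord s hs2)]
      exact_mod_cast heq
    · filter_upwards [hδ.eventually (hopen1.mem_nhds hs), hne] with δ h1 h2
      rw [hZL _ h1] at h2
      simp [hlogZ _ h1 (right_ne_zero_of_mul h2)]
  refine ⟨Z, hZan, hord, hZ0, fun hc ↦ by simp [hZ, hQ, hc], fun s hs ↦ ?_⟩
  have h1 := hZ0 s hs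
  rw [hZL s hs] at h1
  rw [hlogZ s hs (right_ne_zero_of_mul h1)]
  ring

open Filter Topology Complex in
theorem ne_zero_of_three_four_one {Z₀ Z₁ Z₂ : ℂ → ℂ} {s₁ s₂ : ℂ} (h₀ : AnalyticAt ℂ Z₀ 1)
    (h₁ : AnalyticAt ℂ Z₁ s₁) (h₂ : AnalyticAt ℂ Z₂ s₂) (hZ₀ : Z₀ 1 ≠ 0)
    (hZ₁ : analyticOrderAt Z₁ s₁ ≠ ⊤) (hZ₂ : analyticOrderAt Z₂ s₂ ≠ ⊤)
    {M : ℝ} (h : ∀ δ : ℝ, 0 < δ →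
      (3 * logDeriv Z₀ (1 + δ) + 4 * logDeriv Z₁ (s₁ + δ) + logDeriv Z₂ (s₂ + δ)).re ≤
        3 / δ + M) :
    Z₁ s₁ ≠ 0 := by
  have ho : analyticOrderAt Z₀ 1 = 0 := h₀.analyticOrderAt_eq_zero.mpr hZ₀
  have l₀ := h₀.tendsto_mul_logDeriv (by simp [ho])
  have l₁ := h₁.tendsto_mul_logDeriv hZ₁
  have l₂ := h₂.tendsto_mul_logDeriv hZ₂
  have lim := (continuous_re.tendsto _).comp (((l₀.const_mul 3).add (l₁.const_mul 4)).add l₂)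
  have hle : ((3 : ℂ) * (analyticOrderNatAt Z₀ 1) + 4 * analyticOrderNatAt Z₁ s₁
      + analyticOrderNatAt Z₂ s₂).re ≤ 3 := by
    have lim3 : Tendsto (fun δ : ℝ ↦ 3 + δ * M) (𝓝[>] 0) (𝓝 3) := by
      have : Continuous fun δ : ℝ ↦ 3 + δ * M := by fun_prop
      simpa using (this.tendsto 0).mono_left nhdsWithin_le_nhds
    refine le_of_tendsto_of_tendsto lim lim3 ?_
    filter_upwards [self_mem_nhdsWithin] with δ (hδ : 0 < δ)
    have h3 := mul_le_mul_of_nonneg_left (h δ hδ) hδ.le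
    rw [mul_add, mul_div_cancel₀ _ hδ.ne', ← re_ofReal_mul] at h3
    refine le_of_eq_of_le ?_ h3
    simp only [Function.comp_apply]
    congr 1
    ring
  have hn : analyticOrderNatAt Z₁ s₁ = 0 := by
    have h5 : (3 : ℂ) * (analyticOrderNatAt Z₀ 1) + 4 * analyticOrderNatAt Z₁ s₁
      + analyticOrderNatAt Z₂ s₂ = ((3 * (analyticOrderNatAt Z₀ 1) + 4 * analyticOrderNatAt Z₁ s₁
      + analyticOrderNatAt Z₂ s₂ : ℕ) : ℂ) := by push_cast; ring
    rw [h5, natCast_re] at hle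
    have : 3 * (analyticOrderNatAt Z₀ 1) + 4 * analyticOrderNatAt Z₁ s₁
      + analyticOrderNatAt Z₂ s₂ ≤ 3 := by exact_mod_cast hle
    omega
  rw [← h₁.analyticOrderAt_eq_zero, ← Nat.cast_analyticOrderNatAt hZ₁, hn, Nat.cast_zero]

open Filter Topology Complex in
theorem re_LSeries_three_four_one_nonneg {D₀ D₁ D₂ : ℕ → ℂ} {σ t : ℝ}
    (h₀ : LSeriesSummable D₀ σ) (h₁ : LSeriesSummable D₁ (σ + t * I))
    (h₂ : LSeriesSummable D₂ (σ + 2 * t * I))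
    (h : ∀ n : ℕ, ∀ z : ℂ, ‖z‖ = 1 → 0 ≤ (3 * D₀ n + 4 * z * D₁ n + z ^ 2 * D₂ n).re) :
    0 ≤ (3 * LSeries D₀ σ + 4 * LSeries D₁ (σ + t * I) + LSeries D₂ (σ + 2 * t * I)).re := by
  have hs := ((h₀.hasSum.mul_left 3).add (h₁.hasSum.mul_left 4)).add h₂.hasSum
  refine (hasSum_re hs).nonneg fun n ↦ ?_
  rcases eq_or_ne n 0 with rfl | hn
  · simp
  have hn0 : (n : ℂ) ≠ 0 := by exact_mod_cast hn
  set z : ℂ := (n : ℂ) ^ (-(t * I)) with hz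
  have hz1 : ‖z‖ = 1 := by
    rw [hz, ← ofReal_natCast, norm_cpow_eq_rpow_re_of_pos (by positivity)]
    simp
  set r : ℝ := (n : ℝ) ^ (-σ) with hr
  have hr0 : 0 ≤ r := by positivity
  have hr1 : ((n : ℂ) ^ (σ : ℂ))⁻¹ = r := by
    rw [← cpow_neg, hr, ofReal_cpow (by positivity)]
    simp
  have e1 : ((n : ℂ) ^ (σ + t * I : ℂ))⁻¹ = r * z := by
    rw [cpow_add _ _ hn0, mul_inv, hr1, hz, cpow_neg]
  have e2 : ((n : ℂ) ^ (σ + 2 * t * I : ℂ))⁻¹ = r * z ^ 2 := by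
    rw [cpow_add _ _ hn0, mul_inv, hr1, hz, ← cpow_nat_mul, ← cpow_neg]
    congr 2
    push_cast
    ring
  simp only [LSeries.term_of_ne_zero hn, div_eq_mul_inv, hr1, e1, e2]
  have := mul_nonneg hr0 (h n z hz1)
  rw [← re_ofReal_mul] at this
  refine this.trans_eq ?_
  congr 1
  ring

open Filter Topology Complex in
theorem re_inv_add_mul_I_le {δ t : ℝ} (ht : t ≠ 0) : ((δ + t * I : ℂ)⁻¹).re ≤ |t|⁻¹ := by
  refine (re_le_norm _).trans ?_
  rw [norm_inv]
  exact inv_anti₀ (abs_pos.mpr ht) (by simpa using abs_im_le_norm (δ + t * I : ℂ))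

open Filter Topology Complex in
theorem ne_zero_on_line_one {X : Type*} [AddCommGroup X] [DecidableEq X]
    {D : X → ℕ → ℂ} {Z : X → ℂ → ℂ} (hX : ∀ x : X, x + x = 0 → x = 0)
    (hD : ∀ x, ∀ s : ℂ, 1 < s.re → LSeriesSummable (D x) s)
    (hD341 : ∀ x, ∀ n : ℕ, ∀ z : ℂ, ‖z‖ = 1 →
      0 ≤ (3 * D 0 n + 4 * z * D x n + z ^ 2 * D (x + x) n).re)
    (hZ : ∀ x, AnalyticOnNhd ℂ (Z x) {s | 1 / 2 < s.re})
    (hord : ∀ x, ∀ s : ℂ, 1 / 2 < s.re → analyticOrderAt (Z x) s ≠ ⊤) (hZ1 : Z 0 1 ≠ 0)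
    (hZD : ∀ x, ∀ s : ℂ, 1 < s.re →
      LSeries (D x) s = -logDeriv (Z x) s + (if x = 0 then 1 else 0) / (s - 1))
    (x : X) (t : ℝ) : Z x (1 + t * I) ≠ 0 := by
  by_cases hxt : x = 0 ∧ t = 0
  · obtain ⟨rfl, rfl⟩ := hxt
    rwa [ofReal_zero, zero_mul, add_zero]
  have hre : ∀ δ u : ℝ, (1 + δ + u * I : ℂ).re = 1 + δ := by simp
  have hre' : ∀ u : ℝ, 1 / 2 < (1 + u * I : ℂ).re := fun u ↦ by
    have := hre 0 u
    rw [ofReal_zero, add_zero, add_zero] at this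
    rw [this]
    norm_num
  have h1 : 1 / 2 < (1 : ℂ).re := by
    rw [one_re]
    norm_num
  refine ne_zero_of_three_four_one (Z₀ := Z 0) (Z₂ := Z (x + x)) (s₂ := 1 + (2 * t : ℝ) * I)
    (M := 5 * |t|⁻¹) (hZ _ _ h1) (hZ _ _ (hre' _)) (hZ _ _ (hre' _)) hZ1
    (hord _ _ (hre' _)) (hord _ _ (hre' _)) fun δ hδ ↦ ?_
  have hδ1 : ∀ u : ℝ, 1 < (1 + δ + u * I : ℂ).re := fun u ↦ by
    rw [hre]
    linarith
  have hδ0 : 1 < (1 + δ : ℂ).re := by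
    have := hδ1 0
    rwa [ofReal_zero, zero_mul, add_zero] at this
  have key := re_LSeries_three_four_one_nonneg (σ := 1 + δ) (t := t) (D₀ := D 0) (D₁ := D x)
    (D₂ := D (x + x))
  simp only [ofReal_add, ofReal_one] at key
  have e2 : (1 + δ + 2 * t * I : ℂ) = 1 + δ + (2 * t : ℝ) * I := by push_cast; rfl
  rw [e2] at key
  have key := key (hD _ _ hδ0) (hD _ _ (hδ1 _)) (hD _ _ (hδ1 _)) (hD341 x)
  rw [hZD _ _ hδ0, hZD _ _ (hδ1 _), hZD _ _ (hδ1 _), if_pos rfl] at key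
  have hpole : (4 * ((if x = 0 then 1 else 0) / (1 + δ + t * I - 1 : ℂ)) +
      (if x + x = 0 then 1 else 0) / (1 + δ + (2 * t : ℝ) * I - 1 : ℂ)).re ≤ 5 * |t|⁻¹ := by
    by_cases hx : x = 0
    · have ht : t ≠ 0 := fun ht ↦ hxt ⟨hx, ht⟩
      have h2 := re_inv_add_mul_I_le (δ := δ) ht
      have h3 := re_inv_add_mul_I_le (δ := δ) (t := 2 * t) (by simpa using ht)
      have h4 : |2 * t|⁻¹ ≤ |t|⁻¹ := by
        refine inv_anti₀ (abs_pos.mpr ht) ?_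
        rw [abs_mul, abs_two]
        linarith [abs_nonneg t]
      rw [if_pos hx, if_pos (by simp [hx]), one_div, one_div, add_re,
        show (4 : ℂ) = (4 : ℝ) by norm_num, re_ofReal_mul]
      rw [show (1 + δ + t * I - 1 : ℂ) = δ + t * I by ring,
        show (1 + δ + (2 * t : ℝ) * I - 1 : ℂ) = δ + (2 * t : ℝ) * I by ring]
      linarith
    · rw [if_neg hx, if_neg fun h ↦ hx (hX x h)]
      simp
  have hmain : (3 * (1 / (1 + δ - 1)) : ℂ).re = 3 / δ := by
    rw [add_sub_cancel_left, show (3 * (1 / δ) : ℂ) = (3 / δ : ℝ) by push_cast; ring, ofReal_re]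
  rw [show (1 + t * I + δ : ℂ) = 1 + δ + t * I by ring,
    show (1 + (2 * t : ℝ) * I + δ : ℂ) = 1 + δ + (2 * t : ℝ) * I by ring]
  generalize logDeriv (Z 0) (1 + δ) = u₀ at key ⊢
  generalize logDeriv (Z x) (1 + δ + t * I) = u₁ at key ⊢
  generalize logDeriv (Z (x + x)) (1 + δ + (2 * t : ℝ) * I) = u₂ at key ⊢
  generalize (if x = 0 then 1 else 0) / (1 + δ + t * I - 1 : ℂ) = p₁ at key hpole
  generalize (if x + x = 0 then 1 else 0) / (1 + δ + (2 * t : ℝ) * I - 1 : ℂ) = p₂ at key hpole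
  rw [show 3 * (-u₀ + 1 / (1 + δ - 1)) + 4 * (-u₁ + p₁) + (-u₂ + p₂) =
    3 * (1 / (1 + δ - 1)) + (4 * p₁ + p₂) - (3 * u₀ + 4 * u₁ + u₂) by ring, sub_re, add_re,
    hmain] at key
  linarith

open Filter Topology Complex in
theorem exists_continuousOn_LSeries_eq_add_div {X : Type*} [AddCommGroup X] [DecidableEq X]
    {a D : X → ℕ → ℂ} (hX : ∀ x : X, x + x = 0 → x = 0)
    (ha : ∀ x, ∀ s : ℂ, 1 < s.re → LSeriesSummable (a x) s)
    (hD : ∀ x, ∀ s : ℂ, 1 < s.re → LSeriesSummable (D x) s) (ha1 : ∀ x, a x 1 ≠ 0)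
    (haD : ∀ x n, a x n * Real.log n = ∑ p ∈ n.divisorsAntidiagonal, D x p.1 * a x p.2)
    (hD341 : ∀ x, ∀ n : ℕ, ∀ z : ℂ, ‖z‖ = 1 →
      0 ≤ (3 * D 0 n + 4 * z * D x n + z ^ 2 * D (x + x) n).re)
    {c : ℂ} (hc : c ≠ 0) (hpart : ∀ x, ∃ C : ℝ, ∀ n : ℕ,
      ‖∑ k ∈ Finset.Icc 1 n, a x k - (if x = 0 then c else 0) * n‖ ≤ C * √n) (x : X) :
    ∃ F : ℂ → ℂ, ContinuousOn F {s | 1 ≤ s.re} ∧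
      ∀ s : ℂ, 1 < s.re → LSeries (D x) s = F s + (if x = 0 then 1 else 0) / (s - 1) := by
  choose C hC using hpart
  choose Z hZan hord hZ0 hZ1 hZD using fun x ↦
    exists_analyticOnNhd_LSeries_logDeriv (ha x) (hD x) (ha1 x) (haD x) (hC x)
  have hif : ∀ x : X, (if (if x = 0 then c else 0) = 0 then (0 : ℂ) else 1) =
      if x = 0 then 1 else 0 := by
    intro x
    split_ifs <;> simp_all
  simp_rw [hif] at hZD
  have hline := ne_zero_on_line_one hX hD hD341 hZan hord (hZ1 0 (by rwa [if_pos rfl])) hZD x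
  refine ⟨fun s ↦ -logDeriv (Z x) s, fun s (hs : 1 ≤ s.re) ↦ ?_, hZD x⟩
  have han := hZan x s (lt_of_lt_of_le (by norm_num) hs)
  refine (han.deriv.continuousAt.div han.continuousAt ?_).neg.continuousWithinAt
  rcases hs.eq_or_lt with h | h
  · have : s = 1 + s.im * I := by
      conv_lhs => rw [← re_add_im s, ← h]
      simp
    rw [this]
    exact hline _
  · exact hZ0 x s h

namespace Ideal

variable {R : Type*} [CommRing R] [IsDedekindDomain R]

theorem radical_pow_of_prime {P : Ideal R} (hP : Prime P) {k : ℕ} (hk : 0 < k) :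
    (P ^ k).radical = P := by
  rw [radical_pow _ hk.ne', (isPrime_of_prime hP).radical]

theorem finite_setOf_dvd {I : Ideal R} (hI : I ≠ 0) : {J : Ideal R | J ∣ I}.Finite :=
  @Set.toFinite _ _ (@Finite.of_fintype _ (UniqueFactorizationMonoid.fintypeSubtypeDvd I hI))

variable [Module.Free ℤ R]

open Classical in
/-- The von Mangoldt function on the ideals of `R`. -/
noncomputable def vonMangoldt (I : Ideal R) : ℝ :=
  if IsPrimePow I then Real.log (absNorm I.radical) else 0

theorem vonMangoldt_nonneg (I : Ideal R) : 0 ≤ vonMangoldt I := by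
  rw [vonMangoldt]
  split_ifs
  · exact Real.log_natCast_nonneg _
  · exact le_rfl

theorem vonMangoldt_pow {P : Ideal R} (hP : Prime P) {k : ℕ} (hk : 0 < k) :
    vonMangoldt (P ^ k) = Real.log (absNorm P) := by
  rw [vonMangoldt, if_pos ⟨P, k, hP, hk, rfl⟩, radical_pow_of_prime hP hk]

theorem vonMangoldt_of_prime {P : Ideal R} (hP : Prime P) :
    vonMangoldt P = Real.log (absNorm P) := by
  simpa using vonMangoldt_pow hP one_pos

theorem finsum_vonMangoldt_dvd_prime_mul {P I : Ideal R} (hP : Prime P) (hI : I ≠ 0) :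
    ∑ J ∈ (finite_setOf_dvd (mul_ne_zero hP.ne_zero hI)).toFinset, vonMangoldt J =
      Real.log (absNorm P) + ∑ J ∈ (finite_setOf_dvd hI).toFinset, vonMangoldt J := by
  classical
  have hsub : (finite_setOf_dvd hI).toFinset ⊆
      (finite_setOf_dvd (mul_ne_zero hP.ne_zero hI)).toFinset := fun J hJ ↦ by
    simp only [Set.Finite.mem_toFinset, Set.mem_ofPred_eq] at hJ ⊢
    exact hJ.mul_left P
  rw [← Finset.sum_sdiff hsub]
  congr 1
  have hfin : FiniteMultiplicity P I := FiniteMultiplicity.of_prime_left hP hI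
  set v := multiplicity P I
  rw [Finset.sum_eq_single (P ^ (v + 1)), vonMangoldt_pow hP (Nat.succ_pos v)]
  · intro J hJ hne
    simp only [Finset.mem_sdiff, Set.Finite.mem_toFinset, Set.mem_ofPred_eq] at hJ
    rw [vonMangoldt, if_neg]
    rintro ⟨Q, k, hQ, hk, rfl⟩
    by_cases hPQ : Q = P
    · subst hPQ
      apply hne
      congr 1
      obtain ⟨k, rfl⟩ := Nat.exists_eq_succ_of_ne_zero hk.ne'
      have h1 : Q ^ k ∣ I := by
        have := hJ.1
        rw [pow_succ'] at this
        exact (mul_dvd_mul_iff_left hP.ne_zero).mp this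
      have h2 := hfin.pow_dvd_iff_le_multiplicity.mp h1
      have h3 := hfin.pow_dvd_iff_le_multiplicity.not.mp hJ.2
      change k ≤ v at h2
      change ¬ k + 1 ≤ v at h3
      omega
    · refine hJ.2 (hQ.pow_dvd_of_dvd_mul_left k (fun h ↦ hPQ ?_) hJ.1)
      exact associated_iff_eq.mp ((hQ.dvd_prime_iff_associated hP).mp h)
  · intro h
    refine absurd ?_ h
    simp only [Finset.mem_sdiff, Set.Finite.mem_toFinset, Set.mem_ofPred_eq]
    refine ⟨?_, fun h ↦ ?_⟩
    · rw [pow_succ']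
      exact mul_dvd_mul_left _ (pow_multiplicity_dvd P I)
    · have := hfin.pow_dvd_iff_le_multiplicity.mp h
      change v + 1 ≤ v at this
      omega

variable [Module.Finite ℤ R]

theorem sum_vonMangoldt_dvd {I : Ideal R} (hI : I ≠ 0) :
    ∑ J ∈ (finite_setOf_dvd hI).toFinset, vonMangoldt J = Real.log (absNorm I) := by
  induction I using UniqueFactorizationMonoid.induction_on_prime with
  | h₁ => exact absurd rfl hI
  | h₂ I hu =>
    have h0 : Real.log (absNorm I) = 0 := by
      rw [Ideal.isUnit_iff.mp hu, absNorm_top, Nat.cast_one, Real.log_one]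
    rw [h0]
    refine Finset.sum_eq_zero fun J hJ ↦ ?_
    simp only [Set.Finite.mem_toFinset, Set.mem_ofPred_eq] at hJ
    rw [vonMangoldt, if_neg fun h ↦ h.not_isUnit (isUnit_of_dvd_unit hJ hu)]
  | h₃ I P hI0 hP ih =>
    have hN : ∀ {J : Ideal R}, J ≠ 0 → (absNorm J : ℝ) ≠ 0 := fun {J} hJ ↦ by
      exact_mod_cast fun h ↦ hJ (absNorm_eq_zero_iff.mp h)
    rw [finsum_vonMangoldt_dvd_prime_mul hP hI0, ih hI0, map_mul, Nat.cast_mul,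
      Real.log_mul (hN hP.ne_zero) (hN hI0)]

variable [CharZero R]

variable (R) in
/-- The ideals of `R` of absolute norm `n`. -/
noncomputable def ofAbsNorm (n : ℕ) : Finset (Ideal R) :=
  (finite_setOfPred_absNorm_eq (S := R) n).toFinset

@[simp]
theorem mem_ofAbsNorm {n : ℕ} {I : Ideal R} : I ∈ ofAbsNorm R n ↔ absNorm I = n := by
  simp [ofAbsNorm]

theorem sum_ofAbsNorm_mul_log {f : Ideal R → ℂ} (hf : ∀ I J, f (I * J) = f I * f J) (n : ℕ) :
    (∑ I ∈ ofAbsNorm R n, f I) * Real.log n =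
      ∑ p ∈ n.divisorsAntidiagonal, (∑ I ∈ ofAbsNorm R p.1, f I * vonMangoldt I) *
        ∑ I ∈ ofAbsNorm R p.2, f I := by
  classical
  rcases eq_or_ne n 0 with rfl | hn
  · simp
  have hI0 : ∀ I : {I // I ∈ ofAbsNorm R n}, I.1 ≠ 0 := by
    rintro ⟨I, hI⟩ rfl
    simp at hI
    exact hn hI.symm
  rw [← Finset.sum_attach, Finset.sum_mul]
  have h1 : ∀ I ∈ (ofAbsNorm R n).attach, f I.1 * (Real.log n : ℂ) =
      ∑ J ∈ (finite_setOf_dvd (hI0 I)).toFinset, f I.1 * vonMangoldt J := by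
    intro I _
    rw [← Finset.mul_sum, ← Complex.ofReal_sum, sum_vonMangoldt_dvd (hI0 I), mem_ofAbsNorm.mp I.2]
  rw [Finset.sum_congr rfl h1]
  simp_rw [Finset.sum_mul_sum, ← Finset.sum_product']
  rw [Finset.sum_sigma', Finset.sum_sigma']
  symm
  refine Finset.sum_bij (fun x hx ↦ ⟨⟨x.2.1 * x.2.2, ?_⟩, x.2.1⟩) ?_ ?_ ?_ ?_
  · simp only [Finset.mem_sigma, Nat.mem_divisorsAntidiagonal, Finset.mem_product,
      mem_ofAbsNorm] at hx
    rw [mem_ofAbsNorm, map_mul, hx.2.1, hx.2.2, hx.1.1]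
  · intro x hx
    simp
  · rintro ⟨⟨k, l⟩, J, K⟩ hx ⟨⟨k', l'⟩, J', K'⟩ hx' h
    simp only [Finset.mem_sigma, Nat.mem_divisorsAntidiagonal, Finset.mem_product,
      mem_ofAbsNorm] at hx hx'
    simp only [Sigma.mk.injEq, Subtype.mk.injEq, heq_eq_eq] at h
    obtain ⟨h, rfl⟩ := h
    have hJ : J ≠ 0 := by
      rintro rfl
      rw [← hx.1.1, ← hx.2.1] at hn
      simp at hn
    obtain rfl := mul_left_cancel₀ hJ h
    simp [← hx.2.1, ← hx.2.2, ← hx'.2.1, ← hx'.2.2]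
  · rintro ⟨⟨I, hI⟩, J⟩ hx
    simp only [Finset.mem_sigma, Set.Finite.mem_toFinset, Set.mem_ofPred_eq] at hx
    obtain ⟨K, rfl⟩ := hx.2
    refine ⟨⟨(absNorm J, absNorm K), (J, K)⟩, ?_, rfl⟩
    rw [mem_ofAbsNorm, map_mul] at hI
    simp [hI, hn]
  · rintro ⟨⟨k, l⟩, J, K⟩ hx
    simp only [hf]
    ring

theorem sum_ofAbsNorm_vonMangoldt_le (n : ℕ) :
    ∑ I ∈ ofAbsNorm R n, vonMangoldt I ≤
      Module.finrank ℤ R * ArithmeticFunction.vonMangoldt n := by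
  classical
  by_cases hn : ∃ I ∈ ofAbsNorm R n, IsPrimePow I
  swap
  · push Not at hn
    rw [Finset.sum_eq_zero fun I hI ↦ by rw [vonMangoldt, if_neg (hn I hI)]]
    exact mul_nonneg (Nat.cast_nonneg _) ArithmeticFunction.vonMangoldt_nonneg
  have hmem : ∀ {P : Ideal R} {k : ℕ}, Prime P → absNorm (P ^ k) = n → 0 < k →
      n = n.minFac ^ n.factorization n.minFac ∧ n.minFac.Prime ∧ (n.minFac : R) ∈ P := by
    intro P k hP h hk
    have : P.IsMaximal := (isPrime_of_prime hP).isMaximal hP.ne_zero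
    obtain ⟨p, m, hm, hpP, hp, hPm⟩ := exists_prime_and_absNorm_eq_pow P
    have hn : n = p ^ (m * k) := by rw [← h, map_pow, hPm, pow_mul]
    have hf : n.minFac = p := by rw [hn, hp.pow_minFac (by positivity)]
    rw [hf]
    refine ⟨?_, hp, hpP⟩
    rw [hn, hp.factorization_pow]
    simp
  obtain ⟨I, hI, P, k, hP, hk, rfl⟩ := hn
  obtain ⟨hn, hp, -⟩ := hmem hP (mem_ofAbsNorm.mp hI) hk
  set p := n.minFac
  have hk0 : n.factorization p ≠ 0 := by
    intro h0
    rw [h0, pow_zero] at hn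
    have : p = 1 := by simp [p, hn]
    exact hp.one_lt.ne' this
  rw [hn, ArithmeticFunction.vonMangoldt_apply_pow hk0,
    ArithmeticFunction.vonMangoldt_apply_prime hp, ← hn]
  set T := (ofAbsNorm R n).filter IsPrimePow with hT
  have hsum : ∑ I ∈ ofAbsNorm R n, vonMangoldt I =
      ∑ P ∈ T.image radical, Real.log (absNorm P) := by
    rw [Finset.sum_image, hT, Finset.sum_filter]
    · rfl
    · intro I hI J hJ h
      simp only [hT, Finset.coe_filter, Set.mem_ofPred_eq, mem_ofAbsNorm] at hI hJ
      obtain ⟨hI, P, k, hP, hk, rfl⟩ := hI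
      obtain ⟨hJ, Q, l, hQ, hl, rfl⟩ := hJ
      rw [radical_pow_of_prime hP hk, radical_pow_of_prime hQ hl] at h
      subst h
      congr 1
      rw [map_pow, ← hI, map_pow] at hJ
      refine Nat.pow_right_injective ?_ hJ.symm
      have h1 : absNorm P ≠ 0 := fun h ↦ hP.ne_zero (absNorm_eq_zero_iff.mp h)
      have h2 : absNorm P ≠ 1 := fun h ↦ hP.not_isUnit
        (Ideal.isUnit_iff.mpr (absNorm_eq_one_iff.mp h))
      omega
  have hprime : ∀ P ∈ T.image radical, Prime P ∧ (p : R) ∈ P := by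
    intro P hP
    simp only [hT, Finset.mem_image, Finset.mem_filter, mem_ofAbsNorm] at hP
    obtain ⟨I, ⟨hI, P, k, hP, hk, rfl⟩, rfl⟩ := hP
    rw [radical_pow_of_prime hP hk]
    exact ⟨hP, (hmem hP hI hk).2.2⟩
  have hdvd : ∏ P ∈ T.image radical, P ∣ span {(p : R)} := by
    refine Finset.prod_primes_dvd _ (fun P hP ↦ (hprime P hP).1) fun P hP ↦ ?_
    rw [dvd_span_singleton]
    exact (hprime P hP).2
  have hdvd' := Nat.le_of_dvd (by rw [absNorm_span_natCast]; exact pow_pos hp.pos _)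
    (map_dvd absNorm hdvd)
  rw [absNorm_span_natCast, map_prod] at hdvd'
  have hne : ∀ P ∈ T.image radical, (absNorm P : ℝ) ≠ 0 := fun P hP ↦ by
    exact_mod_cast fun h ↦ (hprime P hP).1.ne_zero (absNorm_eq_zero_iff.mp h)
  rw [hsum, ← Real.log_prod hne, ← Real.log_pow]
  refine Real.log_le_log ?_ (by exact_mod_cast hdvd')
  exact Finset.prod_pos fun P hP ↦ lt_of_le_of_ne (Nat.cast_nonneg _) (hne P hP).symm

end Ideal

namespace Ideal

variable {R A : Type*} [CommRing R] [AddCommGroup A]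

open Classical in
/-- The function `I ↦ ψ (φ I)` on the ideals satisfying `P`, extended by zero. -/
noncomputable def twist (P : Ideal R → Prop) (φ : Ideal R → A) (ψ : AddChar A ℂ)
    (I : Ideal R) : ℂ :=
  if P I then ψ (φ I) else 0

variable {P : Ideal R → Prop} {φ : Ideal R → A}

theorem twist_mul (hP : ∀ I J, P (I * J) ↔ P I ∧ P J)
    (hφ : ∀ I J, P I → P J → φ (I * J) = φ I + φ J) (ψ : AddChar A ℂ) (I J : Ideal R) :
    twist P φ ψ (I * J) = twist P φ ψ I * twist P φ ψ J := by
  rw [twist, twist, twist]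
  by_cases hI : P I
  · by_cases hJ : P J
    · rw [if_pos ((hP I J).mpr ⟨hI, hJ⟩), if_pos hI, if_pos hJ, hφ I J hI hJ,
        AddChar.map_add_eq_mul]
    · rw [if_neg fun h ↦ hJ ((hP I J).mp h).2, if_neg hJ, mul_zero]
  · rw [if_neg fun h ↦ hI ((hP I J).mp h).1, if_neg hI, zero_mul]

theorem norm_twist_le [Finite A] (ψ : AddChar A ℂ) (I : Ideal R) : ‖twist P φ ψ I‖ ≤ 1 := by
  rw [twist]
  split_ifs
  · rw [AddChar.norm_apply]
  · simp

theorem re_three_four_one_nonneg {z : ℂ} (hz : ‖z‖ = 1) : 0 ≤ (3 + 4 * z + z ^ 2).re := by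
  have h : z.re ^ 2 + z.im ^ 2 = 1 := by
    have := Complex.sq_norm z
    rw [hz, Complex.normSq_apply] at this
    nlinarith
  have h2 : (3 + 4 * z + z ^ 2).re = 3 + 4 * z.re + (z.re ^ 2 - z.im ^ 2) := by
    simp [pow_two]
  nlinarith [sq_nonneg (1 + z.re)]

theorem re_twist_three_four_one_nonneg [Finite A] (ψ : AddChar A ℂ) {z : ℂ} (hz : ‖z‖ = 1)
    (I : Ideal R) :
    0 ≤ (3 * twist P φ 0 I + 4 * z * twist P φ ψ I + z ^ 2 * twist P φ (ψ + ψ) I).re := by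
  rw [twist, twist, twist]
  split_ifs
  · have h := re_three_four_one_nonneg (z := z * ψ (φ I))
      (by rw [norm_mul, hz, AddChar.norm_apply, one_mul])
    rw [AddChar.zero_apply, AddChar.add_apply]
    convert h using 2
    ring
  · simp

variable [IsDedekindDomain R] [Module.Free ℤ R] [Module.Finite ℤ R] [CharZero R]

open Classical in
variable (P φ) in
/-- The number of ideals of norm `n` satisfying `P` with `φ`-value `c`. -/
noncomputable def fiberCard (c : A) (n : ℕ) : ℕ :=
  ((ofAbsNorm R n).filter fun I ↦ P I ∧ φ I = c).card

open Classical in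
theorem sum_twist_eq [Fintype A] (ψ : AddChar A ℂ) (n : ℕ) :
    ∑ I ∈ ofAbsNorm R n, twist P φ ψ I = ∑ c, ψ c * fiberCard P φ c n := by
  have : ∀ I : Ideal R, twist P φ ψ I = ∑ c, ψ c * if P I ∧ φ I = c then 1 else 0 := by
    intro I
    rw [twist]
    split_ifs with h
    · simp [h]
    · simp [h]
  simp_rw [this]
  rw [Finset.sum_comm]
  refine Finset.sum_congr rfl fun c _ ↦ ?_
  rw [← Finset.mul_sum, fiberCard, Finset.sum_boole]

theorem LSeriesSummable_sum_twist_mul_vonMangoldt [Finite A] (ψ : AddChar A ℂ) {s : ℂ}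
    (hs : 1 < s.re) :
    LSeriesSummable (fun n ↦ ∑ I ∈ ofAbsNorm R n, twist P φ ψ I * vonMangoldt I) s := by
  refine (((ArithmeticFunction.LSeriesSummable_vonMangoldt hs).smul
    (Module.finrank ℤ R : ℂ)).norm).of_norm_bounded fun n ↦ LSeries.norm_term_le s ?_
  refine (norm_sum_le _ _).trans ?_
  rw [Pi.smul_apply, smul_eq_mul, norm_mul, Complex.norm_natCast,
    Complex.norm_of_nonneg ArithmeticFunction.vonMangoldt_nonneg]
  refine le_trans (Finset.sum_le_sum fun I _ ↦ ?_) (sum_ofAbsNorm_vonMangoldt_le n)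
  rw [norm_mul, Complex.norm_of_nonneg (vonMangoldt_nonneg I)]
  exact mul_le_of_le_one_left (vonMangoldt_nonneg I) (norm_twist_le ψ I)

omit [AddCommGroup A] in
theorem sum_fiberCard_le {κ C : ℝ} {c : A}
    (hC : ∀ n : ℕ, |∑ k ∈ Finset.Icc 1 n, (fiberCard P φ c k : ℝ) - κ * n| ≤ C * √n) (n : ℕ) :
    ∑ k ∈ Finset.Icc 1 n, (fiberCard P φ c k : ℝ) ≤ (κ + |C|) * n := by
  have h1 := (le_abs_self _).trans (hC n)
  have h2 : √(n : ℝ) ≤ n := by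
    rcases Nat.eq_zero_or_pos n with rfl | hn
    · simp
    · rw [Real.sqrt_le_left (by positivity)]
      have : (1 : ℝ) ≤ n := by exact_mod_cast hn
      nlinarith
  nlinarith [mul_le_mul (le_abs_self C) h2 (Real.sqrt_nonneg _) (abs_nonneg C)]

theorem LSeriesSummable_sum_twist [Finite A] {κ : ℝ} (hcount : ∀ c : A, ∃ C : ℝ, ∀ n : ℕ,
      |∑ k ∈ Finset.Icc 1 n, (fiberCard P φ c k : ℝ) - κ * n| ≤ C * √n)
    (ψ : AddChar A ℂ) {s : ℂ} (hs : 1 < s.re) :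
    LSeriesSummable (fun n ↦ ∑ I ∈ ofAbsNorm R n, twist P φ ψ I) s := by
  classical
  have := Fintype.ofFinite A
  choose C hC using hcount
  refine LSeriesSummable_of_sum_norm_bigO (r := 1) ?_ zero_le_one hs
  refine Asymptotics.IsBigO.of_bound (∑ c : A, (κ + |C c|)) (.of_forall fun n ↦ ?_)
  rw [Real.rpow_one, Real.norm_of_nonneg (Finset.sum_nonneg fun _ _ ↦ norm_nonneg _),
    Real.norm_of_nonneg (Nat.cast_nonneg n), Finset.sum_mul]
  refine le_trans ?_ (Finset.sum_le_sum fun c _ ↦ sum_fiberCard_le (hC c) n)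
  rw [Finset.sum_comm]
  refine Finset.sum_le_sum fun k _ ↦ ?_
  rw [sum_twist_eq]
  refine (norm_sum_le _ _).trans (Finset.sum_le_sum fun c _ ↦ ?_)
  rw [norm_mul, AddChar.norm_apply, one_mul, Complex.norm_natCast]

open Classical in
theorem norm_sum_sum_twist_sub_le [Fintype A] {κ : ℝ} {C : A → ℝ} (hC : ∀ (c : A) (n : ℕ),
      |∑ k ∈ Finset.Icc 1 n, (fiberCard P φ c k : ℝ) - κ * n| ≤ C c * √n)
    (ψ : AddChar A ℂ) (n : ℕ) :
    ‖∑ k ∈ Finset.Icc 1 n, ∑ I ∈ ofAbsNorm R k, twist P φ ψ I -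
      (if ψ = 0 then (Fintype.card A * κ : ℂ) else 0) * n‖ ≤ (∑ c, C c) * √n := by
  have h1 : (if ψ = 0 then (Fintype.card A * κ : ℂ) else 0) * n = ∑ c, ψ c * (κ * n : ℂ) := by
    rw [← Finset.sum_mul, AddChar.sum_eq_ite]
    split_ifs <;> ring
  have h2 : ∑ k ∈ Finset.Icc 1 n, ∑ I ∈ ofAbsNorm R k, twist P φ ψ I =
      ∑ c, ψ c * ∑ k ∈ Finset.Icc 1 n, (fiberCard P φ c k : ℂ) := by
    simp_rw [sum_twist_eq, Finset.mul_sum]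
    rw [Finset.sum_comm]
  rw [h1, h2, ← Finset.sum_sub_distrib, Finset.sum_mul]
  refine (norm_sum_le _ _).trans (Finset.sum_le_sum fun c _ ↦ ?_)
  rw [← mul_sub, norm_mul, AddChar.norm_apply, one_mul]
  refine le_trans (le_of_eq ?_) (hC c n)
  rw [← Real.norm_eq_abs, ← Complex.norm_real]
  push_cast
  rfl

open Classical in
theorem sum_sum_twist_mul_vonMangoldt [Fintype A] (n : ℕ) :
    ∑ ψ : AddChar A ℂ, ∑ I ∈ ofAbsNorm R n, twist P φ ψ I * vonMangoldt I =
      (Fintype.card A : ℂ) *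
        ((∑ I ∈ (ofAbsNorm R n).filter (fun I ↦ P I ∧ φ I = 0), vonMangoldt I : ℝ) : ℂ) := by
  rw [Finset.sum_comm, Complex.ofReal_sum, Finset.mul_sum, Finset.sum_filter]
  refine Finset.sum_congr rfl fun I _ ↦ ?_
  rw [← Finset.sum_mul]
  simp only [twist]
  by_cases hI : P I
  · simp only [hI, if_true, true_and, AddChar.sum_apply_eq_ite]
    split_ifs <;> simp
  · simp [hI]

theorem re_sum_twist_three_four_one_nonneg [Finite A] (ψ : AddChar A ℂ) (n : ℕ) {z : ℂ}
    (hz : ‖z‖ = 1) :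
    0 ≤ (3 * ∑ I ∈ ofAbsNorm R n, twist P φ 0 I * vonMangoldt I +
      4 * z * ∑ I ∈ ofAbsNorm R n, twist P φ ψ I * vonMangoldt I +
      z ^ 2 * ∑ I ∈ ofAbsNorm R n, twist P φ (ψ + ψ) I * vonMangoldt I).re := by
  rw [Finset.mul_sum, Finset.mul_sum, Finset.mul_sum, ← Finset.sum_add_distrib,
    ← Finset.sum_add_distrib, Complex.re_sum]
  refine Finset.sum_nonneg fun I _ ↦ ?_
  have h := mul_nonneg (re_twist_three_four_one_nonneg (P := P) (φ := φ) ψ hz I)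
    (vonMangoldt_nonneg I)
  rw [← Complex.re_mul_ofReal] at h
  convert h using 2
  ring

theorem _root_.AddChar.eq_zero_of_add_self_eq_zero {A : Type*} [AddCommGroup A] [Finite A]
    (hA : ∀ a : A, a + a = 0 → a = 0)
    {ψ : AddChar A ℂ} (h : ψ + ψ = 0) : ψ = 0 := by
  have hinj : Function.Injective fun a : A ↦ a + a := fun a b hab ↦ by
    have : (a - b) + (a - b) = 0 := by
      rw [sub_add_sub_comm]
      exact sub_eq_zero.mpr hab
    exact sub_eq_zero.mp (hA _ this)
  ext a
  obtain ⟨b, rfl⟩ := Finite.surjective_of_injective hinj a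
  have h1 := DFunLike.congr_fun h b
  rw [AddChar.add_apply] at h1
  change ψ (b + b) = _
  rw [AddChar.map_add_eq_mul, h1]
  rfl

end Ideal

namespace Ideal

variable {R A : Type*} [CommRing R] [AddCommGroup A] {P : Ideal R → Prop} {φ : Ideal R → A}
variable [IsDedekindDomain R] [Module.Free ℤ R] [Module.Finite ℤ R] [CharZero R]

open Classical in
theorem exists_continuousOn_LSeries_sum_twist [Fintype A] (hA : ∀ a : A, a + a = 0 → a = 0)
    (hP1 : P ⊤) (hP : ∀ I J, P (I * J) ↔ P I ∧ P J)
    (hφ : ∀ I J, P I → P J → φ (I * J) = φ I + φ J) {κ : ℝ} (hκ : 0 < κ)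
    (hcount : ∀ c : A, ∃ C : ℝ, ∀ n : ℕ,
      |∑ k ∈ Finset.Icc 1 n, (fiberCard P φ c k : ℝ) - κ * n| ≤ C * √n) (ψ : AddChar A ℂ) :
    ∃ F : ℂ → ℂ, ContinuousOn F {s | 1 ≤ s.re} ∧ ∀ s : ℂ, 1 < s.re →
      LSeries (fun n ↦ ∑ I ∈ ofAbsNorm R n, twist P φ ψ I * vonMangoldt I) s =
        F s + (if ψ = 0 then 1 else 0) / (s - 1) := by
  have ha1 : ∀ ψ : AddChar A ℂ, ∑ I ∈ ofAbsNorm R 1, twist P φ ψ I ≠ 0 := by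
    intro ψ
    rw [Finset.sum_eq_single ⊤]
    · rw [twist, if_pos hP1]
      exact fun h ↦ by simpa [h] using AddChar.norm_apply ψ (φ ⊤)
    · intro I hI hne
      exact absurd (absNorm_eq_one_iff.mp (mem_ofAbsNorm.mp hI)) hne
    · intro h
      exact absurd (mem_ofAbsNorm.mpr absNorm_top) h
  have hc : (Fintype.card A * κ : ℂ) ≠ 0 := by
    rw [mul_ne_zero_iff, Nat.cast_ne_zero, Complex.ofReal_ne_zero]
    exact ⟨Fintype.card_ne_zero, hκ.ne'⟩
  have hsum := LSeriesSummable_sum_twist hcount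
  choose C hC using hcount
  exact exists_continuousOn_LSeries_eq_add_div
    (a := fun ψ n ↦ ∑ I ∈ ofAbsNorm R n, twist P φ ψ I)
    (D := fun ψ n ↦ ∑ I ∈ ofAbsNorm R n, twist P φ ψ I * vonMangoldt I)
    (fun ψ hψ ↦ AddChar.eq_zero_of_add_self_eq_zero hA hψ) (fun ψ s hs ↦ hsum ψ hs)
    (fun ψ s hs ↦ LSeriesSummable_sum_twist_mul_vonMangoldt ψ hs) ha1
    (fun ψ n ↦ sum_ofAbsNorm_mul_log (twist_mul hP hφ ψ) n)
    (fun ψ n z hz ↦ re_sum_twist_three_four_one_nonneg ψ n hz) hc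
    (fun ψ ↦ ⟨_, norm_sum_sum_twist_sub_le hC ψ⟩) ψ

open Classical in
variable (P φ) in
/-- The sum of the von Mangoldt function over the ideals of norm `n` in the kernel of `φ`. -/
noncomputable def kerVonMangoldt (n : ℕ) : ℝ :=
  ∑ I ∈ (ofAbsNorm R n).filter (fun I ↦ P I ∧ φ I = 0), vonMangoldt I

theorem kerVonMangoldt_nonneg (n : ℕ) : 0 ≤ kerVonMangoldt P φ n :=
  Finset.sum_nonneg fun I _ ↦ vonMangoldt_nonneg I

open Classical in
theorem kerVonMangoldt_le (n : ℕ) :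
    kerVonMangoldt P φ n ≤ Module.finrank ℤ R * ArithmeticFunction.vonMangoldt n :=
  (Finset.sum_le_sum_of_subset_of_nonneg (Finset.filter_subset _ _)
    fun I _ _ ↦ vonMangoldt_nonneg I).trans (sum_ofAbsNorm_vonMangoldt_le n)

theorem sum_kerVonMangoldt_le (n : ℕ) :
    ∑ k ∈ Finset.Icc 1 n, kerVonMangoldt P φ k ≤
      Module.finrank ℤ R * (Real.log 4 + 4) * n := by
  refine (Finset.sum_le_sum fun k _ ↦ kerVonMangoldt_le k).trans ?_
  rw [← Finset.mul_sum, mul_assoc]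
  refine mul_le_mul_of_nonneg_left ?_ (Nat.cast_nonneg _)
  refine le_trans ?_ (Chebyshev.psi_le_const_mul_self (Nat.cast_nonneg n))
  rw [Chebyshev.psi_eq_sum_Icc, Nat.floor_natCast]
  exact Finset.sum_le_sum_of_subset_of_nonneg (Finset.Icc_subset_Icc_left zero_le_one)
    fun _ _ _ ↦ ArithmeticFunction.vonMangoldt_nonneg

/-- Equidistribution of prime ideals in the trivial class, for a class map with kernel of odd
index all of whose fibers have the same density. -/
theorem tendsto_sum_kerVonMangoldt [Finite A] (hA : ∀ a : A, a + a = 0 → a = 0)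
    (hP1 : P ⊤) (hP : ∀ I J, P (I * J) ↔ P I ∧ P J)
    (hφ : ∀ I J, P I → P J → φ (I * J) = φ I + φ J) {κ : ℝ} (hκ : 0 < κ)
    (hcount : ∀ c : A, ∃ C : ℝ, ∀ n : ℕ,
      |∑ k ∈ Finset.Icc 1 n, (fiberCard P φ c k : ℝ) - κ * n| ≤ C * √n) :
    Filter.Tendsto (fun n : ℕ ↦ (∑ k ∈ Finset.Icc 1 n, kerVonMangoldt P φ k) / n) Filter.atTop
      (nhds (1 / Nat.card A)) := by
  classical
  have := Fintype.ofFinite A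
  choose F hFc hF using exists_continuousOn_LSeries_sum_twist hA hP1 hP hφ hκ hcount
  have hcard : (Fintype.card A : ℂ) ≠ 0 := Nat.cast_ne_zero.mpr Fintype.card_ne_zero
  refine wienerIkehara kerVonMangoldt_nonneg sum_kerVonMangoldt_le
    (F := fun s ↦ (Fintype.card A : ℂ)⁻¹ * ∑ ψ, F ψ s) ?_ fun s hs ↦ ?_
  · exact continuousOn_const.mul (continuousOn_finsetSum _ fun ψ _ ↦ hFc ψ)
  · have h1 : (fun n ↦ (kerVonMangoldt P φ n : ℂ)) = (Fintype.card A : ℂ)⁻¹ •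
        ∑ ψ : AddChar A ℂ, fun n ↦ ∑ I ∈ ofAbsNorm R n, twist P φ ψ I * vonMangoldt I := by
      funext n
      rw [Pi.smul_apply, Finset.sum_apply, sum_sum_twist_mul_vonMangoldt, smul_eq_mul,
        inv_mul_cancel_left₀ hcard]
      rfl
    rw [h1, LSeries_smul, LSeries_sum
      fun ψ _ ↦ LSeriesSummable_sum_twist_mul_vonMangoldt ψ hs]
    simp_rw [hF _ s hs]
    rw [Finset.sum_add_distrib, ← Finset.sum_div, Finset.sum_ite_eq' Finset.univ 0,
      if_pos (Finset.mem_univ _), Nat.card_eq_fintype_card]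
    push_cast
    rw [mul_add, mul_one_div, one_div, div_eq_mul_inv]

end Ideal

open nonZeroDivisors in
/-- The class of an ideal which is invertible as a fractional ideal. -/
noncomputable def ClassGroup.ofIdeal {O : Type*} [CommRing O] [IsDomain O] (I : Ideal O) :
    ClassGroup O :=
  open Classical in
  if h : IsUnit (I : FractionalIdeal O⁰ (FractionRing O)) then ClassGroup.mk _ h.unit else 1

namespace ClassGroup

open nonZeroDivisors

variable {O : Type*} [CommRing O] [IsDomain O]

theorem ofIdeal_of_coe {I : Ideal O} {u : (FractionalIdeal O⁰ (FractionRing O))ˣ}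
    (hu : (u : FractionalIdeal O⁰ (FractionRing O)) = I) :
    ofIdeal I = ClassGroup.mk (FractionRing O) u := by
  have h : IsUnit (I : FractionalIdeal O⁰ (FractionRing O)) := hu ▸ u.isUnit
  rw [ofIdeal, dif_pos h]
  congr 1
  ext1
  rw [IsUnit.unit_spec, hu]

theorem ofIdeal_mul {I J : Ideal O} (hI : IsUnit (I : FractionalIdeal O⁰ (FractionRing O)))
    (hJ : IsUnit (J : FractionalIdeal O⁰ (FractionRing O))) :
    ofIdeal (I * J) = ofIdeal I * ofIdeal J := by
  obtain ⟨u, hu⟩ := hI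
  obtain ⟨v, hv⟩ := hJ
  have huv : ((u * v : (FractionalIdeal O⁰ (FractionRing O))ˣ) :
      FractionalIdeal O⁰ (FractionRing O)) = ((I * J : Ideal O) : FractionalIdeal O⁰ _) := by
    rw [Units.val_mul, hu, hv, FractionalIdeal.coeIdeal_mul]
  rw [ofIdeal_of_coe hu, ofIdeal_of_coe hv, ofIdeal_of_coe huv, map_mul]

theorem ofIdeal_eq_one_iff {I : Ideal O} (hI : IsUnit (I : FractionalIdeal O⁰ (FractionRing O))) :
    ofIdeal I = 1 ↔ ∃ x : O, x ≠ 0 ∧ I = Ideal.span {x} := by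
  obtain ⟨u, hu⟩ := hI
  rw [ofIdeal_of_coe hu, ClassGroup.mk_eq_one_of_coe_ideal hu]

theorem isUnit_coe_of_mul_eq_span {I J : Ideal O} {m : O} (hm : m ≠ 0)
    (h : I * J = Ideal.span {m}) : IsUnit (I : FractionalIdeal O⁰ (FractionRing O)) := by
  refine IsUnit.of_mul_eq_one
    ((J : FractionalIdeal O⁰ (FractionRing O)) * FractionalIdeal.spanSingleton O⁰
      (algebraMap O (FractionRing O) m)⁻¹) ?_
  rw [← mul_assoc, ← FractionalIdeal.coeIdeal_mul, h, FractionalIdeal.coeIdeal_span_singleton,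
    FractionalIdeal.spanSingleton_mul_spanSingleton, mul_inv_cancel₀,
    FractionalIdeal.spanSingleton_one]
  rwa [ne_eq, FaithfulSMul.algebraMap_eq_zero_iff]

/-- Every class contains an invertible ideal that is not contained in a given proper ideal. -/
theorem exists_ofIdeal_eq_not_le {Q : Ideal O} (hQ : Q ≠ ⊤) (c : ClassGroup O) :
    ∃ I : Ideal O, IsUnit (I : FractionalIdeal O⁰ (FractionRing O)) ∧ ofIdeal I = c ∧ ¬ I ≤ Q := by
  refine ClassGroup.induction (FractionRing O) (fun J ↦ ?_) c
  have h1 : ¬ (J⁻¹.1 * J.1 ≤ (Q : FractionalIdeal O⁰ (FractionRing O))) := by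
    intro h
    rw [Units.inv_mul, ← FractionalIdeal.coeIdeal_top,
      FractionalIdeal.coeIdeal_le_coeIdeal] at h
    exact hQ (top_le_iff.mp h)
  rw [FractionalIdeal.mul_le] at h1
  push Not at h1
  obtain ⟨x, hx, y, hy, hxy⟩ := h1
  have hx0 : x ≠ 0 := by
    rintro rfl
    rw [zero_mul] at hxy
    exact hxy (FractionalIdeal.zero_mem _)
  have h2 : FractionalIdeal.spanSingleton O⁰ x * J.1 ≤ 1 := by
    rw [← Units.inv_mul J]
    refine mul_le_mul_left ?_ J.1
    rw [FractionalIdeal.spanSingleton_le_iff_mem]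
    exact hx
  obtain ⟨I, hI⟩ := FractionalIdeal.le_one_iff_exists_coeIdeal.mp h2
  have h3 : ((J * toPrincipalIdeal O (FractionRing O) (Units.mk0 x hx0) :
      (FractionalIdeal O⁰ (FractionRing O))ˣ) : FractionalIdeal O⁰ (FractionRing O)) = I := by
    rw [hI, Units.val_mul, coe_toPrincipalIdeal, mul_comm, Units.val_mk0]
  refine ⟨I, h3 ▸ Units.isUnit _, ?_, fun hle ↦ ?_⟩
  · rw [ofIdeal_of_coe h3]
    exact (ClassGroup.mk_eq_mk.mpr ⟨_, rfl⟩).symm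
  · refine hxy (FractionalIdeal.coeIdeal_le_coeIdeal _ |>.mpr hle ?_)
    rw [hI]
    exact FractionalIdeal.mul_mem_mul (FractionalIdeal.mem_spanSingleton_self _ _) hy

end ClassGroup

namespace Ideal

/-- An ideal containing an odd rational integer. -/
def ContainsOdd {R : Type*} [CommRing R] (I : Ideal R) : Prop :=
  ∃ m : ℤ, Odd m ∧ (m : R) ∈ I

theorem ContainsOdd.mul {R : Type*} [CommRing R] {I J : Ideal R} (hI : I.ContainsOdd)
    (hJ : J.ContainsOdd) : (I * J).ContainsOdd := by
  obtain ⟨m, hm, hmI⟩ := hI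
  obtain ⟨n, hn, hnJ⟩ := hJ
  exact ⟨m * n, hm.mul hn, by rw [Int.cast_mul]; exact mul_mem_mul hmI hnJ⟩

theorem containsOdd_of_odd_absNorm {S : Type*} [CommRing S] [IsDedekindDomain S]
    [Module.Free ℤ S] {I : Ideal S} (hI : Odd (absNorm I)) : I.ContainsOdd :=
  ⟨absNorm I, by exact_mod_cast hI, by rw [Int.cast_natCast]; exact absNorm_mem I⟩

theorem ContainsOdd.odd_absNorm {S : Type*} [CommRing S] [IsDedekindDomain S]
    [Module.Free ℤ S] [Module.Finite ℤ S] {I : Ideal S} (hI : I.ContainsOdd) : Odd (absNorm I) := by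
  obtain ⟨m, hm, hmI⟩ := hI
  have h := absNorm_dvd_absNorm_of_le ((span_singleton_le_iff_mem I).mpr hmI)
  rw [absNorm_span_singleton, ← eq_intCast (algebraMap ℤ S) m, Algebra.norm_algebraMap,
    Int.natAbs_pow] at h
  exact Odd.of_dvd_nat ((Int.natAbs_odd.mpr hm).pow) h

variable {O S : Type*} [CommRing O] [CommRing S] {ι : O →+* S}

theorem ContainsOdd.comap {I : Ideal S} (hI : I.ContainsOdd) : (I.comap ι).ContainsOdd := by
  obtain ⟨m, hm, hmI⟩ := hI
  exact ⟨m, hm, by rwa [mem_comap, map_intCast]⟩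

theorem ContainsOdd.map {I : Ideal O} (hI : I.ContainsOdd) : (I.map ι).ContainsOdd := by
  obtain ⟨m, hm, hmI⟩ := hI
  exact ⟨m, hm, by simpa using mem_map_of_mem ι hmI⟩

theorem ContainsOdd.mem_of_two_mul_mem {I : Ideal S} (hI : I.ContainsOdd) {x : S}
    (hx : 2 * x ∈ I) : x ∈ I := by
  obtain ⟨m, ⟨k, rfl⟩, hmI⟩ := hI
  have : x = x * ((2 * k + 1 : ℤ) : S) - k * (2 * x) := by push_cast; ring
  rw [this]
  exact sub_mem (I.mul_mem_left _ hmI) (I.mul_mem_left _ hx)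

theorem ContainsOdd.map_comap (h2 : ∀ s : S, ∃ o, ι o = 2 * s) {I : Ideal S}
    (hI : I.ContainsOdd) : (I.comap ι).map ι = I := by
  refine le_antisymm map_comap_le fun x hx ↦ ?_
  obtain ⟨o, ho⟩ := h2 x
  refine hI.comap.map.mem_of_two_mul_mem ?_
  rw [← ho]
  refine mem_map_of_mem ι ?_
  rw [mem_comap, ho]
  exact I.mul_mem_left _ hx

theorem exists_mem_eq_two_mul_of_mem_map (h2 : ∀ s : S, ∃ o, ι o = 2 * s) {I : Ideal O} {x : S}
    (hx : x ∈ I.map ι) (s : S) : ∃ o ∈ I, ι o = 2 * (s * x) := by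
  refine Submodule.span_induction (p := fun x _ ↦ ∀ s, ∃ o ∈ I, ι o = 2 * (s * x))
    ?_ (fun s ↦ ⟨0, zero_mem _, by simp⟩) ?_ ?_ hx s
  · rintro _ ⟨a, ha, rfl⟩ s
    obtain ⟨o, ho⟩ := h2 s
    exact ⟨o * a, I.mul_mem_left _ ha, by rw [map_mul, ho, mul_assoc]⟩
  · rintro x y _ _ hx hy s
    obtain ⟨o, ho, hox⟩ := hx s
    obtain ⟨o', ho', hoy⟩ := hy s
    exact ⟨o + o', add_mem ho ho', by rw [map_add, hox, hoy]; ring⟩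
  · rintro r x _ hx s
    obtain ⟨o, ho, hox⟩ := hx (s * r)
    exact ⟨o, ho, by rw [hox, smul_eq_mul, mul_assoc]⟩

theorem ContainsOdd.comap_map (hι : Function.Injective ι) (h2 : ∀ s : S, ∃ o, ι o = 2 * s)
    {I : Ideal O} (hI : I.ContainsOdd) : (I.map ι).comap ι = I := by
  refine le_antisymm (fun x hx ↦ ?_) le_comap_map
  refine hI.mem_of_two_mul_mem ?_
  obtain ⟨o, ho, hox⟩ := exists_mem_eq_two_mul_of_mem_map h2 (mem_comap.mp hx) 1
  have : o = 2 * x := hι (by rw [hox, one_mul, map_mul, map_ofNat])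
  rwa [← this]

theorem ContainsOdd.comap_mul (hι : Function.Injective ι) (h2 : ∀ s : S, ∃ o, ι o = 2 * s)
    {I J : Ideal S} (hI : I.ContainsOdd) (hJ : J.ContainsOdd) :
    (I * J).comap ι = I.comap ι * J.comap ι := by
  conv_lhs => rw [← hI.map_comap h2, ← hJ.map_comap h2, ← Ideal.map_mul]
  exact (hI.comap.mul hJ.comap).comap_map hι h2

open nonZeroDivisors in
theorem ContainsOdd.isUnit_coe_comap [IsDomain O] [CharZero O] [IsDedekindDomain S]
    (hι : Function.Injective ι) (h2 : ∀ s : S, ∃ o, ι o = 2 * s) {I : Ideal S}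
    (hI : I.ContainsOdd) : IsUnit (I.comap ι : FractionalIdeal O⁰ (FractionRing O)) := by
  obtain ⟨m, hm, hmI⟩ := id hI
  obtain ⟨J, hJ⟩ := dvd_span_singleton.mpr hmI
  have hJ' : J.ContainsOdd :=
    ⟨m, hm, dvd_span_singleton.mp (hJ ▸ dvd_mul_left J I)⟩
  have hm0 : (m : O) ≠ 0 := by
    rw [ne_eq, Int.cast_eq_zero]
    rintro rfl
    simp at hm
  refine ClassGroup.isUnit_coe_of_mul_eq_span hm0 (J := J.comap ι) ?_
  rw [← hI.comap_mul hι h2 hJ', ← hJ, ← map_intCast ι, ← Set.image_singleton, ← map_span]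
  exact ContainsOdd.comap_map hι h2 ⟨m, hm, mem_span_singleton_self _⟩

/-- The class in the class group of `O` of the contraction of an ideal of `S`. -/
noncomputable def comapClass [IsDomain O] (ι : O →+* S) (I : Ideal S) :
    Additive (ClassGroup O) :=
  .ofMul (ClassGroup.ofIdeal (I.comap ι))

section comapClass

variable [IsDomain O] [CharZero O] [IsDedekindDomain S]

theorem ContainsOdd.comapClass_mul (hι : Function.Injective ι)
    (h2 : ∀ s : S, ∃ o, ι o = 2 * s) {I J : Ideal S} (hI : I.ContainsOdd) (hJ : J.ContainsOdd) :
    comapClass ι (I * J) = comapClass ι I + comapClass ι J := by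
  rw [comapClass, hI.comap_mul hι h2 hJ, ClassGroup.ofIdeal_mul (hI.isUnit_coe_comap hι h2)
    (hJ.isUnit_coe_comap hι h2)]
  rfl

theorem ContainsOdd.exists_eq_span_of_comapClass_eq_zero (hι : Function.Injective ι)
    (h2 : ∀ s : S, ∃ o, ι o = 2 * s) {I : Ideal S} (hI : I.ContainsOdd)
    (h : comapClass ι I = 0) : ∃ x : O, I = span {ι x} := by
  rw [comapClass, ofMul_eq_zero, ClassGroup.ofIdeal_eq_one_iff (hI.isUnit_coe_comap hι h2)] at h
  obtain ⟨x, -, hx⟩ := h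
  refine ⟨x, ?_⟩
  rw [← hI.map_comap h2, hx, map_span, Set.image_singleton]

theorem comapClass_span_eq_zero (hι : Function.Injective ι)
    (h2 : ∀ s : S, ∃ o, ι o = 2 * s) {x : O} (hx : (span {x}).ContainsOdd) :
    comapClass ι (span {ι x}) = 0 := by
  have hS : span {ι x} = (span {x}).map ι := by rw [map_span, Set.image_singleton]
  have hx0 : x ≠ 0 := by
    rintro rfl
    obtain ⟨m, hm, hm0⟩ := hx
    rw [mem_span_singleton, zero_dvd_iff, Int.cast_eq_zero] at hm0
    simp [hm0] at hm
  rw [hS, comapClass, ofMul_eq_zero,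
    ClassGroup.ofIdeal_eq_one_iff (hx.map.isUnit_coe_comap hι h2)]
  exact ⟨x, hx0, hx.comap_map hι h2⟩

end comapClass

theorem exists_containsOdd_comapClass_eq [IsDomain O] (hι : Function.Injective ι)
    (h2 : ∀ s : S, ∃ o, ι o = 2 * s) {Q : Ideal O} (hQ : Q ≠ ⊤)
    (hQ' : ∀ x ∉ Q, (span {x}).ContainsOdd) (c : Additive (ClassGroup O)) :
    ∃ I : Ideal S, I.ContainsOdd ∧ comapClass ι I = c := by
  obtain ⟨I, hI, hc, hIQ⟩ := ClassGroup.exists_ofIdeal_eq_not_le hQ c.toMul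
  obtain ⟨x, hxI, hxQ⟩ := Set.not_subset.mp hIQ
  obtain ⟨m, hm, hmx⟩ := hQ' x hxQ
  have hI' : I.ContainsOdd := ⟨m, hm, (span_singleton_le_iff_mem I).mpr hxI hmx⟩
  exact ⟨I.map ι, hI'.map, by rw [comapClass, hI'.comap_map hι h2, hc]; rfl⟩

end Ideal

theorem Int.exists_sq_add_mul_sq_of_mul_eq {q A B w : ℤ} (hq : Prime q) (hA : 0 ≤ A) (hB : 0 ≤ B)
    (hq0 : 0 < q) (hAB : IsCoprime A B) (h : A * B = q * w ^ 2) :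
    ∃ s t : ℤ, s ^ 2 * t ^ 2 = w ^ 2 ∧
      (A = s ^ 2 ∧ B = q * t ^ 2 ∨ A = q * t ^ 2 ∧ B = s ^ 2) := by
  have hsq : ∀ {a b : ℤ}, 0 ≤ a → IsCoprime a b → a * b = w ^ 2 → ∃ r, a = r ^ 2 := by
    intro a b ha hab h
    obtain ⟨r, hr | hr⟩ := Int.sq_of_isCoprime hab h
    · exact ⟨r, hr⟩
    · exact ⟨0, by nlinarith [sq_nonneg r]⟩
  have key : ∀ {a b : ℤ}, 0 ≤ a → 0 ≤ b → IsCoprime a b → a * b = q * w ^ 2 → q ∣ b →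
      ∃ s t : ℤ, s ^ 2 * t ^ 2 = w ^ 2 ∧ a = s ^ 2 ∧ b = q * t ^ 2 := by
    rintro a _ ha hb hab h ⟨b, rfl⟩
    have hab' : IsCoprime a b := hab.of_mul_right_right
    have h' : a * b = w ^ 2 := mul_left_cancel₀ hq.ne_zero (by rw [← h]; ring)
    have hb' : 0 ≤ b := nonneg_of_mul_nonneg_right hb hq0
    obtain ⟨s, rfl⟩ := hsq ha hab' h'
    obtain ⟨t, rfl⟩ := hsq hb' hab'.symm (by rw [← h']; ring)
    exact ⟨s, t, h', rfl, rfl⟩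
  rcases hq.dvd_or_dvd (h ▸ dvd_mul_right q _) with hd | hd
  · obtain ⟨s, t, h1, h2, h3⟩ := key hB hA hAB.symm (by rw [← h]; ring) hd
    exact ⟨s, t, h1, Or.inr ⟨h3, h2⟩⟩
  · obtain ⟨s, t, h1, h2, h3⟩ := key hA hB hAB h hd
    exact ⟨s, t, h1, Or.inl ⟨h2, h3⟩⟩

namespace Zsqrtd

variable {q : ℕ}

theorem norm_neg_natCast (α : ℤ√(-(q : ℤ))) : α.norm = α.re ^ 2 + q * α.im ^ 2 := by
  rw [norm_def]
  ring

theorem containsOdd_span_of_odd_norm {d : ℤ} {α : ℤ√d} (h : Odd α.norm) :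
    (Ideal.span {α}).ContainsOdd :=
  ⟨α.norm, h, by
    rw [norm_eq_mul_conj]
    exact Ideal.mul_mem_right _ _ (Ideal.mem_span_singleton_self α)⟩

theorem prime_dvd_of_sq_dvd {p : ℤ} (hp : Prime p) (hp2 : ¬ p ∣ 2) (hpq : ¬ p ∣ q)
    {y : ℤ√(-(q : ℤ))} (h : (p : ℤ√(-(q : ℤ))) ∣ y ^ 2) : (p : ℤ√(-(q : ℤ))) ∣ y := by
  rw [intCast_dvd] at h ⊢
  have hre : (y ^ 2).re = y.re ^ 2 - q * y.im ^ 2 := by rw [pow_two, re_mul]; ring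
  have him : (y ^ 2).im = 2 * (y.re * y.im) := by rw [pow_two, im_mul]; ring
  rw [hre, him] at h
  obtain ⟨h1, h2⟩ := h
  rcases hp.dvd_or_dvd ((hp.dvd_or_dvd h2).resolve_left hp2) with h3 | h3
  · refine ⟨h3, ?_⟩
    have h4 : p ∣ q * y.im ^ 2 := by
      have := dvd_sub (dvd_pow h3 two_ne_zero) h1
      rwa [sub_sub_cancel] at this
    exact hp.dvd_of_dvd_pow ((hp.dvd_or_dvd h4).resolve_left hpq)
  · refine ⟨?_, h3⟩
    have h4 : p ∣ y.re ^ 2 := by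
      have := dvd_add h1 ((dvd_pow h3 two_ne_zero).mul_left (q : ℤ))
      rwa [sub_add_cancel] at this
    exact hp.dvd_of_dvd_pow h4

theorem sqrtd_dvd_of_dvd_sq (hq : q.Prime) {y : ℤ√(-(q : ℤ))}
    (h : ((q : ℤ) : ℤ√(-(q : ℤ))) ∣ y ^ 2) : sqrtd ∣ y := by
  rw [intCast_dvd] at h
  have hre : (y ^ 2).re = y.re ^ 2 - q * y.im ^ 2 := by rw [pow_two, re_mul]; ring
  have h4 : (q : ℤ) ∣ y.re ^ 2 := by
    have := dvd_add h.1 (dvd_mul_right (q : ℤ) (y.im ^ 2))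
    rwa [hre, sub_add_cancel] at this
  obtain ⟨a, ha⟩ := (Nat.prime_iff_prime_int.mp hq).dvd_of_dvd_pow h4
  refine ⟨⟨y.im, -a⟩, ?_⟩
  ext
  · simp [ha]
  · simp

variable {S : Type*} [CommRing S] {ι : ℤ√(-(q : ℤ)) →+* S}

/-- If the square of an odd ideal is generated by a multiple of a rational prime `p`, the ideal is
contained in a proper principal ideal. -/
theorem exists_le_span_of_dvd [IsDedekindDomain S] (hq : q.Prime) (hι : Function.Injective ι)
    (h2 : ∀ s : S, ∃ o, ι o = 2 * s)
    {I : Ideal S} {α : ℤ√(-(q : ℤ))} (hα : I ^ 2 = Ideal.span {ι α}) {p : ℤ} (hp : Prime p)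
    (hp2 : ¬ p ∣ 2) (hpα : (p : ℤ√(-(q : ℤ))) ∣ α) :
    ∃ π : ℤ√(-(q : ℤ)), 1 < π.norm ∧ Odd π.norm ∧ I ≤ Ideal.span {ι π} := by
  have hpodd : Odd p := Int.not_even_iff_odd.mp fun h ↦ by
    have h2p := even_iff_two_dvd.mp h
    exact hp2 ((Int.prime_two.dvd_prime_iff_associated hp).mp h2p).symm.dvd
  have hsq : ∀ x ∈ I, ∃ y : ℤ√(-(q : ℤ)), ι y = 2 * x ∧ (p : ℤ√(-(q : ℤ))) ∣ y ^ 2 := by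
    intro x hx
    obtain ⟨y, hy⟩ := h2 x
    refine ⟨y, hy, ?_⟩
    have hx2 : x ^ 2 ∈ Ideal.span {ι α} := hα ▸ Ideal.pow_mem_pow hx 2
    obtain ⟨s, hs⟩ := Ideal.mem_span_singleton'.mp hx2
    obtain ⟨o, ho⟩ := h2 s
    refine hpα.trans ⟨2 * o, hι ?_⟩
    rw [map_mul, map_mul, map_pow, hy, ho, mul_pow, ← hs, map_ofNat]
    ring
  have hmem : ∀ π : ℤ√(-(q : ℤ)), Odd π.norm →
      (∀ y : ℤ√(-(q : ℤ)), (p : ℤ√(-(q : ℤ))) ∣ y ^ 2 → π ∣ y) → I ≤ Ideal.span {ι π} := by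
    intro π hπ h x hx
    obtain ⟨y, hy, hpy⟩ := hsq x hx
    have hodd : (Ideal.span {ι π}).ContainsOdd := by
      have := (containsOdd_span_of_odd_norm hπ).map (ι := ι)
      rwa [Ideal.map_span, Set.image_singleton] at this
    refine hodd.mem_of_two_mul_mem ?_
    rw [← hy]
    exact Ideal.mem_span_singleton.mpr (map_dvd ι (h y hpy))
  by_cases hpq : p ∣ q
  · have hqp : (q : ℤ) ∣ p :=
      ((hp.dvd_prime_iff_associated (Nat.prime_iff_prime_int.mp hq)).mp hpq).symm.dvd
    have hqodd : Odd (q : ℤ) := by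
      obtain ⟨k, rfl⟩ := hqp
      exact (Int.odd_mul.mp hpodd).1
    have hnorm : (sqrtd : ℤ√(-(q : ℤ))).norm = q := by simp [norm_def]
    refine ⟨sqrtd, ?_, ?_, hmem _ ?_ fun y hy ↦ ?_⟩
    · rw [hnorm]
      exact_mod_cast hq.one_lt
    · rw [hnorm]
      exact hqodd
    · rw [hnorm]
      exact hqodd
    · exact sqrtd_dvd_of_dvd_sq hq ((Int.cast_dvd_cast _ _ hqp).trans hy)
  · have hnorm : ((p : ℤ) : ℤ√(-(q : ℤ))).norm = p * p := norm_intCast p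
    refine ⟨p, ?_, ?_, hmem p ?_ fun y hy ↦ prime_dvd_of_sq_dvd hp hp2 hpq hy⟩
    · rw [hnorm]
      have h1 : p ≠ 0 := hp.ne_zero
      have h3 : p ≠ 1 := fun h ↦ hp.not_isUnit (h ▸ isUnit_one)
      have h4 : p ≠ -1 := fun h ↦ hp.not_isUnit (h ▸ isUnit_one.neg)
      rcases lt_or_gt_of_ne h1 with h | h
      · have : p ≤ -2 := by omega
        nlinarith
      · have : 2 ≤ p := by omega
        nlinarith
    · rw [hnorm]
      exact hpodd.mul hpodd
    · rw [hnorm]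
      exact hpodd.mul hpodd

end Zsqrtd

namespace Zsqrtd

variable {q : ℕ} {S : Type*} [CommRing S] {ι : ℤ√(-(q : ℤ)) →+* S} [IsDedekindDomain S]
  [Module.Free ℤ S]

section

variable [Module.Finite ℤ S] [IsDomain (ℤ√(-(q : ℤ)))]

/-- An odd ideal contained in a proper odd principal ideal can be replaced by an ideal of smaller
norm in its class. -/
theorem exists_absNorm_lt_of_le_span (hι : Function.Injective ι)
    (h2 : ∀ s : S, ∃ o, ι o = 2 * s)
    (hN : ∀ α, Ideal.absNorm (Ideal.span {ι α}) = α.norm.natAbs) {I : Ideal S}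
    (hI : I.ContainsOdd) {π : ℤ√(-(q : ℤ))} (hπ : 1 < π.norm) (hπodd : Odd π.norm)
    (hle : I ≤ Ideal.span {ι π}) :
    ∃ J : Ideal S, J.ContainsOdd ∧ Ideal.comapClass ι J = Ideal.comapClass ι I ∧
      Ideal.absNorm J < Ideal.absNorm I := by
  obtain ⟨J, rfl⟩ := Ideal.dvd_iff_le.mpr hle
  have hodd := hI.odd_absNorm
  rw [map_mul, Nat.odd_mul] at hodd
  have hJ := Ideal.containsOdd_of_odd_absNorm hodd.2
  refine ⟨J, hJ, ?_, ?_⟩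
  · rw [(Ideal.containsOdd_of_odd_absNorm hodd.1).comapClass_mul hι h2 hJ,
      Ideal.comapClass_span_eq_zero hι h2 (containsOdd_span_of_odd_norm hπodd), zero_add]
  · rw [map_mul, hN]
    have h1 : 0 < Ideal.absNorm J := hodd.2.pos
    have h2 : 1 < π.norm.natAbs := by omega
    nlinarith

end

/-- An odd ideal of minimal norm in a class of order dividing two is principal. -/
theorem exists_eq_span_of_sq_eq_span (hq : q.Prime) (hq4 : q % 4 = 3)
    (hι : Function.Injective ι) (h2 : ∀ s : S, ∃ o, ι o = 2 * s)
    (hN : ∀ α, Ideal.absNorm (Ideal.span {ι α}) = α.norm.natAbs) {I : Ideal S}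
    (hI : Odd (Ideal.absNorm I)) {α : ℤ√(-(q : ℤ))} (hα : I ^ 2 = Ideal.span {ι α})
    (hmin : ∀ π : ℤ√(-(q : ℤ)), 1 < π.norm → Odd π.norm → ¬ I ≤ Ideal.span {ι π}) :
    ∃ β : ℤ√(-(q : ℤ)), I = Ideal.span {ι β} := by
  have hq' : Prime (q : ℤ) := Nat.prime_iff_prime_int.mp hq
  have hq0 : (0 : ℤ) < q := by exact_mod_cast hq.pos
  obtain ⟨N, hNdef⟩ : ∃ N : ℤ, N = Ideal.absNorm I := ⟨_, rfl⟩
  have hNpos : 0 < N := by rw [hNdef]; exact_mod_cast hI.pos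
  have hNodd : Odd N := by rw [hNdef]; exact_mod_cast hI
  have hnorm : N ^ 2 = α.re ^ 2 + q * α.im ^ 2 := by
    have h := hN α
    rw [← hα, map_pow] at h
    rw [← norm_neg_natCast, ← abs_of_nonneg (norm_nonneg (by omega) α), Int.abs_eq_natAbs, ← h]
    rw [hNdef, Nat.cast_pow]
  obtain ⟨u, hu⟩ : ∃ u, α.re = u := ⟨_, rfl⟩
  obtain ⟨v, hv⟩ : ∃ v, α.im = v := ⟨_, rfl⟩
  rw [hu, hv] at hnorm
  have hparity : Odd u ∧ Even v := by
    obtain ⟨n, hn⟩ := hNodd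
    obtain ⟨k, hk⟩ : ∃ k : ℤ, (q : ℤ) = 4 * k + 3 := ⟨q / 4, by omega⟩
    rw [hn, hk] at hnorm
    rcases Int.even_or_odd' u with ⟨a, rfl | rfl⟩ <;> rcases Int.even_or_odd' v with ⟨b, rfl | rfl⟩
    · ring_nf at hnorm; omega
    · ring_nf at hnorm; omega
    · exact ⟨⟨a, rfl⟩, ⟨b, by ring⟩⟩
    · ring_nf at hnorm; omega
  obtain ⟨hu2, w, hw⟩ := hparity
  obtain ⟨A, hA⟩ : ∃ A, N + u = 2 * A := (hNodd.add_odd hu2).two_dvd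
  obtain ⟨B, hB⟩ : ∃ B, N - u = 2 * B := (hNodd.sub_odd hu2).two_dvd
  have hAB : A * B = q * w ^ 2 := by
    have : 4 * (A * B) = 4 * (q * w ^ 2) := by
      calc 4 * (A * B) = (N + u) * (N - u) := by rw [hA, hB]; ring
        _ = N ^ 2 - u ^ 2 := by ring
        _ = _ := by rw [hnorm, hw]; ring
    omega
  have huN : |u| ≤ N := by
    refine abs_le_of_sq_le_sq ?_ hNpos.le
    nlinarith [mul_nonneg hq0.le (sq_nonneg v)]
  obtain ⟨h3, h4⟩ := abs_le.mp huN
  have hcop : IsCoprime A B := by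
    rw [Int.isCoprime_iff_gcd_eq_one]
    by_contra hg
    obtain ⟨p, hp, hpA, hpB⟩ := Nat.Prime.not_coprime_iff_dvd.mp hg
    rw [← Int.natCast_dvd] at hpA hpB
    have hpZ := Nat.prime_iff_prime_int.mp hp
    have hpN : (p : ℤ) ∣ N := by
      have h5 : N = A + B := by omega
      rw [h5]
      exact dvd_add hpA hpB
    have hpu : (p : ℤ) ∣ u := by
      have h5 : u = A - B := by omega
      rw [h5]
      exact dvd_sub hpA hpB
    have hp2 : ¬ (p : ℤ) ∣ 2 := fun h ↦ by
      have : Odd p := by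
        have := hNodd
        obtain ⟨k, hk⟩ := hpN
        rw [hk, Int.odd_mul] at this
        exact_mod_cast this.1
      have h5 : p ∣ 2 := by exact_mod_cast h
      obtain rfl := (Nat.prime_dvd_prime_iff_eq hp Nat.prime_two).mp h5
      exact absurd this (by decide)
    have hpw : (p : ℤ) ∣ w := by
      have h5 : (p : ℤ) * p ∣ q * w ^ 2 := hAB ▸ mul_dvd_mul hpA hpB
      by_cases hpq : (p : ℤ) ∣ q
      · have : (p : ℤ) = q := by
          have : p ∣ q := by exact_mod_cast hpq
          exact_mod_cast (Nat.prime_dvd_prime_iff_eq hp hq).mp this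
        rw [this] at h5 ⊢
        exact hq'.dvd_of_dvd_pow ((mul_dvd_mul_iff_left hq'.ne_zero).mp h5)
      · exact hpZ.dvd_of_dvd_pow
          ((hpZ.dvd_or_dvd ((dvd_mul_right _ _).trans h5)).resolve_left hpq)
    have hpα : ((p : ℤ) : ℤ√(-(q : ℤ))) ∣ α := by
      rw [intCast_dvd, hu, hv, hw]
      exact ⟨hpu, dvd_add hpw hpw⟩
    obtain ⟨π, h5, h6, h7⟩ := exists_le_span_of_dvd hq hι h2 hα hpZ hp2 hpα
    exact hmin π h5 h6 h7
  have hroot : ∃ β : ℤ√(-(q : ℤ)), α = β ^ 2 ∨ α = -β ^ 2 := by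
    obtain ⟨s, t, hst, h5⟩ := Int.exists_sq_add_mul_sq_of_mul_eq hq' (by omega) (by omega) hq0
      hcop hAB
    have hst' : w = s * t ∨ w = -(s * t) := sq_eq_sq_iff_eq_or_eq_neg.mp (by rw [← hst]; ring)
    have hu' : u = A - B := by omega
    have hre : ∀ a b : ℤ, ((⟨a, b⟩ : ℤ√(-(q : ℤ))) ^ 2).re = a ^ 2 - q * b ^ 2 := fun a b ↦ by
      rw [pow_two, re_mul]; ring
    have him : ∀ a b : ℤ, ((⟨a, b⟩ : ℤ√(-(q : ℤ))) ^ 2).im = 2 * (a * b) := fun a b ↦ by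
      rw [pow_two, im_mul]; ring
    rcases h5 with ⟨rfl, rfl⟩ | ⟨rfl, rfl⟩
    · rcases hst' with rfl | rfl
      · refine ⟨⟨s, t⟩, Or.inl (Zsqrtd.ext ?_ ?_)⟩
        · rw [hre, hu, hu']
        · rw [him, hv, hw]; ring
      · refine ⟨⟨s, -t⟩, Or.inl (Zsqrtd.ext ?_ ?_)⟩
        · rw [hre, hu, hu']; ring
        · rw [him, hv, hw]; ring
    · rcases hst' with rfl | rfl
      · refine ⟨⟨s, -t⟩, Or.inr (Zsqrtd.ext ?_ ?_)⟩
        · rw [re_neg, hre, hu, hu']; ring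
        · rw [im_neg, him, hv, hw]; ring
      · refine ⟨⟨s, t⟩, Or.inr (Zsqrtd.ext ?_ ?_)⟩
        · rw [re_neg, hre, hu, hu']; ring
        · rw [im_neg, him, hv, hw]; ring
  obtain ⟨β, hβ⟩ := hroot
  refine ⟨β, pow_left_injective two_ne_zero ?_⟩
  change I ^ 2 = Ideal.span {ι β} ^ 2
  rw [hα, Ideal.span_singleton_pow, ← map_pow]
  rcases hβ with h | h
  · rw [h]
  · rw [h, map_neg, Ideal.span_singleton_neg]

variable [Module.Finite ℤ S] [IsDomain (ℤ√(-(q : ℤ)))]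

theorem eq_zero_of_add_self_eq_zero (hq : q.Prime) (hq4 : q % 4 = 3)
    (hι : Function.Injective ι) (h2 : ∀ s : S, ∃ o, ι o = 2 * s)
    (hN : ∀ α, Ideal.absNorm (Ideal.span {ι α}) = α.norm.natAbs)
    (hsurj : ∀ c, ∃ I : Ideal S, I.ContainsOdd ∧ Ideal.comapClass ι I = c)
    {c : Additive (ClassGroup (ℤ√(-(q : ℤ))))} (hc : c + c = 0) : c = 0 := by
  classical
  have hex : ∃ n, ∃ I : Ideal S, I.ContainsOdd ∧ Ideal.comapClass ι I = c ∧
      Ideal.absNorm I = n := by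
    obtain ⟨I, hI, hIc⟩ := hsurj c
    exact ⟨_, I, hI, hIc, rfl⟩
  obtain ⟨I, hI, hIc, hIn⟩ := Nat.find_spec hex
  have hsq : ∃ α : ℤ√(-(q : ℤ)), I ^ 2 = Ideal.span {ι α} := by
    rw [pow_two]
    refine (hI.mul hI).exists_eq_span_of_comapClass_eq_zero hι h2 ?_
    rw [hI.comapClass_mul hι h2 hI, hIc, hc]
  obtain ⟨α, hα⟩ := hsq
  obtain ⟨β, rfl⟩ := exists_eq_span_of_sq_eq_span hq hq4 hι h2 hN hI.odd_absNorm hα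
    fun π h1 h3 h4 ↦ by
      obtain ⟨J, hJ, hJc, hlt⟩ := exists_absNorm_lt_of_le_span hι h2 hN hI h1 h3 h4
      exact Nat.find_min hex (hIn ▸ hlt) ⟨J, hJ, hJc.trans hIc, rfl⟩
  rw [← hIc]
  refine Ideal.comapClass_span_eq_zero hι h2 (containsOdd_span_of_odd_norm ?_)
  rw [← Int.natAbs_odd, ← hN]
  exact hI.odd_absNorm

end Zsqrtd

namespace LatticeCount

/-- The Euclidean norm of `x + y √-q`. -/
noncomputable def qnorm (q : ℕ) (p : ℝ × ℝ) : ℝ :=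
  ‖(p.1 + p.2 * √q * Complex.I : ℂ)‖

variable {q : ℕ}

theorem qnorm_nonneg (p : ℝ × ℝ) : 0 ≤ qnorm q p := norm_nonneg _

theorem qnorm_sq (p : ℝ × ℝ) : qnorm q p ^ 2 = p.1 ^ 2 + q * p.2 ^ 2 := by
  rw [qnorm, Complex.sq_norm, ← Complex.ofReal_mul, Complex.normSq_add_mul_I, mul_pow,
    Real.sq_sqrt (Nat.cast_nonneg q), mul_comm (q : ℝ)]

theorem qnorm_le_iff {p : ℝ × ℝ} {r : ℝ} (hr : 0 ≤ r) :
    qnorm q p ≤ r ↔ p.1 ^ 2 + q * p.2 ^ 2 ≤ r ^ 2 := by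
  rw [← qnorm_sq, sq_le_sq₀ (qnorm_nonneg p) hr]

theorem qnorm_add_le (p p' : ℝ × ℝ) : qnorm q (p + p') ≤ qnorm q p + qnorm q p' := by
  refine le_trans (le_of_eq ?_) (norm_add_le _ _)
  rw [qnorm, Prod.fst_add, Prod.snd_add]
  push_cast
  congr 1
  ring

theorem qnorm_smul (t : ℝ) (p : ℝ × ℝ) : qnorm q (t • p) = |t| * qnorm q p := by
  rw [qnorm, qnorm, ← Real.norm_eq_abs, ← Complex.norm_real, ← norm_mul, Prod.smul_fst,
    Prod.smul_snd]
  simp only [smul_eq_mul]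
  push_cast
  congr 1
  ring

theorem qnorm_sub_comm (p p' : ℝ × ℝ) : qnorm q (p - p') = qnorm q (p' - p) := by
  rw [← neg_sub, ← neg_one_smul ℝ, qnorm_smul, abs_neg, abs_one, one_mul]

theorem qnorm_le_one_add_sqrt {p : ℝ × ℝ} (h1 : |p.1| ≤ 1) (h2 : |p.2| ≤ 1) :
    qnorm q p ≤ 1 + √q := by
  rw [qnorm]
  refine (norm_add_le _ _).trans ?_
  rw [norm_mul, norm_mul, Complex.norm_I, mul_one, Complex.norm_real, Complex.norm_real,
    Complex.norm_real, Real.norm_eq_abs, Real.norm_eq_abs, Real.norm_of_nonneg (Real.sqrt_nonneg _)]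
  have := mul_le_mul_of_nonneg_right h2 (Real.sqrt_nonneg q)
  linarith

theorem abs_fst_le_qnorm (p : ℝ × ℝ) : |p.1| ≤ qnorm q p := by
  refine abs_le_of_sq_le_sq ?_ (qnorm_nonneg p)
  rw [qnorm_sq]
  nlinarith [mul_nonneg (Nat.cast_nonneg (α := ℝ) q) (sq_nonneg p.2)]

theorem abs_snd_le_qnorm (hq : 0 < q) (p : ℝ × ℝ) : |p.2| ≤ qnorm q p := by
  refine abs_le_of_sq_le_sq ?_ (qnorm_nonneg p)
  rw [qnorm_sq]
  have : (1 : ℝ) ≤ q := by exact_mod_cast hq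
  nlinarith [sq_nonneg p.1, sq_nonneg p.2]

theorem continuous_qnorm : Continuous (qnorm q) := by
  unfold qnorm
  fun_prop

/-- The region bounded by the ellipse `x² + q y² = r²`. -/
def ellipse (q : ℕ) (r : ℝ) : Set (ℝ × ℝ) := {p | qnorm q p ≤ r}

open MeasureTheory

open Pointwise in
theorem volume_ellipse {r : ℝ} (hr : 0 < r) :
    volume (ellipse q r) = ENNReal.ofReal (r ^ 2) * volume (ellipse q 1) := by
  have h : ellipse q r = r • ellipse q 1 := by
    ext p
    rw [Set.mem_smul_set_iff_inv_smul_mem₀ hr.ne']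
    change qnorm q p ≤ r ↔ qnorm q (r⁻¹ • p) ≤ 1
    rw [qnorm_smul, abs_of_pos (inv_pos.mpr hr), inv_mul_le_iff₀ hr, mul_one]
  rw [h, Measure.addHaar_smul, Module.finrank_prod, Module.finrank_self, one_add_one_eq_two,
    abs_of_nonneg (sq_nonneg r)]

theorem volume_ellipse_lt_top (hq : 0 < q) : volume (ellipse q 1) < ⊤ := by
  refine Bornology.IsBounded.measure_lt_top ?_
  rw [isBounded_iff_forall_norm_le]
  exact ⟨1, fun p (hp : qnorm q p ≤ 1) ↦
    max_le ((abs_fst_le_qnorm p).trans hp) ((abs_snd_le_qnorm hq p).trans hp)⟩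

theorem volume_ellipse_pos : 0 < volume (ellipse q 1) := by
  have hopen : IsOpen {p : ℝ × ℝ | qnorm q p < 1} :=
    isOpen_lt continuous_qnorm continuous_const
  refine (hopen.measure_pos volume ⟨0, ?_⟩).trans_le (measure_mono fun p hp ↦ ?_)
  · simp [qnorm]
  · exact le_of_lt (Set.mem_ofPred_eq ▸ hp)

/-- The unit square with lower left corner `v`. -/
def tile (v : ℤ × ℤ) : Set (ℝ × ℝ) := {p | ⌊p.1⌋ = v.1 ∧ ⌊p.2⌋ = v.2}

/-- The point of the plane underlying an integral point. -/
def toPlane (v : ℤ × ℤ) : ℝ × ℝ := (v.1, v.2)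

theorem toPlane_add (v w : ℤ × ℤ) : toPlane (v + w) = toPlane v + toPlane w := by
  simp [toPlane]

theorem tile_eq (v : ℤ × ℤ) :
    tile v = Set.Ico (v.1 : ℝ) (v.1 + 1) ×ˢ Set.Ico (v.2 : ℝ) (v.2 + 1) := by
  ext p
  rw [Set.mem_prod, Set.mem_Ico, Set.mem_Ico, ← Int.floor_eq_iff, ← Int.floor_eq_iff]
  rfl

theorem volume_biUnion_tile (s : Finset (ℤ × ℤ)) :
    volume (⋃ v ∈ s, tile v) = s.card := by
  rw [measure_biUnion_finset]
  · have : ∀ v ∈ s, volume (tile v) = 1 := fun v _ ↦ by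
      rw [tile_eq, Measure.volume_eq_prod, Measure.prod_prod, Real.volume_Ico, Real.volume_Ico]
      simp
    rw [Finset.sum_congr rfl this, Finset.sum_const, nsmul_one]
  · rintro v - w - hvw
    refine Set.disjoint_left.mpr fun p hp hp' ↦ hvw (Prod.ext ?_ ?_)
    · exact hp.1.symm.trans hp'.1
    · exact hp.2.symm.trans hp'.2
  · intro v _
    rw [tile_eq]
    exact measurableSet_Ico.prod measurableSet_Ico

theorem qnorm_sub_toPlane_le {p : ℝ × ℝ} {v : ℤ × ℤ} (h : p ∈ tile v) :
    qnorm q (p - toPlane v) ≤ 1 + √q := by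
  obtain ⟨h1, h2⟩ := h
  refine qnorm_le_one_add_sqrt ?_ ?_
  · change |p.1 - v.1| ≤ 1
    rw [← h1, Int.self_sub_floor, abs_of_nonneg (Int.fract_nonneg _)]
    exact (Int.fract_lt_one _).le
  · change |p.2 - v.2| ≤ 1
    rw [← h2, Int.self_sub_floor, abs_of_nonneg (Int.fract_nonneg _)]
    exact (Int.fract_lt_one _).le

theorem finite_setOf_qnorm_le (hq : 0 < q) (r : ℝ) :
    {v : ℤ × ℤ | qnorm q (toPlane v) ≤ r}.Finite := by
  refine ((Set.finite_Icc (-⌈r⌉) ⌈r⌉).prod (Set.finite_Icc (-⌈r⌉) ⌈r⌉)).subset ?_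
  intro v (hv : qnorm q (toPlane v) ≤ r)
  have h1 := (abs_fst_le_qnorm (toPlane v)).trans hv
  have h2 := (abs_snd_le_qnorm hq (toPlane v)).trans hv
  have h3 := Int.le_ceil r
  change |(v.1 : ℝ)| ≤ r at h1
  change |(v.2 : ℝ)| ≤ r at h2
  rw [abs_le] at h1 h2
  refine ⟨⟨?_, ?_⟩, ⟨?_, ?_⟩⟩ <;> rify <;> linarith

/-- The area of the ellipse `x² + q y² = 1`. -/
noncomputable def area (q : ℕ) : ℝ := (volume (ellipse q 1)).toReal

theorem area_pos (hq : 0 < q) : 0 < area q :=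
  ENNReal.toReal_pos volume_ellipse_pos.ne' (volume_ellipse_lt_top hq).ne

theorem toReal_volume_ellipse {r : ℝ} (hr : 0 < r) :
    (volume (ellipse q r)).toReal = area q * r ^ 2 := by
  rw [volume_ellipse hr, ENNReal.toReal_mul, ENNReal.toReal_ofReal (sq_nonneg r), mul_comm, area]

theorem volume_ellipse_ne_top (hq : 0 < q) {r : ℝ} (hr : 0 < r) : volume (ellipse q r) ≠ ⊤ := by
  rw [volume_ellipse hr]
  exact ENNReal.mul_ne_top ENNReal.ofReal_ne_top (volume_ellipse_lt_top hq).ne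

theorem card_le_area (hq : 0 < q) {r : ℝ} (hr : 0 ≤ r) :
    ((finite_setOf_qnorm_le hq r).toFinset.card : ℝ) ≤ area q * (r + (1 + √q)) ^ 2 := by
  have hr' : 0 < r + (1 + √q) := by positivity
  rw [← toReal_volume_ellipse hr', ← ENNReal.toReal_natCast, ← volume_biUnion_tile]
  refine ENNReal.toReal_mono (volume_ellipse_ne_top hq hr') (measure_mono ?_)
  intro p hp
  simp only [Set.mem_iUnion, Set.Finite.mem_toFinset, Set.mem_ofPred_eq] at hp
  obtain ⟨v, hv, hp⟩ := hp
  have h := qnorm_add_le (q := q) (toPlane v) (p - toPlane v)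
  rw [add_sub_cancel] at h
  exact h.trans (add_le_add hv (qnorm_sub_toPlane_le hp))

theorem area_le_card (hq : 0 < q) {r : ℝ} (hr : 1 + √q < r) :
    area q * (r - (1 + √q)) ^ 2 ≤ (finite_setOf_qnorm_le hq r).toFinset.card := by
  have hr' : 0 < r - (1 + √q) := sub_pos.mpr hr
  rw [← toReal_volume_ellipse hr', ← ENNReal.toReal_natCast (Finset.card _),
    ← volume_biUnion_tile]
  refine ENNReal.toReal_mono ?_ (measure_mono fun p hp ↦ ?_)
  · rw [volume_biUnion_tile]
    exact ENNReal.natCast_ne_top _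
  · simp only [Set.mem_iUnion, Set.Finite.mem_toFinset, Set.mem_ofPred_eq]
    have hpv : p ∈ tile (⌊p.1⌋, ⌊p.2⌋) := ⟨rfl, rfl⟩
    refine ⟨(⌊p.1⌋, ⌊p.2⌋), ?_, hpv⟩
    have h := qnorm_add_le (q := q) p (toPlane (⌊p.1⌋, ⌊p.2⌋) - p)
    rw [add_sub_cancel, qnorm_sub_comm] at h
    have h2 := qnorm_sub_toPlane_le (q := q) hpv
    change qnorm q p ≤ _ at hp
    linarith

end LatticeCount

namespace LatticeCount

variable {q : ℕ} {H : Type*} [AddCommGroup H]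

open Classical in
/-- The number of integral points of a given class inside an ellipse. -/
noncomputable def classCount (hq : 0 < q) (ψ : ℤ × ℤ →+ H) (h : H) (r : ℝ) : ℕ :=
  ((finite_setOf_qnorm_le hq r).toFinset.filter fun v ↦ ψ v = h).card

theorem sum_classCount [Fintype H] (hq : 0 < q) (ψ : ℤ × ℤ →+ H) (r : ℝ) :
    ∑ h, classCount hq ψ h r = (finite_setOf_qnorm_le hq r).toFinset.card := by
  classical
  rw [Finset.card_eq_sum_card_fiberwise (f := ψ) (t := Finset.univ) fun _ _ ↦ by simp]
  rfl

theorem classCount_le_classCount_add (hq : 0 < q) (ψ : ℤ × ℤ →+ H) {h h' : H} {w : ℤ × ℤ}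
    {R : ℝ} (hw : ψ w = h' - h) (hR : qnorm q (toPlane w) ≤ R) (r : ℝ) :
    classCount hq ψ h r ≤ classCount hq ψ h' (r + R) := by
  refine Finset.card_le_card_of_injOn (· + w) (fun v hv ↦ ?_) fun _ _ _ _ ↦ add_right_cancel
  simp only [Finset.coe_filter, Set.Finite.mem_toFinset, Set.mem_ofPred_eq] at hv ⊢
  refine ⟨?_, ?_⟩
  · rw [toPlane_add]
    exact (qnorm_add_le _ _).trans (add_le_add hv.1 hR)
  · rw [map_add, hv.2, hw, add_sub_cancel]

theorem exists_abs_classCount_sub_le [Finite H] (hq : 0 < q) {ψ : ℤ × ℤ →+ H}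
    (hψ : Function.Surjective ψ) (h : H) :
    ∃ C, ∀ r, 0 ≤ r → |(classCount hq ψ h r : ℝ) - area q / Nat.card H * r ^ 2| ≤ C * (r + 1) := by
  cases nonempty_fintype H
  choose σ hσ using hψ
  set R : ℝ := ∑ h, qnorm q (toPlane (σ h))
  have hR (h) : qnorm q (toPlane (σ h)) ≤ R :=
    Finset.single_le_sum (fun h _ ↦ qnorm_nonneg (toPlane (σ h))) (Finset.mem_univ h)
  have hR0 : 0 ≤ R := (qnorm_nonneg _).trans (hR 0)
  have key (h h' : H) (r : ℝ) : classCount hq ψ h r ≤ classCount hq ψ h' (r + R) :=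
    classCount_le_classCount_add hq ψ (hσ (h' - h)) (hR _) r
  set t : ℝ := R + (1 + √q) with ht
  have ht0 : 0 ≤ t := by positivity
  have hV := area_pos hq
  have hH : (0 : ℝ) < Nat.card H := by exact_mod_cast Nat.card_pos
  have upper (r : ℝ) (hr : 0 ≤ r) :
      Nat.card H * (classCount hq ψ h r : ℝ) ≤ area q * (r + t) ^ 2 := by
    have h1 : Nat.card H * classCount hq ψ h r ≤
        (finite_setOf_qnorm_le hq (r + R)).toFinset.card := by
      rw [← sum_classCount hq ψ, Nat.card_eq_fintype_card, ← smul_eq_mul]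
      exact Finset.card_nsmul_le_sum _ _ _ fun h' _ ↦ key h h' r
    have h2 := card_le_area hq (add_nonneg hr hR0)
    rw [add_assoc] at h2
    exact le_trans (by exact_mod_cast h1) h2
  have lower (r : ℝ) (hr : t < r) :
      area q * (r - t) ^ 2 ≤ Nat.card H * (classCount hq ψ h r : ℝ) := by
    have h1 : (finite_setOf_qnorm_le hq (r - R)).toFinset.card ≤
        Nat.card H * classCount hq ψ h r := by
      rw [← sum_classCount hq ψ, Nat.card_eq_fintype_card, ← smul_eq_mul]
      refine Finset.sum_le_card_nsmul _ _ _ fun h' _ ↦ ?_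
      have := key h' h (r - R)
      rwa [sub_add_cancel] at this
    have h2 := area_le_card hq (r := r - R) (by linarith)
    rw [sub_sub] at h2
    exact h2.trans (by exact_mod_cast h1)
  refine ⟨area q * (2 * t + t ^ 2) / Nat.card H, fun r hr ↦ ?_⟩
  have hrew : (classCount hq ψ h r : ℝ) - area q / Nat.card H * r ^ 2 =
      (Nat.card H * (classCount hq ψ h r : ℝ) - area q * r ^ 2) / Nat.card H := by
    field_simp
  rw [hrew, abs_div, abs_of_pos hH, div_mul_eq_mul_div]
  refine div_le_div_of_nonneg_right ?_ hH.le
  have hu := upper r hr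
  have hnn : (0 : ℝ) ≤ Nat.card H * (classCount hq ψ h r : ℝ) := by positivity
  have e1 : (r + t) ^ 2 - r ^ 2 ≤ (2 * t + t ^ 2) * (r + 1) := by nlinarith [mul_nonneg ht0 hr]
  have e2 := mul_le_mul_of_nonneg_left e1 hV.le
  rw [abs_le]
  refine ⟨?_, by linarith⟩
  rcases lt_or_ge t r with hrt | hrt
  · have hl := lower r hrt
    have e3 : r ^ 2 - (r - t) ^ 2 ≤ (2 * t + t ^ 2) * (r + 1) := by
      nlinarith [mul_nonneg ht0 hr, mul_nonneg (sq_nonneg t) hr]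
    have e4 := mul_le_mul_of_nonneg_left e3 hV.le
    linarith
  · have e3 : r ^ 2 ≤ (2 * t + t ^ 2) * (r + 1) := by
      nlinarith [mul_nonneg ht0 hr, mul_nonneg (sq_nonneg t) hr]
    have e4 := mul_le_mul_of_nonneg_left e3 hV.le
    linarith

end LatticeCount

namespace Zsqrtd

variable {q : ℕ}

theorem eq_or_eq_neg_of_span_eq (hq : 1 < q) [IsDomain (ℤ√(-(q : ℤ)))] {α β : ℤ√(-(q : ℤ))}
    (h : Ideal.span {α} = Ideal.span {β}) : α = β ∨ α = -β := by
  obtain ⟨u, rfl⟩ := (Ideal.span_singleton_eq_span_singleton.mp h).symm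
  have h1 : (u : ℤ√(-(q : ℤ))).norm = 1 :=
    (norm_eq_one_iff' (by simp) _).mpr u.isUnit
  rw [norm_neg_natCast] at h1
  have h2 : (u : ℤ√(-(q : ℤ))).im = 0 := by
    by_contra h0
    have : 0 < (u : ℤ√(-(q : ℤ))).im ^ 2 := by positivity
    nlinarith [sq_nonneg (u : ℤ√(-(q : ℤ))).re]
  rw [h2] at h1
  have h3 : (u : ℤ√(-(q : ℤ))).re = 1 ∨ (u : ℤ√(-(q : ℤ))).re = -1 := by
    rw [← sq_eq_one_iff]
    linarith
  rcases h3 with h3 | h3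
  · left
    rw [show (u : ℤ√(-(q : ℤ))) = 1 from Zsqrtd.ext h3 h2, mul_one]
  · right
    rw [show (u : ℤ√(-(q : ℤ))) = -1 from Zsqrtd.ext h3 h2, mul_neg_one]

/-- The element with given coordinates, as an additive map. -/
def ofProd (d : ℤ) : ℤ × ℤ →+ ℤ√d where
  toFun v := ⟨v.1, v.2⟩
  map_zero' := rfl
  map_add' _ _ := rfl

theorem ofProd_injective (d : ℤ) : Function.Injective (ofProd d) := fun _ _ h ↦
  Prod.ext (congrArg re h) (congrArg im h)

/-- The sum of the coordinates modulo two. -/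
def parity (d : ℤ) : ℤ√d →+ ZMod 2 where
  toFun α := α.re + α.im
  map_zero' := by simp
  map_add' _ _ := by simp; ring

theorem parity_eq_one_iff (hq : Odd q) (α : ℤ√(-(q : ℤ))) : parity _ α = 1 ↔ Odd α.norm := by
  change (α.re + α.im : ZMod 2) = 1 ↔ _
  rw [← Int.cast_add, ZMod.intCast_eq_one_iff_odd, norm_neg_natCast]
  have := Int.odd_coe_nat q |>.mpr hq
  simp only [Int.odd_add, ← Int.not_odd_iff_even, Int.odd_mul, Int.odd_pow' two_ne_zero]
  tauto

theorem qnorm_toPlane_le_iff (v : ℤ × ℤ) (m : ℕ) :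
    LatticeCount.qnorm q (LatticeCount.toPlane v) ≤ √m ↔ (ofProd (-(q : ℤ)) v).norm ≤ m := by
  rw [LatticeCount.qnorm_le_iff (Real.sqrt_nonneg _), Real.sq_sqrt (Nat.cast_nonneg m),
    norm_neg_natCast]
  change (v.1 : ℝ) ^ 2 + q * (v.2 : ℝ) ^ 2 ≤ m ↔ v.1 ^ 2 + q * v.2 ^ 2 ≤ m
  norm_cast

variable {S : Type*} [CommRing S] {ι : ℤ√(-(q : ℤ)) →+* S}

/-- Residue modulo an ideal together with the parity. -/
def residueParity (ι : ℤ√(-(q : ℤ)) →+* S) (J : Ideal S) : ℤ × ℤ →+ (S ⧸ J) × ZMod 2 :=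
  (((Ideal.Quotient.mk J).comp ι).toAddMonoidHom.prod (parity _)).comp (ofProd _)

theorem residueParity_eq_iff (hq : Odd q) (J : Ideal S) (v : ℤ × ℤ) :
    residueParity ι J v = (0, 1) ↔ ι (ofProd _ v) ∈ J ∧ Odd (ofProd (-(q : ℤ)) v).norm := by
  rw [← parity_eq_one_iff hq, ← Ideal.Quotient.eq_zero_iff_mem]
  exact Prod.mk_inj

theorem residueParity_surjective (h2 : ∀ s : S, ∃ o, ι o = 2 * s) {J : Ideal S}
    (hJ : J.ContainsOdd) : Function.Surjective (residueParity ι J) := by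
  obtain ⟨m, ⟨k, rfl⟩, hm⟩ := hJ
  rintro ⟨s, b⟩
  obtain ⟨s, rfl⟩ := Ideal.Quotient.mk_surjective s
  obtain ⟨o, ho⟩ := h2 ((k + 1) * s)
  obtain ⟨e, he⟩ := ZMod.intCast_surjective (b - parity _ o)
  refine ⟨(o.re + (2 * k + 1) * e, o.im), Prod.ext ?_ ?_⟩
  · change Ideal.Quotient.mk J (ι ⟨o.re + (2 * k + 1) * e, o.im⟩) = Ideal.Quotient.mk J s
    have : (⟨o.re + (2 * k + 1) * e, o.im⟩ : ℤ√(-(q : ℤ))) = o + ((2 * k + 1 : ℤ) * (e : ℤ)) := by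
      rw [← Int.cast_mul]
      exact Zsqrtd.ext (by simp) (by simp)
    rw [Ideal.Quotient.eq, this, map_add, map_mul, map_intCast, map_intCast, ho]
    have : 2 * ((k + 1) * s) + ((2 * k + 1 : ℤ) : S) * (e : S) - s =
        (s + e) * ((2 * k + 1 : ℤ) : S) := by
      push_cast
      ring
    rw [this]
    exact J.mul_mem_left _ hm
  · change ((o.re + (2 * k + 1) * e : ℤ) + (o.im : ℤ) : ZMod 2) = b
    have h20 : (2 : ZMod 2) = 0 := rfl
    have : parity (-(q : ℤ)) o = o.re + o.im := rfl
    rw [this] at he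
    push_cast
    rw [he, h20]
    ring

end Zsqrtd

namespace Zsqrtd

open Ideal

variable {q : ℕ} [IsDomain (ℤ√(-(q : ℤ)))] {S : Type*} [CommRing S] [IsDedekindDomain S]
  [Module.Free ℤ S] [Module.Finite ℤ S] [CharZero S] {ι : ℤ√(-(q : ℤ)) →+* S}

open Classical in
/-- The ideals of odd norm at most `n` in a given class. -/
noncomputable def oddIdeals (ι : ℤ√(-(q : ℤ)) →+* S) (c : Additive (ClassGroup (ℤ√(-(q : ℤ)))))
    (n : ℕ) : Finset (Ideal S) :=
  (Finset.Icc 1 n).biUnion fun k ↦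
    (ofAbsNorm S k).filter fun I ↦ Odd (absNorm I) ∧ comapClass ι I = c

theorem mem_oddIdeals {c : Additive (ClassGroup (ℤ√(-(q : ℤ))))} {n : ℕ} {I : Ideal S} :
    I ∈ oddIdeals ι c n ↔ absNorm I ≤ n ∧ Odd (absNorm I) ∧ comapClass ι I = c := by
  simp only [oddIdeals, Finset.mem_biUnion, Finset.mem_filter, mem_ofAbsNorm, Finset.mem_Icc]
  constructor
  · rintro ⟨k, ⟨-, hk⟩, rfl, h⟩
    exact ⟨hk, h⟩
  · rintro ⟨h1, h2, h3⟩
    exact ⟨_, ⟨h2.pos, h1⟩, rfl, h2, h3⟩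

theorem card_oddIdeals (c : Additive (ClassGroup (ℤ√(-(q : ℤ))))) (n : ℕ) :
    (oddIdeals ι c n).card =
      ∑ k ∈ Finset.Icc 1 n, fiberCard (fun I : Ideal S ↦ Odd (absNorm I)) (comapClass ι) c k := by
  rw [oddIdeals, Finset.card_biUnion]
  · refine Finset.sum_congr rfl fun k _ ↦ ?_
    rw [fiberCard]
    congr
  refine fun k _ l _ hkl ↦ Finset.disjoint_left.mpr fun I hI hI' ↦ hkl ?_
  simp only [Finset.mem_filter, mem_ofAbsNorm] at hI hI'
  exact hI.1.symm.trans hI'.1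

omit [IsDedekindDomain S] [Module.Free ℤ S] [Module.Finite ℤ S] [CharZero S] in
theorem eq_or_eq_neg_of_span_map_eq (hq : 1 < q) (hι : Function.Injective ι)
    (h2 : ∀ s : S, ∃ o, ι o = 2 * s) {α β : ℤ√(-(q : ℤ))} (hα : Odd α.norm) (hβ : Odd β.norm)
    (h : span {ι α} = span {ι β}) : α = β ∨ α = -β := by
  have h' (x : ℤ√(-(q : ℤ))) : span {ι x} = (span {x}).map ι := by
    rw [map_span, Set.image_singleton]
  refine eq_or_eq_neg_of_span_eq hq ?_
  rw [← (containsOdd_span_of_odd_norm hα).comap_map hι h2, ← h', h, h',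
    (containsOdd_span_of_odd_norm hβ).comap_map hι h2]

omit [Module.Finite ℤ S] [CharZero S] in
open Classical in
theorem card_filter_span_eq (hq : 1 < q) (hι : Function.Injective ι)
    (h2 : ∀ s : S, ∃ o, ι o = 2 * s) (hN : ∀ α, absNorm (span {ι α}) = α.norm.natAbs)
    {s : Finset (ℤ × ℤ)} {α : ℤ√(-(q : ℤ))} (hα : Odd α.norm)
    (hs : ∀ v, span {ι (ofProd _ v)} = span {ι α} → v ∈ s) :
    (s.filter fun v ↦ span {ι (ofProd _ v)} = span {ι α}).card = 2 := by
  have hne : (α.re, α.im) ≠ (-α.re, -α.im) := by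
    intro h
    have : α = 0 := Zsqrtd.ext (self_eq_neg.mp (congrArg Prod.fst h))
      (self_eq_neg.mp (congrArg Prod.snd h))
    simp [this] at hα
  have hneg : span {ι (-α)} = span {ι α} := by rw [map_neg, span_singleton_neg]
  rw [← Finset.card_pair hne]
  congr 1
  ext v
  rw [Finset.mem_filter, Finset.mem_insert, Finset.mem_singleton]
  constructor
  · rintro ⟨-, hv⟩
    have hv' : Odd (ofProd (-(q : ℤ)) v).norm := by
      rw [← Int.natAbs_odd, ← hN, hv, hN, Int.natAbs_odd]
      exact hα
    refine (eq_or_eq_neg_of_span_map_eq hq hι h2 hv' hα hv).imp (fun h ↦ ?_) fun h ↦ ?_ <;>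
      exact ofProd_injective _ h
  · rintro (rfl | rfl)
    · exact ⟨hs _ rfl, rfl⟩
    · exact ⟨hs _ hneg, hneg⟩

theorem classCount_residueParity (hq : 1 < q) (hqo : Odd q) (hι : Function.Injective ι)
    (h2 : ∀ s : S, ∃ o, ι o = 2 * s) (hN : ∀ α, absNorm (span {ι α}) = α.norm.natAbs)
    {J : Ideal S} (hJ : J.ContainsOdd) {c : Additive (ClassGroup (ℤ√(-(q : ℤ))))}
    (hc : comapClass ι J + c = 0) (n : ℕ) :
    LatticeCount.classCount (zero_lt_one.trans hq) (residueParity ι J) (0, 1)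
      √((absNorm J * n : ℕ) : ℝ) = 2 * (oddIdeals ι c n).card := by
  classical
  have hJM := hJ.odd_absNorm
  have hJ0 : J ≠ 0 := by
    rintro rfl
    simp at hJM
  rw [LatticeCount.classCount, mul_comm 2, ← smul_eq_mul,
    ← Finset.card_image_of_injective (oddIdeals ι c n) (mul_right_injective₀ hJ0),
    Finset.card_eq_sum_card_fiberwise (f := fun v ↦ span {ι (ofProd _ v)})
      (t := (oddIdeals ι c n).image (J * ·))]
  · refine Finset.sum_const_nat fun K hK ↦ ?_
    obtain ⟨I, hI, rfl⟩ := Finset.mem_image.mp hK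
    obtain ⟨hIn, hIo, hIc⟩ := mem_oddIdeals.mp hI
    have hIo' := containsOdd_of_odd_absNorm hIo
    obtain ⟨α, hα⟩ := (hJ.mul hIo').exists_eq_span_of_comapClass_eq_zero hι h2
      (by rw [hJ.comapClass_mul hι h2 hIo', hIc, hc])
    have hαN : α.norm.natAbs = absNorm J * absNorm I := by rw [← hN, ← hα, map_mul]
    have hαo : Odd α.norm := by
      rw [← Int.natAbs_odd, hαN]
      exact hJM.mul hIo
    rw [hα]
    refine card_filter_span_eq hq hι h2 hN hαo fun v hv ↦ ?_
    have hvN : (ofProd (-(q : ℤ)) v).norm.natAbs = absNorm J * absNorm I := by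
      rw [← hN, hv, hN, hαN]
    simp only [Finset.mem_filter, Set.Finite.mem_toFinset, Set.mem_ofPred_eq, qnorm_toPlane_le_iff,
      residueParity_eq_iff hqo]
    refine ⟨Int.le_natAbs.trans ?_, ?_, ?_⟩
    · rw [hvN]
      exact_mod_cast Nat.mul_le_mul_left _ hIn
    · refine (mul_le_left : J * I ≤ J) ?_
      rw [hα, ← hv]
      exact mem_span_singleton_self _
    · rw [← Int.natAbs_odd, hvN]
      exact hJM.mul hIo
  · intro v hv
    simp only [Finset.coe_filter, Set.Finite.mem_toFinset, Set.mem_ofPred_eq,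
      qnorm_toPlane_le_iff, residueParity_eq_iff hqo] at hv
    obtain ⟨hvn, hvJ, hvo⟩ := hv
    obtain ⟨I, hI⟩ := dvd_span_singleton.mpr hvJ
    have hvN : (ofProd (-(q : ℤ)) v).norm.natAbs = absNorm J * absNorm I := by
      rw [← hN, hI, map_mul]
    have hIo : Odd (absNorm I) := by
      rw [← Int.natAbs_odd, hvN] at hvo
      exact (Nat.odd_mul.mp hvo).2
    refine Finset.mem_coe.mpr (Finset.mem_image.mpr ⟨I, mem_oddIdeals.mpr ⟨?_, hIo, ?_⟩, hI.symm⟩)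
    · rw [← Int.natAbs_of_nonneg (norm_nonneg (by simp) _), hvN] at hvn
      exact Nat.le_of_mul_le_mul_left (by exact_mod_cast hvn) hJM.pos
    · have := comapClass_span_eq_zero hι h2 (containsOdd_span_of_odd_norm hvo)
      rw [hI, hJ.comapClass_mul hι h2 (containsOdd_of_odd_absNorm hIo), ← hc] at this
      exact add_left_cancel this

theorem exists_abs_sum_fiberCard_sub_le (hq : 1 < q) (hqo : Odd q) (hι : Function.Injective ι)
    (h2 : ∀ s : S, ∃ o, ι o = 2 * s) (hN : ∀ α, absNorm (span {ι α}) = α.norm.natAbs)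
    (hsurj : ∀ c, ∃ I : Ideal S, I.ContainsOdd ∧ comapClass ι I = c)
    (c : Additive (ClassGroup (ℤ√(-(q : ℤ))))) :
    ∃ C : ℝ, ∀ n : ℕ, |∑ k ∈ Finset.Icc 1 n,
      (fiberCard (fun I : Ideal S ↦ Odd (absNorm I)) (comapClass ι) c k : ℝ) -
        LatticeCount.area q / 4 * n| ≤ C * √n := by
  obtain ⟨J, hJ, hJc⟩ := hsurj (-c)
  have hJM := hJ.odd_absNorm
  have hJ0 : J ≠ ⊥ := by
    rintro rfl
    simp at hJM
  have : Finite (S ⧸ J) := finiteQuotientOfFreeOfNeBot J hJ0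
  obtain ⟨C, hC⟩ := LatticeCount.exists_abs_classCount_sub_le (zero_lt_one.trans hq)
    (residueParity_surjective h2 hJ) (0, 1)
  have hC0 : 0 ≤ C := by simpa using (abs_nonneg _).trans (hC 0 le_rfl)
  refine ⟨C * (√(absNorm J) + 1) / 2, fun n ↦ ?_⟩
  rcases n.eq_zero_or_pos with rfl | hn
  · simp
  have hn1 : 1 ≤ √(n : ℝ) := Real.one_le_sqrt.mpr (by exact_mod_cast hn)
  have h := hC _ (Real.sqrt_nonneg ((absNorm J * n : ℕ) : ℝ))
  have hcard : Nat.card ((S ⧸ J) × ZMod 2) = absNorm J * 2 := by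
    rw [Nat.card_prod, Nat.card_zmod]
    rfl
  have hMpos : (0 : ℝ) < absNorm J := by exact_mod_cast hJM.pos
  rw [classCount_residueParity hq hqo hι h2 hN hJ (by rw [hJc, neg_add_cancel]),
    Real.sq_sqrt (Nat.cast_nonneg _), hcard, card_oddIdeals] at h
  push_cast at h
  rw [Real.sqrt_mul hMpos.le] at h
  have e1 : ∀ x : ℝ, x - LatticeCount.area q / 4 * n = (2 * x - LatticeCount.area q /
      (absNorm J * 2) * (absNorm J * n)) / 2 := fun x ↦ by
    field_simp
    ring
  rw [e1, abs_div, abs_of_pos (zero_lt_two' ℝ), div_mul_eq_mul_div (C * _)]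
  refine div_le_div_of_nonneg_right (h.trans ?_) zero_le_two
  rw [mul_assoc]
  exact mul_le_mul_of_nonneg_left (by linarith) hC0

end Zsqrtd

namespace QuadraticAlgebra

variable {q : ℕ} [Fact (∀ r : ℚ, r ^ 2 ≠ (-q : ℚ) + 0 * r)]

instance : FiniteDimensional ℚ (QuadraticAlgebra ℚ (-q : ℚ) 0) :=
  Module.Basis.finiteDimensional_of_finite (basis (-q : ℚ) 0)

instance : CharZero (QuadraticAlgebra ℚ (-q : ℚ) 0) :=
  algebraRat.charZero _

instance : NumberField (QuadraticAlgebra ℚ (-q : ℚ) 0) where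
  to_finiteDimensional := by
    convert! (inferInstance : FiniteDimensional ℚ (QuadraticAlgebra ℚ (-q : ℚ) 0))

theorem finrank_rat : @Module.finrank ℚ (QuadraticAlgebra ℚ (-q : ℚ) 0) _ _
    (DivisionRing.toRatAlgebra.toModule) = 2 := by
  convert Module.finrank_eq_card_basis (basis (-q : ℚ) 0)
  rw [Fintype.card_fin]

theorem algebraNorm_eq (z : QuadraticAlgebra ℚ (-q : ℚ) 0) :
    @Algebra.norm ℚ (QuadraticAlgebra ℚ (-q : ℚ) 0) _ _ DivisionRing.toRatAlgebra z = norm z := by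
  rw [← det_toLinearMap_eq_norm]
  convert Algebra.norm_apply ℚ z
  rfl

theorem isIntegral_star {z : QuadraticAlgebra ℚ (-q : ℚ) 0} (hz : IsIntegral ℤ z) :
    IsIntegral ℤ (star z) :=
  hz.map (starRingEnd (QuadraticAlgebra ℚ (-q : ℚ) 0)).toIntAlgHom

theorem isIntegral_C_iff {r : ℚ} :
    IsIntegral ℤ (.C r : QuadraticAlgebra ℚ (-q : ℚ) 0) ↔ ∃ m : ℤ, (m : ℚ) = r := by
  have h : (.C r : QuadraticAlgebra ℚ (-q : ℚ) 0) = algebraMap ℚ _ r := rfl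
  rw [h, isIntegral_algebraMap_iff (algebraMap ℚ (QuadraticAlgebra ℚ (-q : ℚ) 0)).injective,
    IsIntegrallyClosed.isIntegral_iff]
  rfl

theorem exists_two_mul_eq (hq : q.Prime) {z : QuadraticAlgebra ℚ (-q : ℚ) 0}
    (hz : IsIntegral ℤ z) : ∃ a b : ℤ, (a : ℚ) = 2 * z.re ∧ (b : ℚ) = 2 * z.im := by
  have e1 : z + star z = .C (2 * z.re) := by
    refine QuadraticAlgebra.ext ?_ ?_
    · change z.re + (z.re + 0 * z.im) = 2 * z.re
      ring
    · change z.im + -z.im = 0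
      ring
  have e2 : z * star z = .C (z.re ^ 2 + q * z.im ^ 2) := by
    refine QuadraticAlgebra.ext ?_ ?_
    · change z.re * (z.re + 0 * z.im) + -q * z.im * -z.im = z.re ^ 2 + q * z.im ^ 2
      ring
    · change z.re * -z.im + z.im * (z.re + 0 * z.im) + 0 * z.im * -z.im = 0
      ring
  obtain ⟨a, ha⟩ := isIntegral_C_iff.mp (e1 ▸ hz.add (isIntegral_star hz))
  obtain ⟨n, hn⟩ := isIntegral_C_iff.mp (e2 ▸ hz.mul (isIntegral_star hz))
  have hq0 : (q : ℚ) ≠ 0 := by exact_mod_cast hq.ne_zero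
  have h1 : (q * (2 * z.im)) ^ 2 = ((q * (4 * n - a ^ 2) : ℤ) : ℚ) := by
    push_cast
    rw [hn, ha]
    ring
  obtain ⟨m, hm⟩ : ∃ m : ℤ, (m : ℚ) = q * (2 * z.im) :=
    IsIntegrallyClosed.isIntegral_iff.mp <| IsIntegral.of_pow two_pos
      (h1 ▸ isIntegral_algebraMap (A := ℚ) (R := ℤ) (x := (q * (4 * n - a ^ 2) : ℤ)))
  rw [← hm] at h1
  have h2 : (q : ℤ) ∣ m := by
    refine Int.Prime.dvd_pow' hq (k := 2) ⟨4 * n - a ^ 2, by exact_mod_cast h1⟩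
  obtain ⟨b, rfl⟩ := h2
  refine ⟨a, b, ha, mul_left_cancel₀ hq0 ?_⟩
  rw [← hm]
  push_cast
  rfl

theorem omega_mul_omega_eq_neg :
    (omega : QuadraticAlgebra ℚ (-q : ℚ) 0) * omega =
      ((-(q : ℤ) : ℤ) : QuadraticAlgebra ℚ (-q : ℚ) 0) := by
  rw [omega_mul_omega_eq_mk]
  exact QuadraticAlgebra.ext (by simp) (by simp)

end QuadraticAlgebra

namespace Zsqrtd

open NumberField QuadraticAlgebra

variable {q : ℕ} [Fact (∀ r : ℚ, r ^ 2 ≠ (-q : ℚ) + 0 * r)]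

theorem isIntegral_omega : IsIntegral ℤ (omega : QuadraticAlgebra ℚ (-q : ℚ) 0) := by
  refine IsIntegral.of_pow two_pos ?_
  rw [pow_two, omega_mul_omega_eq_neg]
  exact isIntegral_algebraMap (R := ℤ) (x := -(q : ℤ))

variable (q) in
/-- The inclusion of `ℤ[√-q]` in the maximal order. -/
noncomputable def toRingOfIntegers : ℤ√(-(q : ℤ)) →+* 𝓞 (QuadraticAlgebra ℚ (-q : ℚ) 0) :=
  lift ⟨⟨omega, isIntegral_omega⟩, by
    exact RingOfIntegers.ext omega_mul_omega_eq_neg⟩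

theorem coe_toRingOfIntegers (α : ℤ√(-(q : ℤ))) :
    (toRingOfIntegers q α : QuadraticAlgebra ℚ (-q : ℚ) 0) = ⟨α.re, α.im⟩ := by
  change (α.re : QuadraticAlgebra ℚ (-q : ℚ) 0) +
    α.im * (omega : QuadraticAlgebra ℚ (-q : ℚ) 0) = _
  exact QuadraticAlgebra.ext (by simp) (by simp)

theorem toRingOfIntegers_injective : Function.Injective (toRingOfIntegers q) := by
  intro α β h
  have h' := congrArg (fun x : 𝓞 _ ↦ (x : QuadraticAlgebra ℚ (-q : ℚ) 0)) h
  simp only [coe_toRingOfIntegers, QuadraticAlgebra.mk.injEq, Int.cast_inj] at h'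
  exact Zsqrtd.ext h'.1 h'.2

theorem exists_toRingOfIntegers_eq_two_mul (hq : q.Prime)
    (s : 𝓞 (QuadraticAlgebra ℚ (-q : ℚ) 0)) : ∃ o, toRingOfIntegers q o = 2 * s := by
  obtain ⟨a, b, ha, hb⟩ := exists_two_mul_eq hq s.2
  refine ⟨⟨a, b⟩, RingOfIntegers.ext ?_⟩
  rw [coe_toRingOfIntegers, two_mul]
  refine QuadraticAlgebra.ext ?_ ?_
  · exact ha.trans (two_mul _)
  · exact hb.trans (two_mul _)

theorem absNorm_span_toRingOfIntegers (α : ℤ√(-(q : ℤ))) :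
    Ideal.absNorm (Ideal.span {toRingOfIntegers q α}) = α.norm.natAbs := by
  rw [Ideal.absNorm_span_singleton]
  congr 1
  have h := Algebra.coe_norm_int (toRingOfIntegers q α)
  rw [algebraNorm_eq, coe_toRingOfIntegers] at h
  have h' : (Algebra.norm ℤ (toRingOfIntegers q α) : ℚ) = (α.norm : ℚ) := by
    rw [h, norm_neg_natCast, QuadraticAlgebra.norm_def]
    push_cast
    ring
  exact_mod_cast h'

theorem finrank_ringOfIntegers :
    Module.finrank ℤ (𝓞 (QuadraticAlgebra ℚ (-q : ℚ) 0)) = 2 := by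
  rw [RingOfIntegers.rank, finrank_rat]

theorem exists_containsOdd_comapClass_eq [IsDomain (ℤ√(-(q : ℤ)))] (hq : q.Prime) (hqo : Odd q)
    (c : Additive (ClassGroup (ℤ√(-(q : ℤ))))) :
    ∃ I : Ideal (𝓞 (QuadraticAlgebra ℚ (-q : ℚ) 0)),
      I.ContainsOdd ∧ Ideal.comapClass (toRingOfIntegers q) I = c := by
  have hq1 : (1 : ZMod 2) * 1 = ((-(q : ℤ) : ℤ) : ZMod 2) := by
    rw [one_mul, eq_comm, ZMod.intCast_eq_one_iff_odd, odd_neg]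
    exact_mod_cast hqo
  let f : ℤ√(-(q : ℤ)) →+* ZMod 2 := lift ⟨1, hq1⟩
  have hf (x) : f x = parity _ x := by
    change (x.re : ZMod 2) + x.im * 1 = x.re + x.im
    rw [mul_one]
  refine Ideal.exists_containsOdd_comapClass_eq toRingOfIntegers_injective
    (exists_toRingOfIntegers_eq_two_mul hq) (RingHom.ker_ne_top f) (fun x hx ↦ ?_) c
  refine containsOdd_span_of_odd_norm ((parity_eq_one_iff hqo x).mp ?_)
  rw [RingHom.mem_ker, hf] at hx
  generalize parity _ x = y at hx
  decide +revert

end Zsqrtd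

section principalVonMangoldt

open Filter Topology Ideal NumberField

theorem tendsto_div_of_abs_sub_le_sqrt {f : ℕ → ℝ} {κ C : ℝ}
    (h : ∀ n : ℕ, |f n - κ * n| ≤ C * √n) : Tendsto (fun n : ℕ ↦ f n / n) atTop (𝓝 κ) := by
  rw [tendsto_iff_norm_sub_tendsto_zero]
  have h0 : Tendsto (fun n : ℕ ↦ C * (√(n : ℝ))⁻¹) atTop (𝓝 (C * 0)) :=
    (tendsto_inv_atTop_zero.comp
      (Real.tendsto_sqrt_atTop.comp tendsto_natCast_atTop_atTop)).const_mul C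
  rw [mul_zero] at h0
  refine squeeze_zero' (Eventually.of_forall fun _ ↦ norm_nonneg _) ?_ h0
  filter_upwards [eventually_gt_atTop 0] with n hn
  have hn' : (0 : ℝ) < n := by exact_mod_cast hn
  have e : f n / n - κ = (f n - κ * n) / n := by field_simp
  rw [e, norm_div, Real.norm_eq_abs, Real.norm_of_nonneg hn'.le, div_le_iff₀ hn']
  refine (h n).trans_eq ?_
  rw [mul_assoc]
  congr 1
  rw [eq_inv_mul_iff_mul_eq₀ (Real.sqrt_pos.mpr hn').ne', Real.mul_self_sqrt hn'.le]

namespace Zsqrtd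

variable {q : ℕ} [Fact (∀ r : ℚ, r ^ 2 ≠ (-q : ℚ) + 0 * r)] [IsDomain (ℤ√(-(q : ℤ)))]

theorem sum_card_oddIdeals_le (F : Finset (Additive (ClassGroup (ℤ√(-(q : ℤ)))))) (n : ℕ) :
    ∑ c ∈ F, (oddIdeals (toRingOfIntegers q) c n).card ≤
      Nat.card {I : Ideal (𝓞 (QuadraticAlgebra ℚ (-q : ℚ) 0)) // absNorm I ≤ (n : ℝ)} := by
  classical
  rw [← Finset.card_biUnion]
  · have hfin : {I : Ideal (𝓞 (QuadraticAlgebra ℚ (-q : ℚ) 0)) | absNorm I ≤ (n : ℝ)}.Finite := by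
      simpa only [Nat.cast_le] using
        finite_setOfPred_absNorm_le (S := 𝓞 (QuadraticAlgebra ℚ (-q : ℚ) 0)) n
    have hcard := Nat.card_coe_set_eq
      {I : Ideal (𝓞 (QuadraticAlgebra ℚ (-q : ℚ) 0)) | absNorm I ≤ (n : ℝ)}
    refine le_of_le_of_eq ?_ hcard.symm
    rw [← Set.ncard_coe_finset (F.biUnion _)]
    refine Set.ncard_le_ncard (fun I hI ↦ ?_) hfin
    simp only [Finset.coe_biUnion, Set.mem_iUnion, Finset.mem_coe, mem_oddIdeals] at hI
    obtain ⟨_, _, hI, -⟩ := hI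
    exact Nat.cast_le (α := ℝ).mpr hI
  · refine fun c _ d _ hcd ↦ Finset.disjoint_left.mpr fun I hI hI' ↦ hcd ?_
    exact (mem_oddIdeals.mp hI).2.2.symm.trans (mem_oddIdeals.mp hI').2.2

theorem finite_classGroup (hq : q.Prime) (hqo : Odd q) : Finite (ClassGroup (ℤ√(-(q : ℤ)))) := by
  suffices Finite (Additive (ClassGroup (ℤ√(-(q : ℤ))))) from this
  by_contra hinf
  rw [not_finite_iff_infinite] at hinf
  have hκ : 0 < LatticeCount.area q / 4 := div_pos (LatticeCount.area_pos hq.pos) four_pos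
  obtain ⟨L, hL⟩ : ∃ L, Tendsto (fun s : ℝ ↦ (Nat.card
      {I : Ideal (𝓞 (QuadraticAlgebra ℚ (-q : ℚ) 0)) // absNorm I ≤ s} : ℝ) / s) atTop (𝓝 L) :=
    ⟨_, NumberField.Ideal.tendsto_norm_le_div_atTop (QuadraticAlgebra ℚ (-q : ℚ) 0)⟩
  obtain ⟨m, hm⟩ := exists_nat_gt (L / (LatticeCount.area q / 4))
  obtain ⟨F, hF⟩ := Infinite.exists_subset_card_eq (Additive (ClassGroup (ℤ√(-(q : ℤ))))) m
  have h1 : Tendsto (fun n : ℕ ↦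
      ∑ c ∈ F, ((oddIdeals (toRingOfIntegers q) c n).card : ℝ) / n) atTop
      (𝓝 (∑ c ∈ F, LatticeCount.area q / 4)) := by
    refine tendsto_finsetSum _ fun c _ ↦ ?_
    obtain ⟨C, hC⟩ := exists_abs_sum_fiberCard_sub_le hq.one_lt hqo toRingOfIntegers_injective
      (exists_toRingOfIntegers_eq_two_mul hq) absNorm_span_toRingOfIntegers
      (exists_containsOdd_comapClass_eq hq hqo) c
    refine tendsto_div_of_abs_sub_le_sqrt (C := C) fun n ↦ ?_
    rw [card_oddIdeals]
    exact_mod_cast hC n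
  have h2 := le_of_tendsto_of_tendsto h1 (hL.comp tendsto_natCast_atTop_atTop)
    (Eventually.of_forall fun n ↦ by
      change ∑ c ∈ F, ((oddIdeals (toRingOfIntegers q) c n).card : ℝ) / n ≤ _ / (n : ℝ)
      rw [← Finset.sum_div]
      exact div_le_div_of_nonneg_right (by exact_mod_cast sum_card_oddIdeals_le F n)
        (Nat.cast_nonneg n))
  rw [Finset.sum_const, hF, nsmul_eq_mul] at h2
  rw [div_lt_iff₀ hκ] at hm
  exact h2.not_gt hm

variable (q) in
/-- The sum of the von Mangoldt function over the principal ideals of odd norm `n` generated by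
elements of `ℤ[√-q]`. -/
noncomputable def principalVonMangoldt (n : ℕ) : ℝ :=
  kerVonMangoldt
    (fun I : Ideal (𝓞 (QuadraticAlgebra ℚ (-q : ℚ) 0)) ↦ Odd (absNorm I))
    (comapClass (toRingOfIntegers q)) n

theorem tendsto_sum_principalVonMangoldt (hq : q.Prime) (hq4 : q % 4 = 3) :
    Tendsto (fun n : ℕ ↦ (∑ k ∈ Finset.Icc 1 n, principalVonMangoldt q k) / n) atTop
      (𝓝 (1 / Nat.card (ClassGroup (ℤ√(-(q : ℤ)))))) := by
  have hqo : Odd q := by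
    rw [Nat.odd_iff]
    lia
  have := finite_classGroup hq hqo
  have hfin : Finite (Additive (ClassGroup (ℤ√(-(q : ℤ))))) := this
  have h2 := exists_toRingOfIntegers_eq_two_mul hq
  refine tendsto_sum_kerVonMangoldt (A := Additive (ClassGroup (ℤ√(-(q : ℤ)))))
    (fun c hc ↦ eq_zero_of_add_self_eq_zero hq hq4 toRingOfIntegers_injective h2
      absNorm_span_toRingOfIntegers (exists_containsOdd_comapClass_eq hq hqo) hc) ?_ ?_ ?_
    (div_pos (LatticeCount.area_pos hq.pos) four_pos)
    (exists_abs_sum_fiberCard_sub_le hq.one_lt hqo toRingOfIntegers_injective h2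
      absNorm_span_toRingOfIntegers (exists_containsOdd_comapClass_eq hq hqo))
  · rw [absNorm_top]
    exact odd_one
  · intro I J
    rw [map_mul, Nat.odd_mul]
  · exact fun I J hI hJ ↦ (containsOdd_of_odd_absNorm hI).comapClass_mul
      toRingOfIntegers_injective h2 (containsOdd_of_odd_absNorm hJ)

end Zsqrtd

end principalVonMangoldt

section chebyshev

open Filter Topology Asymptotics

namespace Chebyshev

open ArithmeticFunction in
theorem tendsto_psi_div : Tendsto (fun n : ℕ ↦ ψ n / n) atTop (𝓝 1) := by
  have h := wienerIkehara (f := fun n ↦ vonMangoldt n) (A := 1) (C := Real.log 4 + 4)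
    (fun n ↦ vonMangoldt_nonneg) (fun n ↦ ?_)
    (vonMangoldt.continuousOn_LFunctionResidueClassAux (q := 1) 1) fun s hs ↦ ?_
  · refine h.congr fun n ↦ ?_
    rw [psi_eq_sum_Icc, Nat.floor_natCast, ← Finset.add_sum_Ioc_eq_sum_Icc (Nat.zero_le n),
      ArithmeticFunction.map_zero, zero_add]
    rfl
  · refine le_trans ?_ (psi_le_const_mul_self (Nat.cast_nonneg n))
    rw [psi_eq_sum_Icc, Nat.floor_natCast]
    exact Finset.sum_le_sum_of_subset_of_nonneg (Finset.Icc_subset_Icc_left zero_le_one)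
      fun _ _ _ ↦ vonMangoldt_nonneg
  · have h1 := vonMangoldt.eqOn_LFunctionResidueClassAux (q := 1) (a := 1) isUnit_one hs
    have h2 : vonMangoldt.residueClass (1 : ZMod 1) = fun n ↦ vonMangoldt n := by
      ext n
      exact Set.indicator_of_mem (s := {n : ℕ | (n : ZMod 1) = 1})
        (Subsingleton.elim (n : ZMod 1) 1) fun n ↦ vonMangoldt n
    rw [h1, h2]
    simp

theorem tendsto_theta_sub_psi_div :
    Tendsto (fun n : ℕ ↦ (ψ n - θ n) / n) atTop (𝓝 0) := by
  have h1 : Tendsto (fun x : ℝ ↦ Real.log x / x ^ (1 / 2 : ℝ)) atTop (𝓝 0) :=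
    (isLittleO_log_rpow_atTop (by norm_num)).tendsto_div_nhds_zero
  have h2 := (h1.comp (tendsto_natCast_atTop_atTop (R := ℝ))).const_mul 2
  rw [mul_zero] at h2
  refine squeeze_zero' ?_ ?_ h2
  · exact Eventually.of_forall fun n ↦
      div_nonneg (sub_nonneg.mpr (theta_le_psi n)) (Nat.cast_nonneg n)
  · filter_upwards [eventually_ge_atTop 1] with n hn
    have hn1 : (1 : ℝ) ≤ n := by exact_mod_cast hn
    have hn0 : (0 : ℝ) < n := by linarith
    have hs := Real.sqrt_pos.mpr hn0
    rw [Function.comp_apply, ← Real.sqrt_eq_rpow, div_le_iff₀ hn0]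
    refine (psi_sub_theta_le hn1).trans_eq ?_
    rw [mul_assoc, mul_assoc]
    congr 1
    rw [div_mul_eq_mul_div, eq_div_iff hs.ne', mul_comm (√(n : ℝ)), mul_assoc,
      Real.mul_self_sqrt hn0.le]

theorem tendsto_theta_div : Tendsto (fun n : ℕ ↦ θ n / n) atTop (𝓝 1) := by
  have h := tendsto_psi_div.sub tendsto_theta_sub_psi_div
  rw [sub_zero] at h
  exact h.congr fun n ↦ by ring

theorem tendsto_primeCounting_mul_log_sub_theta_div :
    Tendsto (fun n : ℕ ↦ (n.primeCounting * Real.log n - θ n) / n) atTop (𝓝 0) := by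
  have h1 : (fun x : ℝ ↦ (⌊x⌋₊.primeCounting * Real.log x - θ x) / x) =O[atTop]
      fun x ↦ (Real.log x)⁻¹ := by
    have h2 := primeCounting_sub_theta_div_log_isBigO.mul
      (isBigO_refl (fun x : ℝ ↦ Real.log x / x) atTop)
    refine h2.congr' ?_ ?_
    · filter_upwards [eventually_gt_atTop 1] with x hx
      have := Real.log_pos hx
      field_simp
    · filter_upwards [eventually_gt_atTop 1] with x hx
      have := Real.log_pos hx
      field_simp
  have h3 := h1.trans_tendsto (tendsto_inv_atTop_zero.comp Real.tendsto_log_atTop)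
  refine (h3.comp tendsto_natCast_atTop_atTop).congr fun n ↦ ?_
  rw [Function.comp_apply, Nat.floor_natCast]

theorem tendsto_primeCounting_mul_log_div :
    Tendsto (fun n : ℕ ↦ n.primeCounting * Real.log n / n) atTop (𝓝 1) := by
  have h := tendsto_primeCounting_mul_log_sub_theta_div.add tendsto_theta_div
  rw [zero_add] at h
  exact h.congr fun n ↦ by ring

end Chebyshev

open Chebyshev

theorem Nat.ncard_setOf_prime_le (n : ℕ) : {p : ℕ | p ≤ n ∧ p.Prime}.ncard = n.primeCounting := by
  rw [← Nat.primesLE_card_eq_primeCounting, ← Set.ncard_coe_finset]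
  congr 1
  ext p
  simp [Nat.mem_primesLE]

open Classical in
/-- A set of primes whose logarithms sum to `(δ + o(1)) n` has relative density `δ`. -/
theorem tendsto_ncard_div_ncard_primes {s : Set ℕ} (hs : ∀ p ∈ s, p.Prime) {δ : ℝ}
    (h : Tendsto (fun n : ℕ ↦ (∑ p ∈ (Finset.Icc 0 n).filter (· ∈ s), Real.log p) / n) atTop
      (𝓝 δ)) :
    Tendsto (fun n : ℕ ↦ ({p : ℕ | p ≤ n ∧ p ∈ s}.ncard : ℝ) /
      {p : ℕ | p ≤ n ∧ p.Prime}.ncard) atTop (𝓝 δ) := by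
  have hcard (n : ℕ) : {p : ℕ | p ≤ n ∧ p ∈ s}.ncard = ((Finset.Icc 0 n).filter (· ∈ s)).card := by
    rw [← Set.ncard_coe_finset]
    congr 1
    ext p
    simp
  have hsub (n : ℕ) : ((Finset.Icc 0 n).filter (· ∈ s)) ⊆ (Finset.Icc 0 n).filter Nat.Prime :=
    Finset.monotone_filter_right _ fun p _ ↦ hs p
  have hpi (n : ℕ) : n.primeCounting = ((Finset.Icc 0 n).filter Nat.Prime).card := by
    rw [← Nat.ncard_setOf_prime_le, ← Set.ncard_coe_finset]
    congr 1
    ext p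
    simp
  have e (t : Finset ℕ) (n : ℕ) : (t.card : ℝ) * Real.log n - ∑ p ∈ t, Real.log p =
      ∑ p ∈ t, (Real.log n - Real.log p) := by
    rw [Finset.sum_sub_distrib, Finset.sum_const, nsmul_eq_mul]
  have hnn (n : ℕ) : ∀ p ∈ (Finset.Icc 0 n).filter Nat.Prime,
      0 ≤ Real.log n - Real.log p := fun p hp ↦ by
    rw [Finset.mem_filter, Finset.mem_Icc] at hp
    exact sub_nonneg.mpr (Real.log_le_log (by exact_mod_cast hp.2.pos) (by exact_mod_cast hp.1.2))
  have h1 : Tendsto (fun n : ℕ ↦ (((Finset.Icc 0 n).filter (· ∈ s)).card * Real.log n -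
      ∑ p ∈ (Finset.Icc 0 n).filter (· ∈ s), Real.log p) / n) atTop (𝓝 0) := by
    refine squeeze_zero (fun n ↦ ?_) (fun n ↦ ?_) tendsto_primeCounting_mul_log_sub_theta_div
    · rw [e]
      exact div_nonneg (Finset.sum_nonneg fun p hp ↦ hnn n p (hsub n hp)) (Nat.cast_nonneg n)
    · refine div_le_div_of_nonneg_right ?_ (Nat.cast_nonneg n)
      rw [theta_eq_sum_Icc, Nat.floor_natCast, hpi, e, e]
      exact Finset.sum_le_sum_of_subset_of_nonneg (hsub n) fun p hp _ ↦ hnn n p hp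
  have h2 := (h1.add h).div tendsto_primeCounting_mul_log_div one_ne_zero
  rw [zero_add, div_one] at h2
  refine h2.congr' ?_
  filter_upwards [eventually_ge_atTop 2] with n hn
  have hn0 : (0 : ℝ) < n := by exact_mod_cast (by lia : 0 < n)
  have hlog : 0 < Real.log n := Real.log_pos (by exact_mod_cast hn)
  simp only [Pi.div_apply]
  rw [Nat.ncard_setOf_prime_le, hcard, ← add_div, sub_add_cancel,
    div_div_div_cancel_right₀ hn0.ne', mul_div_mul_right _ _ hlog.ne']

end chebyshev

section representablePrimes

open Filter Topology Ideal NumberField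

namespace Zsqrtd

variable {q : ℕ} [Fact (∀ r : ℚ, r ^ 2 ≠ (-q : ℚ) + 0 * r)] [IsDomain (ℤ√(-(q : ℤ)))]

theorem principalVonMangoldt_nonneg (n : ℕ) : 0 ≤ principalVonMangoldt q n :=
  kerVonMangoldt_nonneg n

theorem principalVonMangoldt_le (n : ℕ) :
    principalVonMangoldt q n ≤ 2 * ArithmeticFunction.vonMangoldt n := by
  refine (kerVonMangoldt_le n).trans_eq ?_
  rw [finrank_ringOfIntegers, Nat.cast_ofNat]

omit [Fact (∀ r : ℚ, r ^ 2 ≠ (-q : ℚ) + 0 * r)] [IsDomain (ℤ√(-(q : ℤ)))] in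
theorem norm_mk_neg_natCast (x y : ℤ) :
    (⟨x, y⟩ : ℤ√(-(q : ℤ))).norm = x ^ 2 + q * y ^ 2 := by
  rw [norm_def]
  ring

theorem principalVonMangoldt_eq_zero (hq : q.Prime) {p : ℕ}
    (hp : ¬ ∃ x y : ℤ, (p : ℤ) = x ^ 2 + q * y ^ 2) : principalVonMangoldt q p = 0 := by
  rw [principalVonMangoldt, kerVonMangoldt]
  refine Finset.sum_eq_zero fun I hI ↦ absurd ?_ hp
  simp only [Finset.mem_filter, mem_ofAbsNorm] at hI
  obtain ⟨hIp, hodd, hI0⟩ := hI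
  obtain ⟨α, hα⟩ := (containsOdd_of_odd_absNorm hodd).exists_eq_span_of_comapClass_eq_zero
    toRingOfIntegers_injective (exists_toRingOfIntegers_eq_two_mul hq) hI0
  refine ⟨α.re, α.im, ?_⟩
  rw [hα, absNorm_span_toRingOfIntegers] at hIp
  rw [← norm_mk_neg_natCast, ← hIp, Int.natCast_natAbs, abs_of_nonneg]
  rw [norm_mk_neg_natCast (q := q) α.re α.im]
  positivity

theorem two_mul_log_le_principalVonMangoldt (hq : q.Prime) (hq2 : 2 < q) {p : ℕ} (hp : p.Prime)
    (hpq : p ≠ q) {x y : ℤ} (h : (p : ℤ) = x ^ 2 + q * y ^ 2) :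
    2 * Real.log p ≤ principalVonMangoldt q p := by
  have h2 := exists_toRingOfIntegers_eq_two_mul hq
  have hy : y ≠ 0 := by
    rintro rfl
    refine (Nat.prime_iff_prime_int.mp hp).not_isSquare ⟨x, ?_⟩
    rw [h]
    ring
  have hx : x ≠ 0 := by
    rintro rfl
    refine hpq ((Nat.prime_dvd_prime_iff_eq hq hp).mp ?_).symm
    exact Int.natCast_dvd_natCast.mp ⟨y ^ 2, by rw [h]; ring⟩
  have hpo : Odd p := hp.odd_of_ne_two fun hp2 ↦ by
    have h1 : 1 ≤ y ^ 2 := sq_pos_of_ne_zero hy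
    have h3 : (2 : ℤ) < q := by exact_mod_cast hq2
    rw [hp2, Nat.cast_ofNat] at h
    nlinarith [sq_nonneg x]
  have hnorm {z : ℤ} (hz : z ^ 2 = y ^ 2) : (⟨x, z⟩ : ℤ√(-(q : ℤ))).norm = p := by
    rw [norm_mk_neg_natCast, hz, h]
  have hodd {z : ℤ} (hz : z ^ 2 = y ^ 2) : Odd (⟨x, z⟩ : ℤ√(-(q : ℤ))).norm := by
    rw [hnorm hz]
    exact_mod_cast hpo
  let P (z : ℤ) : Ideal (𝓞 (QuadraticAlgebra ℚ (-q : ℚ) 0)) := span {toRingOfIntegers q ⟨x, z⟩}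
  have hP {z : ℤ} (hz : z ^ 2 = y ^ 2) : absNorm (P z) = p := by
    rw [absNorm_span_toRingOfIntegers, hnorm hz, Int.natAbs_natCast]
  have hy' : (-y) ^ 2 = y ^ 2 := neg_sq y
  have hne : P y ≠ P (-y) := by
    intro hPP
    rcases eq_or_eq_neg_of_span_map_eq hq.one_lt toRingOfIntegers_injective h2 (hodd rfl)
      (hodd hy') hPP with h' | h'
    · exact hy (self_eq_neg.mp (congrArg im h'))
    · exact hx (self_eq_neg.mp (congrArg re h'))
  have hvon {z : ℤ} (hz : z ^ 2 = y ^ 2) : vonMangoldt (P z) = Real.log p := by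
    have hpr : (P z).IsPrime := isPrime_of_irreducible_absNorm (by rw [hP hz]; exact hp)
    rw [vonMangoldt_of_prime (prime_of_isPrime ?_ hpr), hP hz]
    intro h0
    have := hP hz
    rw [h0, absNorm_bot] at this
    exact hp.ne_zero this.symm
  classical
  rw [principalVonMangoldt, kerVonMangoldt]
  calc 2 * Real.log p = ∑ I ∈ {P y, P (-y)}, vonMangoldt I := by
        rw [Finset.sum_pair hne, hvon rfl, hvon hy', two_mul]
    _ ≤ _ := by
        refine Finset.sum_le_sum_of_subset_of_nonneg ?_ fun I _ _ ↦ vonMangoldt_nonneg I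
        have hmem {z : ℤ} (hz : z ^ 2 = y ^ 2) : absNorm (P z) = p ∧ Odd (absNorm (P z)) ∧
            comapClass (toRingOfIntegers q) (P z) = 0 :=
          ⟨hP hz, by rwa [hP hz], comapClass_span_eq_zero toRingOfIntegers_injective h2
            (containsOdd_span_of_odd_norm (hodd hz))⟩
        intro I hI
        simp only [Finset.mem_filter, mem_ofAbsNorm]
        rcases Finset.mem_insert.mp hI with rfl | hI
        · exact hmem rfl
        · rw [Finset.mem_singleton.mp hI]
          exact hmem hy'

variable (q) in
/-- The primes other than `q` represented by the form `x² + qy²`. -/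
def representablePrimes : Set ℕ :=
  {p | p.Prime ∧ p ≠ q ∧ ∃ x y : ℤ, (p : ℤ) = x ^ 2 + q * y ^ 2}

open Classical in
theorem principalVonMangoldt_sub_nonneg (hq : q.Prime) (hq2 : 2 < q) (k : ℕ) :
    0 ≤ principalVonMangoldt q k -
      2 * (if k ∈ representablePrimes q then Real.log k else 0) := by
  split_ifs with h
  · obtain ⟨hk, hkq, x, y, hxy⟩ := h
    exact sub_nonneg.mpr (two_mul_log_le_principalVonMangoldt hq hq2 hk hkq hxy)
  · rw [mul_zero, sub_zero]
    exact principalVonMangoldt_nonneg k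

open Classical in
theorem principalVonMangoldt_sub_le (hq : q.Prime) (k : ℕ) :
    principalVonMangoldt q k - 2 * (if k ∈ representablePrimes q then Real.log k else 0) ≤
      2 * (ArithmeticFunction.vonMangoldt k - if k.Prime then Real.log k else 0) +
        if k = q then 2 * Real.log q else 0 := by
  have h3 : (0 : ℝ) ≤ if k = q then 2 * Real.log q else 0 := by
    split_ifs
    · exact mul_nonneg two_pos.le (Real.log_natCast_nonneg q)
    · exact le_rfl
  have hle := principalVonMangoldt_le (q := q) k
  by_cases hk : k.Prime
  · rw [ArithmeticFunction.vonMangoldt_apply_prime hk] at hle ⊢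
    rw [if_pos hk]
    by_cases hkr : k ∈ representablePrimes q
    · rw [if_pos hkr]
      linarith
    rw [if_neg hkr]
    by_cases hkq : k = q
    · subst hkq
      rw [if_pos rfl]
      linarith
    rw [principalVonMangoldt_eq_zero hq fun h ↦ hkr ⟨hk, hkq, h⟩]
    linarith
  · rw [if_neg hk, if_neg fun h ↦ hk h.1]
    linarith

open Classical in
theorem tendsto_sum_log_representablePrimes (hq : q.Prime) (hq4 : q % 4 = 3) :
    Tendsto (fun n : ℕ ↦
      (∑ p ∈ (Finset.Icc 0 n).filter (· ∈ representablePrimes q), Real.log p) / n) atTop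
      (𝓝 (1 / (2 * Nat.card (ClassGroup (ℤ√(-(q : ℤ))))))) := by
  have hq2 : 2 < q := by
    have := hq.two_le
    lia
  have hsum (f : ℕ → ℝ) (hf : f 0 = 0) (n : ℕ) :
      ∑ k ∈ Finset.Icc 1 n, f k = ∑ k ∈ Finset.Icc 0 n, f k := by
    refine Finset.sum_subset (Finset.Icc_subset_Icc_left zero_le_one) fun k hk hk' ↦ ?_
    rw [Finset.mem_Icc] at hk hk'
    rw [show k = 0 by lia, hf]
  have h0 : principalVonMangoldt q 0 = 0 :=
    _root_.le_antisymm (by simpa using principalVonMangoldt_le (q := q) 0)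
      (principalVonMangoldt_nonneg 0)
  have hS := tendsto_sum_principalVonMangoldt hq hq4
  simp only [hsum _ h0] at hS
  have hE : Tendsto (fun n : ℕ ↦ (∑ k ∈ Finset.Icc 0 n, principalVonMangoldt q k -
      2 * ∑ p ∈ (Finset.Icc 0 n).filter (· ∈ representablePrimes q), Real.log p) / n) atTop
      (𝓝 0) := by
    have hlim := (Chebyshev.tendsto_theta_sub_psi_div.const_mul 2).add
      (tendsto_const_div_atTop_nhds_zero_nat (2 * Real.log q))
    rw [mul_zero, zero_add] at hlim
    refine squeeze_zero (fun n ↦ ?_) (fun n ↦ ?_) hlim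
    · rw [Finset.sum_filter, Finset.mul_sum, ← Finset.sum_sub_distrib]
      exact div_nonneg (Finset.sum_nonneg fun k _ ↦ principalVonMangoldt_sub_nonneg hq hq2 k)
        (Nat.cast_nonneg n)
    · rw [← mul_div_assoc, ← add_div]
      refine div_le_div_of_nonneg_right ?_ (Nat.cast_nonneg n)
      rw [Finset.sum_filter, Finset.mul_sum, ← Finset.sum_sub_distrib]
      refine (Finset.sum_le_sum fun k _ ↦ principalVonMangoldt_sub_le hq k).trans ?_
      rw [Finset.sum_add_distrib, ← Finset.mul_sum, Finset.sum_sub_distrib,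
        Finset.sum_ite_eq', ← Finset.sum_filter,
        Chebyshev.psi_eq_sum_Icc, Chebyshev.theta_eq_sum_Icc, Nat.floor_natCast]
      have h3 : (0 : ℝ) ≤ 2 * Real.log q :=
        mul_nonneg two_pos.le (Real.log_natCast_nonneg q)
      gcongr
      split_ifs
      · exact le_rfl
      · exact h3
  have h := (hS.sub hE).div_const 2
  rw [sub_zero, div_div, mul_comm _ (2 : ℝ)] at h
  refine h.congr fun n ↦ ?_
  ring

theorem tendsto_ncard_representablePrimes (hq : q.Prime) (hq4 : q % 4 = 3) :
    Tendsto (fun n : ℕ ↦ ({p : ℕ | p ≤ n ∧ p ∈ representablePrimes q}.ncard : ℝ) /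
      {p : ℕ | p ≤ n ∧ p.Prime}.ncard) atTop
      (𝓝 (1 / (2 * Nat.card (ClassGroup (ℤ√(-(q : ℤ))))))) :=
  tendsto_ncard_div_ncard_primes (fun _ hp ↦ hp.1) (tendsto_sum_log_representablePrimes hq hq4)

end Zsqrtd

end representablePrimes

theorem Zsqrtd.adjoin_eq_range_lift {R : Type*} [CommRing R] {d : ℤ} (r : {r : R // r * r = d}) :
    Algebra.adjoin ℤ {(r : R)} = (lift r).toIntAlgHom.range := by
  refine _root_.le_antisymm (Algebra.adjoin_le ?_) ?_
  · rintro _ rfl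
    exact ⟨sqrtd, by simp⟩
  · rintro _ ⟨α, rfl⟩
    have h := Algebra.subset_adjoin (R := ℤ) (Set.mem_singleton (r : R))
    exact add_mem (intCast_mem _ _) (mul_mem (intCast_mem _ _) h)

theorem Zsqrtd.lift_neg_injective {q : ℕ} (hq : 0 < q)
    (r : {r : ℂ // r * r = (-(q : ℤ) : ℤ)}) : Function.Injective (lift r) :=
  lift_injective r fun n hn ↦ by
    have := mul_self_nonneg n
    lia

/-- Let `g ≥ 5` be a Sophie Germain prime and `h` the cardinality of the class group of the
order `ℤ[√-(2g+1)]` (realized as the subring of `ℂ` generated by `√(2g+1)·i`).  Then the set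
of primes `p ≠ 2g+1` representable as `p = x² + (2g+1)y²` has relative natural density
`1/(2h)` among all primes. -/
theorem stmt_2 (g : ℕ) (hg5 : 5 ≤ g) (hg : Nat.Prime g) (hsg : Nat.Prime (2 * g + 1))
    (h : ℕ)
    (hh : h = Nat.card (ClassGroup
      (Algebra.adjoin ℤ {(Real.sqrt (2 * g + 1) : ℂ) * Complex.I}))) :
    Filter.Tendsto
      (fun N : ℕ =>
        (({p : ℕ | p ≤ N ∧ p.Prime ∧ p ≠ 2 * g + 1 ∧
            (∃ x y : ℤ, (p : ℤ) = x ^ 2 + (2 * g + 1) * y ^ 2)}.ncard : ℝ)) /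
          ({p : ℕ | p ≤ N ∧ p.Prime}.ncard : ℝ))
      Filter.atTop
      (nhds (1 / (2 * (h : ℝ)))) := by
  have hq4 : (2 * g + 1) % 4 = 3 := by
    have := hg.odd_of_ne_two (by lia)
    rw [Nat.odd_iff] at this
    lia
  have : Fact (∀ r : ℚ, r ^ 2 ≠ (-(2 * g + 1 : ℕ) : ℚ) + 0 * r) := ⟨fun r hr ↦ by
    have h0 : (0 : ℚ) < (2 * g + 1 : ℕ) := by exact_mod_cast hsg.pos
    nlinarith [sq_nonneg r]⟩
  have hdom : IsDomain (ℤ√(-((2 * g + 1 : ℕ) : ℤ))) := Zsqrtd.toRingOfIntegers_injective.isDomain _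
  let r : {r : ℂ // r * r = (-((2 * g + 1 : ℕ) : ℤ) : ℤ)} :=
    ⟨(Real.sqrt (2 * g + 1) : ℂ) * Complex.I, by
      rw [mul_mul_mul_comm, Complex.I_mul_I, ← Complex.ofReal_mul,
        Real.mul_self_sqrt (by positivity)]
      push_cast
      ring⟩
  have hinj := Zsqrtd.lift_neg_injective hsg.pos r
  let e := (AlgEquiv.ofInjective (Zsqrtd.lift r).toIntAlgHom hinj).trans
    (Subalgebra.equivOfEq _ _ (Zsqrtd.adjoin_eq_range_lift r).symm)
  have hcard : h = Nat.card (ClassGroup (ℤ√(-((2 * g + 1 : ℕ) : ℤ)))) := by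
    rw [hh]
    exact Nat.card_congr (ClassGroup.mulEquiv e.toRingEquiv).symm.toEquiv
  rw [hcard]
  refine (Zsqrtd.tendsto_ncard_representablePrimes hsg hq4).congr fun n ↦ ?_
  congr 4 with p
end

section
/- Let g ≥ 5 be a Sophie Germain prime, let p be a prime, and let a, s be integers with gcd(a, p) = 1, s ≠ 0, and a² − 4p = −(2g+1)s². Then the polynomial t² + a·p^((g−1)/2)·t + p^g is irreducible over ℚ. -/
open Polynomial in
/-- Let `g ≥ 5` be a Sophie Germain prime, `p` a prime, and `a, s` integers with
`gcd(a, p) = 1`, `s ≠ 0` and `a² − 4p = −(2g+1)s²`.  Then the polynomial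
`t² + a·p^((g−1)/2)·t + p^g` is irreducible over `ℚ`. -/
theorem stmt_6 (g : ℕ) (hg5 : 5 ≤ g) (hg : Nat.Prime g) (hsg : Nat.Prime (2 * g + 1))
    (p : ℕ) (hp : p.Prime) (a s : ℤ) (ha : Int.gcd a (p : ℤ) = 1) (hs : s ≠ 0)
    (heq : a ^ 2 - 4 * (p : ℤ) = -(2 * g + 1) * s ^ 2) :
    Irreducible ((X : ℚ[X]) ^ 2 + C ((a : ℚ) * (p : ℚ) ^ ((g - 1) / 2)) * X
      + C ((p : ℚ) ^ g)) := by
  obtain ⟨k, hk⟩ := hg.odd_of_ne_two (by lia)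
  have hhalf : (g - 1) / 2 = k := by lia
  rw [hhalf]
  have hdeg : ((X : ℚ[X]) ^ 2 + C ((a : ℚ) * (p : ℚ) ^ k) * X + C ((p : ℚ) ^ g)).natDegree = 2 := by
    compute_degree!
  refine (irreducible_iff_roots_eq_zero_of_degree_le_three hdeg.ge (by lia)).2 ?_
  refine Multiset.eq_zero_of_forall_notMem fun x hx ↦ ?_
  have hroot := isRoot_of_mem_roots hx
  simp only [IsRoot.def, eval_add, eval_mul, eval_pow, eval_X, eval_C] at hroot
  have heqQ : (a : ℚ) ^ 2 - 4 * p = -(2 * g + 1) * (s : ℚ) ^ 2 := by exact_mod_cast heq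
  have hpow : (p : ℚ) ^ g = p * ((p : ℚ) ^ k) ^ 2 := by rw [hk]; ring
  have hp0 : (0 : ℚ) < p := by exact_mod_cast hp.pos
  have hs0 : (s : ℚ) ≠ 0 := by exact_mod_cast hs
  have hpos : 0 < (2 * g + 1) * (s : ℚ) ^ 2 * ((p : ℚ) ^ k) ^ 2 := by positivity
  have hsq : (2 * x + a * (p : ℚ) ^ k) ^ 2 = -((2 * g + 1) * (s : ℚ) ^ 2 * ((p : ℚ) ^ k) ^ 2) := by
    rw [hpow] at hroot
    linear_combination 4 * hroot + ((p : ℚ) ^ k) ^ 2 * heqQ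
  linarith [sq_nonneg (2 * x + a * (p : ℚ) ^ k)]
end

section
/- Let g ≥ 5 be a Sophie Germain prime, let p be a prime, and let a, s be integers with gcd(a, p) = 1, s ≠ 0, and a² − 4p = −(2g+1)s². Then for any complex root π of the polynomial t² + a·p^((g−1)/2)·t + p^g, the subfield ℚ(π) of ℂ equals the subfield ℚ(√(2g+1)·i) of ℂ; that is, ℚ(π) = ℚ(√-(2g+1)) is an imaginary quadratic field. -/
/-- Two elements related by an affine map with rational coefficients generate the same field. -/
theorem adjoin_singleton_eq_of_affine {x y : ℂ} {b c : ℚ} (hc : c ≠ 0)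
    (h : x = algebraMap ℚ ℂ b + algebraMap ℚ ℂ c * y) :
    IntermediateField.adjoin ℚ {x} = IntermediateField.adjoin ℚ {y} := by
  apply le_antisymm <;> rw [IntermediateField.adjoin_simple_le_iff]
  · rw [h]
    exact add_mem (algebraMap_mem _ b)
      (mul_mem (algebraMap_mem _ c) (IntermediateField.mem_adjoin_simple_self ℚ y))
  · have hc' : algebraMap ℚ ℂ c ≠ 0 := by simpa using hc
    have hy : y = algebraMap ℚ ℂ c⁻¹ * (x - algebraMap ℚ ℂ b) := by
      rw [h, map_inv₀]
      field_simp
      ring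
    rw [hy]
    exact mul_mem (algebraMap_mem _ _)
      (sub_mem (IntermediateField.mem_adjoin_simple_self ℚ x) (algebraMap_mem _ b))

/-- Let `g ≥ 5` be a Sophie Germain prime, `p` a prime, and `a, s` integers with
`gcd(a, p) = 1`, `s ≠ 0` and `a² − 4p = −(2g+1)s²`.  Then for any complex root `π` of
`t² + a·p^((g−1)/2)·t + p^g`, the subfield `ℚ(π)` of `ℂ` equals `ℚ(√(2g+1)·i)`, i.e. the
imaginary quadratic field `ℚ(√-(2g+1))`. -/
theorem stmt_7 (g : ℕ) (hg5 : 5 ≤ g) (hg : Nat.Prime g) (hsg : Nat.Prime (2 * g + 1))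
    (p : ℕ) (hp : p.Prime) (a s : ℤ) (ha : Int.gcd a (p : ℤ) = 1) (hs : s ≠ 0)
    (heq : a ^ 2 - 4 * (p : ℤ) = -(2 * g + 1) * s ^ 2)
    (π : ℂ)
    (hroot : π ^ 2 + (a : ℂ) * (p : ℂ) ^ ((g - 1) / 2) * π + (p : ℂ) ^ g = 0) :
    IntermediateField.adjoin ℚ {π}
      = IntermediateField.adjoin ℚ {(Real.sqrt (2 * g + 1) : ℂ) * Complex.I} := by
  obtain ⟨m, rfl⟩ : Odd g := hg.odd_of_ne_two (by lia)
  rw [show (2 * m + 1 - 1) / 2 = m by lia] at hroot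
  set θ : ℂ := (Real.sqrt (2 * (2 * m + 1 : ℕ) + 1) : ℂ) * Complex.I with hθ
  have hθ2 : θ ^ 2 = -(2 * (2 * m + 1) + 1) := by
    rw [hθ, mul_pow, Complex.I_sq, ← Complex.ofReal_pow, Real.sq_sqrt (by positivity)]
    push_cast
    ring
  have heq' : (a : ℂ) ^ 2 - 4 * p = -(2 * (2 * m + 1) + 1) * s ^ 2 := by exact_mod_cast heq
  have hsq : (2 * π + a * (p : ℂ) ^ m) ^ 2 = ((p : ℂ) ^ m * s * θ) ^ 2 := by
    have hpow : (p : ℂ) ^ (2 * m + 1) = ((p : ℂ) ^ m) ^ 2 * p := by ring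
    rw [hpow] at hroot
    linear_combination 4 * hroot + ((p : ℂ) ^ m) ^ 2 * heq' - ((p : ℂ) ^ m) ^ 2 * s ^ 2 * hθ2
  have hc : (p : ℚ) ^ m * s / 2 ≠ 0 := by
    have : (p : ℚ) ≠ 0 := by exact_mod_cast hp.ne_zero
    have : (s : ℚ) ≠ 0 := by exact_mod_cast hs
    positivity
  rcases sq_eq_sq_iff_eq_or_eq_neg.mp hsq with h | h
  · refine adjoin_singleton_eq_of_affine (b := -(a * (p : ℚ) ^ m) / 2) hc ?_
    simp
    linear_combination h / 2
  · refine adjoin_singleton_eq_of_affine (b := -(a * (p : ℚ) ^ m) / 2) (neg_ne_zero.mpr hc) ?_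
    simp
    linear_combination h / 2
end
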